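/- arXiv:1409.2469 — 4 statements merged into one kernel-verified Lean document; each statement's English description precedes it below -/
import Mathlib

section
/- Let k ≥ 2 be an integer and let G be a connected simple graph such that d(x) + d(y) ≥ t_{k+1} − k + 1 for every pair of nonadjacent vertices x, y, where t_{k+1} is the maximum number of vertices of a subgraph of G that is a tree with at most k+1 leaves. Then G has a spanning tree with at most k leaves. -/
open SimpleGraph

/-- The degree of a vertex: the cardinality of its neighborhood. -/
noncomputable def deg {V : Type*} (G : SimpleGraph V) (x : V) : ℕ :=
  (G.neighborSet x).ncard

/-- The number of leaves (vertices of degree 1) of a subgraph. -/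
noncomputable def leafCount {V : Type*} {G : SimpleGraph V} (H : G.Subgraph) : ℕ :=
  {v : H.verts | (H.coe.neighborSet v).ncard = 1}.ncard

/-- `H` is a tree with at most `k` leaves (a `k`-ended tree). -/
def IsEndedTree {V : Type*} {G : SimpleGraph V} (H : G.Subgraph) (k : ℕ) : Prop :=
  H.coe.IsTree ∧ leafCount H ≤ k

/-- `t_k`: the maximum order of a subgraph of `G` that is a tree with at most `k` leaves. -/
noncomputable def treeOrd {V : Type*} (G : SimpleGraph V) (k : ℕ) : ℕ :=
  sSup {m | ∃ H : G.Subgraph, IsEndedTree H k ∧ H.verts.ncard = m}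

/-- The number of vertices of a longest path in `G`. -/
noncomputable def pathOrd {V : Type*} (G : SimpleGraph V) : ℕ :=
  sSup {m | ∃ (u v : V) (p : G.Walk u v), p.IsPath ∧ p.support.length = m}

/-- `s` is an independent set of vertices of `G`. -/
def IsIndep {V : Type*} (G : SimpleGraph V) (s : Set V) : Prop :=
  s.Pairwise fun a b => ¬ G.Adj a b

/-- `σ₃`: the minimum degree sum over independent triples of vertices. -/
noncomputable def sigma3 {V : Type*} (G : SimpleGraph V) : ℕ :=
  sInf {s | ∃ x y z : V, x ≠ y ∧ x ≠ z ∧ y ≠ z ∧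
    ¬G.Adj x y ∧ ¬G.Adj x z ∧ ¬G.Adj y z ∧ s = deg G x + deg G y + deg G z}

def lset {W : Type*} (T : SimpleGraph W) : Set W := {v | ∃! u, T.Adj v u}

def exch {W : Type*} (T : SimpleGraph W) (b c x y : W) : SimpleGraph W :=
  T.deleteEdges {s(b, c)} ⊔ SimpleGraph.edge x y

lemma exch_adj {W : Type*} (T : SimpleGraph W) {b c x y : W} (hxy : x ≠ y) (u v : W) :
    (exch T b c x y).Adj u v ↔
      (T.Adj u v ∧ ¬ (u = b ∧ v = c) ∧ ¬ (u = c ∧ v = b)) ∨ (u = x ∧ v = y) ∨ (u = y ∧ v = x) := by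
  simp only [exch, SimpleGraph.sup_adj, SimpleGraph.deleteEdges_adj, SimpleGraph.edge_adj,
    Set.mem_singleton_iff, Sym2.eq_iff]
  grind

lemma exch_not_adj {W : Type*} {T : SimpleGraph W} (hT : T.IsTree) {b c x y : W} (hbc : T.Adj b c)
    (h1 : (T.deleteEdges {s(b, c)}).Reachable x c)
    (h2 : (T.deleteEdges {s(b, c)}).Reachable y b) :
    ¬ (T.deleteEdges {s(b, c)}).Reachable x y := by
  intro h
  have hb := (SimpleGraph.isAcyclic_iff_forall_adj_isBridge.1 hT.isAcyclic) hbc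
  rw [SimpleGraph.isBridge_iff] at hb
  exact hb ((h2.symm.trans h.symm).trans h1)

lemma exch_isTree {W : Type*} {T : SimpleGraph W} (hT : T.IsTree) {b c x y : W} (hbc : T.Adj b c)
    (h1 : (T.deleteEdges {s(b, c)}).Reachable x c)
    (h2 : (T.deleteEdges {s(b, c)}).Reachable y b) :
    (exch T b c x y).IsTree := by
  have hn := exch_not_adj hT hbc h1 h2
  have hxy : x ≠ y := by rintro rfl; exact hn (SimpleGraph.Reachable.refl _)
  have hle : T.deleteEdges {s(b, c)} ≤ exch T b c x y := le_sup_left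
  have hbc' : (exch T b c x y).Reachable b c := by
    have : (exch T b c x y).Reachable y x :=
      SimpleGraph.Adj.reachable ((exch_adj T hxy y x).2 (by simp))
    exact ((h2.symm.mono hle).trans this).trans (h1.mono hle)
  refine ⟨?_, ?_⟩
  · have := hT.1.nonempty
    refine ⟨?_⟩
    intro u v
    obtain ⟨p⟩ := hT.1.preconnected u v
    induction p with
    | nil => exact SimpleGraph.Reachable.refl _
    | @cons u w v h p ih =>
      refine SimpleGraph.Reachable.trans ?_ ih
      by_cases e1 : u = b ∧ w = c
      · rw [e1.1, e1.2]; exact hbc'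
      by_cases e2 : u = c ∧ w = b
      · rw [e2.1, e2.2]; exact hbc'.symm
      exact SimpleGraph.Adj.reachable ((exch_adj T hxy u w).2 (Or.inl ⟨h, e1, e2⟩))
  · exact (hT.isAcyclic.anti (SimpleGraph.deleteEdges_le _)).sup_edge_of_not_reachable hn

lemma walk_avoid {W : Type*} {T : SimpleGraph W} {a c u v : W} (p : T.Walk u v)
    (h : a ∉ p.support) : (T.deleteEdges {s(a, c)}).Reachable u v := by
  rw [SimpleGraph.reachable_deleteEdges_iff_exists_walk]
  exact ⟨p, fun he => h (p.fst_mem_support_of_mem_edges he)⟩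

lemma path_interior {W : Type*} {T : SimpleGraph W} {x y a : W} (p : T.Walk y x) (hp : p.IsPath)
    (ha : a ∈ p.support) (hx : a ≠ x) (hy : a ≠ y) :
    ∃ c1 c2, c1 ∈ p.support ∧ c2 ∈ p.support ∧ c1 ≠ c2 ∧ T.Adj a c1 ∧ T.Adj a c2 ∧
      (T.deleteEdges {s(a, c2)}).Reachable x c2 ∧ (T.deleteEdges {s(a, c2)}).Reachable y a := by
  classical
  obtain ⟨r, q, rfl⟩ := SimpleGraph.Walk.mem_support_iff_exists_append.1 ha
  cases q with
  | nil => exact absurd rfl hx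
  | @cons _ c2 _ h q =>
    have hr : ¬ r.Nil := fun hn => hy hn.eq.symm
    have hnd : (r.append (SimpleGraph.Walk.cons h q)).support.Nodup := hp.support_nodup
    rw [SimpleGraph.Walk.support_append] at hnd
    simp only [SimpleGraph.Walk.support_cons, List.tail_cons] at hnd
    rw [List.nodup_append'] at hnd
    obtain ⟨n1, n2, n3⟩ := hnd
    have hc1 : r.penultimate ∈ r.support := SimpleGraph.Walk.getVert_mem_support _ _
    refine ⟨r.penultimate, c2, ?_, ?_, ?_, (SimpleGraph.Walk.adj_penultimate hr).symm, h, ?_, ?_⟩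
    · simp [SimpleGraph.Walk.support_append, hc1]
    · simp [SimpleGraph.Walk.support_append]
    · intro e
      exact n3 hc1 (by rw [e]; exact q.start_mem_support)
    · exact (walk_avoid q (n3 r.end_mem_support)).symm
    · have : c2 ∉ r.support := fun hh => n3 hh q.start_mem_support
      have := walk_avoid (c := a) r this
      rwa [Sym2.eq_swap] at this

lemma leaves_adj {W : Type*} [Fintype W] {T G : SimpleGraph W} (hT : T.IsTree) (hle : T ≤ G)
    {k : ℕ} (hk : 2 ≤ k) (hc : (lset T).ncard = k + 1) {x y : W} (hx : x ∈ lset T)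
    (hy : y ∈ lset T) (hxy : G.Adj x y) :
    ∃ T' : SimpleGraph W, T'.IsTree ∧ T' ≤ G ∧ (lset T').ncard ≤ k := by
  classical
  have hne := hxy.ne
  obtain ⟨z, hz, hzxy⟩ : ∃ z ∈ lset T, z ∉ ({x, y} : Set W) := by
    refine Set.exists_mem_notMem_of_ncard_lt_ncard ?_
    rw [Set.ncard_pair hne]; omega
  obtain ⟨w⟩ := hT.1.preconnected y x
  obtain ⟨p, hp⟩ : ∃ p : T.Walk y x, p.IsPath := ⟨w.bypass, w.bypass_isPath⟩
  have hzp : z ∉ p.support := by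
    intro h
    obtain ⟨c1, c2, -, -, h12, a1, a2, -⟩ := path_interior p hp h (by grind) (by grind)
    exact h12 (hz.unique a1 a2)
  obtain ⟨q⟩ := hT.1.preconnected x z
  obtain ⟨d, -, hd1, hd2⟩ := q.exists_boundary_dart {v | v ∈ p.support} p.end_mem_support hzp
  obtain ⟨⟨a, c⟩, hac⟩ := d
  simp only [Set.mem_ofPred_eq] at hd1 hd2
  replace hac : T.Adj a c := hac
  have hnn : ¬ p.Nil := fun h => hne h.eq.symm
  have hax : a ≠ x := by
    rintro rfl
    have := hx.unique hac (SimpleGraph.Walk.adj_penultimate hnn).symm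
    exact hd2 (this ▸ SimpleGraph.Walk.getVert_mem_support _ _)
  have hay : a ≠ y := by
    rintro rfl
    have := hy.unique hac (SimpleGraph.Walk.adj_snd hnn)
    exact hd2 (this ▸ SimpleGraph.Walk.getVert_mem_support _ _)
  obtain ⟨c1, c2, s1, s2, h12, a1, a2, r1, r2⟩ := path_interior p hp hd1 hax hay
  have hnr := exch_not_adj hT a2 r1 r2
  have hnxy : ¬ T.Adj x y := by
    intro h
    apply hnr
    refine SimpleGraph.Adj.reachable ?_
    simp only [SimpleGraph.deleteEdges_adj, Set.mem_singleton_iff, Sym2.eq_iff]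
    grind
  refine ⟨exch T a c2 x y, exch_isTree hT a2 r1 r2, ?_, ?_⟩
  · intro u v h
    rw [exch_adj T hne] at h
    rcases h with h | h | h
    · exact hle h.1
    · rw [h.1, h.2]; exact hxy
    · rw [h.1, h.2]; exact hxy.symm
  · have hsub : lset (exch T a c2 x y) ⊆ insert c2 (lset T \ {x, y}) := by
      intro u hu
      by_cases huc : u = c2
      · exact Or.inl huc
      refine Or.inr ?_
      obtain ⟨u', hu', huu⟩ := hu
      simp only [exch_adj T hne] at hu' huu
      obtain ⟨px, hpx, hpxu⟩ := hx
      obtain ⟨py, hpy, hpyu⟩ := hy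
      have e1 : u ≠ x := by
        rintro rfl
        have := huu y (by simp)
        have := huu px (by grind)
        grind
      have e2 : u ≠ y := by
        rintro rfl
        have := huu x (by simp)
        have := huu py (by grind)
        grind [T.adj_comm]
      have e3 : u ≠ a := by
        rintro rfl
        have := huu c (by grind)
        have := huu c1 (by grind)
        grind
      refine ⟨⟨u', by grind, ?_⟩, by simp [e1, e2]⟩
      intro t ht
      exact huu t (by grind)
    have h1 := Set.ncard_le_ncard hsub
    have h2 := Set.ncard_insert_le c2 (lset T \ {x, y})
    have h3 : (lset T \ {x, y}).ncard = (lset T).ncard - 2 := by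
      rw [Set.ncard_sdiff (by intro t ht; rcases ht with rfl | rfl <;> assumption), Set.ncard_pair hne]
    omega

lemma parent {W : Type*} {T : SimpleGraph W} (hT : T.IsTree) (x v : W) (h : v ≠ x) :
    ∃ w, T.Adj v w ∧ T.dist v x = T.dist w x + 1 ∧
      (T.deleteEdges {s(v, w)}).Reachable x w := by
  obtain ⟨p, hp⟩ := hT.1.exists_walk_length_eq_dist v x
  cases p with
  | nil => exact absurd rfl h
  | @cons _ w _ hw q =>
    have hpp : (SimpleGraph.Walk.cons hw q).IsPath := SimpleGraph.Walk.isPath_of_length_eq_dist _ hp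
    rw [SimpleGraph.Walk.cons_isPath_iff] at hpp
    refine ⟨w, hw, ?_, (walk_avoid q hpp.2).symm⟩
    simp only [SimpleGraph.Walk.length_cons] at hp
    have h1 := SimpleGraph.dist_le q
    have h2 := hT.1.dist_triangle (u := v) (v := w) (w := x)
    have h3 : T.dist v w = 1 := SimpleGraph.dist_eq_one_iff_adj.2 hw
    omega

lemma core {W : Type*} [Fintype W] {T G : SimpleGraph W} (hT : T.IsTree) (hle : T ≤ G)
    {k : ℕ} (hk : 2 ≤ k) (hc : (lset T).ncard = k + 1)
    (hmin : ∀ T' : SimpleGraph W, T'.IsTree → T' ≤ G → ¬ (lset T').ncard ≤ k)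
    {x y : W} (hx : x ∈ lset T) (hy : y ∈ lset T) (hxy : x ≠ y) :
    ¬ G.Adj x y ∧ (G.neighborSet x).ncard + (G.neighborSet y).ncard + k ≤ Fintype.card W := by
  classical
  have hind : ∀ u ∈ lset T, ∀ v ∈ lset T, ¬ G.Adj u v := by
    intro u hu v hv h
    obtain ⟨T', h1, h2, h3⟩ := leaves_adj hT hle hk hc hu hv h
    exact hmin T' h1 h2 h3
  have hnxy := hind x hx y hy
  refine ⟨hnxy, ?_⟩
  have hpar : ∀ v, ∃ w, v ≠ x → T.Adj v w ∧ T.dist v x = T.dist w x + 1 ∧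
      (T.deleteEdges {s(v, w)}).Reachable x w := by
    intro v
    by_cases h : v = x
    · exact ⟨v, fun h' => absurd h h'⟩
    · obtain ⟨w, hw⟩ := parent hT x v h
      exact ⟨w, fun _ => hw⟩
  choose f hf using hpar
  -- main exchange facts
  have key : ∀ v, G.Adj x v → f v ≠ x →
      (exch T v (f v) x v).IsTree ∧ exch T v (f v) x v ≤ G ∧ ¬ T.Adj x v ∧
      f v ∉ lset T ∧ lset (exch T v (f v) x v) = insert (f v) (lset T \ {x}) := by
    intro v hv hw
    obtain ⟨f1, f2, f3⟩ := hf v hv.ne'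
    have t1 := exch_isTree hT f1 f3 (SimpleGraph.Reachable.refl v)
    have hnr := exch_not_adj hT f1 f3 (SimpleGraph.Reachable.refl v)
    have hxv := hv.ne
    have t2 : exch T v (f v) x v ≤ G := by
      intro a b h
      rw [exch_adj T hxv] at h
      rcases h with h | h | h
      · exact hle h.1
      · rw [h.1, h.2]; exact hv
      · rw [h.1, h.2]; exact hv.symm
    have t3 : ¬ T.Adj x v := by
      intro h
      apply hnr
      refine SimpleGraph.Adj.reachable ?_
      simp only [SimpleGraph.deleteEdges_adj, Set.mem_singleton_iff, Sym2.eq_iff]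
      grind
    have hsub : lset (exch T v (f v) x v) ⊆ insert (f v) (lset T \ {x}) := by
      intro u hu
      by_cases huc : u = f v
      · exact Or.inl huc
      refine Or.inr ?_
      obtain ⟨u', hu', huu⟩ := hu
      simp only [exch_adj T hxv] at hu' huu
      obtain ⟨px, hpx, hpxu⟩ := hx
      have e1 : u ≠ x := by
        rintro rfl
        have := huu v (by simp)
        have := huu px (by grind)
        grind
      refine ⟨?_, by simp [e1]⟩
      by_cases e2 : u = v
      · subst e2
        refine ⟨f u, f1, ?_⟩
        intro t ht
        by_contra hne
        have := huu t (by grind)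
        have := huu x (by grind)
        grind [T.adj_comm]
      · refine ⟨u', by grind, ?_⟩
        intro t ht
        exact huu t (by grind)
    have h1 := Set.ncard_le_ncard hsub
    have h2 := Set.ncard_insert_le (f v) (lset T \ {x})
    have h3 : (lset T \ {x}).ncard = k := by
      rw [Set.ncard_sdiff_singleton_of_mem hx, hc]; rfl
    have h4 := hmin _ t1 t2
    refine ⟨t1, t2, t3, ?_, ?_⟩
    · intro h
      have : insert (f v) (lset T \ {x}) = lset T \ {x} := Set.insert_eq_of_mem ⟨h, hw⟩
      rw [this] at h1
      omega
    · exact Set.eq_of_subset_of_ncard_le hsub (by omega)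
  have hinj : Set.InjOn f (G.neighborSet x) := by
    intro v hv v' hv' e
    replace hv : G.Adj x v := hv
    replace hv' : G.Adj x v' := hv'
    obtain ⟨f1, f2, f3⟩ := hf v hv.ne'
    obtain ⟨g1, g2, g3⟩ := hf v' hv'.ne'
    by_cases hw : f v = x
    · rw [← e, hw] at g1
      rw [hw] at f1
      exact hx.unique f1.symm g1.symm
    · obtain ⟨t1, t2, t3, t4, t5⟩ := key v hv hw
      obtain ⟨p1, p2, p3⟩ := hf (f v) hw
      by_contra hne
      have hl : f v ∈ lset (exch T v (f v) x v) := by rw [t5]; simp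
      obtain ⟨u', hu', huu⟩ := hl
      simp only [exch_adj T hv.ne] at hu' huu
      have hd : f (f v) ≠ v := by intro h; rw [h] at p2; omega
      have hd' : f (f v) ≠ v' := by intro h; rw [h, g2, ← e] at p2; omega
      have := huu v' (by grind [T.adj_comm])
      have := huu (f (f v)) (by grind)
      grind
  have hA : ((f '' G.neighborSet x) ∪ G.neighborSet y) ⊆ (lset T \ {x})ᶜ := by
    rintro u (⟨v, hv, rfl⟩ | hu)
    · rintro ⟨h1, h2⟩
      exact (key v hv h2).2.2.2.1 h1
    · rintro ⟨h1, h2⟩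
      exact hind y hy u h1 hu
  have hdisj : Disjoint (f '' G.neighborSet x) (G.neighborSet y) := by
    rw [Set.disjoint_left]
    rintro u ⟨v, hv, rfl⟩ hu
    replace hv : G.Adj x v := hv
    replace hu : G.Adj y (f v) := hu
    by_cases hw : f v = x
    · rw [hw] at hu; exact hnxy hu.symm
    obtain ⟨t1, t2, t3, t4, t5⟩ := key v hv hw
    have h3 : (lset T \ {x}).ncard = k := by
      rw [Set.ncard_sdiff_singleton_of_mem hx, hc]; rfl
    have hcc : (lset (exch T v (f v) x v)).ncard = k + 1 := by
      rw [t5, Set.ncard_insert_of_notMem (fun h => t4 h.1), h3]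
    obtain ⟨T', q1, q2, q3⟩ := leaves_adj t1 t2 hk hcc (x := y) (y := f v)
      (by rw [t5]; exact Or.inr ⟨hy, hxy.symm⟩) (by rw [t5]; exact Or.inl rfl) hu
    exact hmin T' q1 q2 q3
  have h1 := Set.ncard_le_ncard hA
  rw [Set.ncard_union_eq hdisj, Set.InjOn.ncard_image hinj] at h1
  have h2 := Set.ncard_add_ncard_compl (lset T \ {x})
  rw [Set.ncard_sdiff_singleton_of_mem hx, hc, Nat.card_eq_fintype_card] at h2
  omega

lemma leafCount_eq {V : Type*} {G : SimpleGraph V} (H : G.Subgraph) :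
    leafCount H = (lset H.coe).ncard := by
  unfold leafCount lset
  congr 1
  ext v
  simp only [Set.mem_ofPred_eq, Set.ncard_eq_one]
  constructor
  · rintro ⟨a, ha⟩
    refine ⟨a, ?_, fun b hb => ?_⟩
    · have : a ∈ H.coe.neighborSet v := by rw [ha]; rfl
      exact this
    · have : b ∈ H.coe.neighborSet v := hb
      rw [ha] at this; exact this
  · rintro ⟨a, ha, hu⟩
    refine ⟨a, ?_⟩
    ext b
    exact ⟨fun h => hu b h, fun h => by rw [Set.mem_singleton_iff.1 h]; exact ha⟩

/-- Rebuild a subgraph from a graph on a vertex subset. -/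
def mkSub {V : Type*} {G : SimpleGraph V} (S : Set V) (T : SimpleGraph S)
    (h : T ≤ G.induce S) : G.Subgraph where
  verts := S
  Adj a b := ∃ (ha : a ∈ S) (hb : b ∈ S), T.Adj ⟨a, ha⟩ ⟨b, hb⟩
  adj_sub := by
    rintro a b ⟨ha, hb, hab⟩
    exact h hab
  edge_vert := by
    rintro a b ⟨ha, hb, hab⟩
    exact ha
  symm := by
    constructor
    rintro a b ⟨ha, hb, hab⟩
    exact ⟨hb, ha, hab.symm⟩

lemma mkSub_coe {V : Type*} {G : SimpleGraph V} (S : Set V) (T : SimpleGraph S)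
    (h : T ≤ G.induce S) : (mkSub S T h).coe = T := by
  ext ⟨a, ha⟩ ⟨b, hb⟩
  exact ⟨fun ⟨_, _, h⟩ => h, fun h => ⟨ha, hb, h⟩⟩

lemma extend_tree {V : Type*} [Fintype V] {G : SimpleGraph V} (H : G.Subgraph) (hT : H.coe.IsTree)
    {u v : V} (hu : u ∈ H.verts) (hv : v ∉ H.verts) (huv : G.Adj u v) :
    ∃ H' : G.Subgraph, H'.coe.IsTree ∧ H'.verts.ncard = H.verts.ncard + 1 ∧
      leafCount H' ≤ max (leafCount H + 1) 2 ∧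
      ((⟨u, hu⟩ : H.verts) ∈ lset H.coe → leafCount H' ≤ leafCount H) := by
  classical
  set H' : G.Subgraph := H ⊔ G.subgraphOfAdj huv with hH'
  have hverts : H'.verts = insert v H.verts := by
    ext t; simp [hH']; grind
  have hadj : ∀ a b, H'.Adj a b ↔ H.Adj a b ∨ (a = u ∧ b = v) ∨ (a = v ∧ b = u) := by
    intro a b
    simp [hH', Sym2.eq_iff]; grind
  have hcard : H'.verts.ncard = H.verts.ncard + 1 := by
    rw [hverts, Set.ncard_insert_of_notMem hv]
  have hconn : H'.coe.Connected := by
    have h1 : H.Connected := SimpleGraph.Subgraph.connected_iff'.2 hT.1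
    have h2 := SimpleGraph.Subgraph.subgraphOfAdj_connected huv
    have := SimpleGraph.Subgraph.connected_sup h1.preconnected h2.preconnected ⟨u, by simp [hu]⟩
    exact SimpleGraph.Subgraph.connected_iff'.1 this
  have hvle : ∀ t, t ∈ H.verts → t ∈ H'.verts := by intro t ht; rw [hverts]; exact Or.inr ht
  have hv' : v ∈ H'.verts := by rw [hverts]; exact Or.inl rfl
  let ι : H.verts → H'.verts := fun t => ⟨t.1, hvle _ t.2⟩
  refine ⟨H', ?_, hcard, ?_⟩
  · rw [SimpleGraph.isTree_iff_connected_and_card]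
    refine ⟨hconn, le_antisymm ?_ hconn.card_vert_le_card_edgeSet_add_one⟩
    have hE : H'.coe.edgeSet ⊆ insert s(ι ⟨u, hu⟩, ⟨v, hv'⟩) (Sym2.map ι '' H.coe.edgeSet) := by
      intro e
      induction e with
      | _ a b =>
        intro he
        have he' : H'.Adj a.1 b.1 := he
        rw [hadj] at he'
        rcases he' with h | h | h
        · refine Or.inr ⟨s(⟨a.1, H.edge_vert h⟩, ⟨b.1, H.edge_vert h.symm⟩), h, ?_⟩
          simp [ι]
        · left
          have h1 : a = ι ⟨u, hu⟩ := Subtype.ext h.1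
          have h2 : b = ⟨v, hv'⟩ := Subtype.ext h.2
          rw [h1, h2]
        · left
          have h1 : b = ι ⟨u, hu⟩ := Subtype.ext h.2
          have h2 : a = ⟨v, hv'⟩ := Subtype.ext h.1
          rw [h1, h2, Sym2.eq_swap]
    have h1 := Set.ncard_le_ncard hE (Set.toFinite _)
    have h2 := Set.ncard_insert_le s(ι ⟨u, hu⟩, ⟨v, hv'⟩) (Sym2.map ι '' H.coe.edgeSet)
    have h3 := Set.ncard_image_le (f := Sym2.map ι) (Set.toFinite H.coe.edgeSet)
    have h4 := (SimpleGraph.isTree_iff_connected_and_card.1 hT).2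
    simp only [Nat.card_coe_set_eq] at h4 ⊢
    omega
  · have hsub : (∃ c, H.Adj u c) → lset H'.coe ⊆ insert ⟨v, hv'⟩ (ι '' (lset H.coe \ {⟨u, hu⟩})) := by
      rintro ⟨c, hc⟩ ⟨a, ha⟩ ⟨⟨b, hb⟩, hab, hun⟩
      by_cases hav : a = v
      · left; exact Subtype.ext hav
      right
      have haH : a ∈ H.verts := by rw [hverts] at ha; exact ha.resolve_left hav
      have hun' : ∀ t, H'.Adj a t → t = b := fun t ht =>
        congrArg Subtype.val (hun ⟨t, H'.edge_vert ht.symm⟩ ht)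
      have hab' : H'.Adj a b := hab
      have hau : a ≠ u := by
        rintro rfl
        have e1 := hun' v ((hadj _ _).2 (by simp))
        have e2 := hun' c ((hadj _ _).2 (Or.inl hc))
        exact hv (e1.trans e2.symm ▸ H.edge_vert hc.symm)
      have hab2 : H.Adj a b := by
        rw [hadj] at hab'; grind
      refine ⟨⟨a, haH⟩, ⟨⟨⟨b, H.edge_vert hab2.symm⟩, hab2, ?_⟩, ?_⟩, rfl⟩
      · rintro ⟨t, ht⟩ hat
        exact Subtype.ext (hun' t ((hadj _ _).2 (Or.inl hat)))
      · intro h; exact hau (congrArg Subtype.val h)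
    have hcnt : (∃ c, H.Adj u c) → (lset H'.coe).ncard ≤ (lset H.coe \ {⟨u, hu⟩}).ncard + 1 := by
      intro h
      have h1 := Set.ncard_le_ncard (hsub h) (Set.toFinite _)
      have h2 := Set.ncard_insert_le (⟨v, hv'⟩ : H'.verts) (ι '' (lset H.coe \ {⟨u, hu⟩}))
      have h3 := Set.ncard_image_le (f := ι) (Set.toFinite (lset H.coe \ {⟨u, hu⟩}))
      omega
    simp only [leafCount_eq]
    constructor
    · by_cases h : ∃ c, H.Adj u c
      · have h1 := hcnt h
        have h2 : (lset H.coe \ {⟨u, hu⟩}).ncard ≤ (lset H.coe).ncard :=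
          Set.ncard_le_ncard Set.diff_subset (Set.toFinite _)
        exact le_max_of_le_left (by omega)
      · have hall : H.verts ⊆ {u} := by
          intro t ht
          obtain ⟨p⟩ := hT.1.preconnected ⟨u, hu⟩ ⟨t, ht⟩
          cases p with
          | nil => rfl
          | cons hh q => exact absurd ⟨_, hh⟩ h
        have h1 := Set.ncard_le_ncard hall (Set.toFinite _)
        rw [Set.ncard_singleton] at h1
        have h2 := Set.ncard_le_card (lset H'.coe)
        rw [Nat.card_coe_set_eq] at h2
        exact le_max_of_le_right (by omega)
    · intro hl
      obtain ⟨c, hc, -⟩ := id hl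
      have h1 := hcnt ⟨c.1, hc⟩
      rw [Set.ncard_sdiff_singleton_of_mem hl] at h1
      have : 0 < (lset H.coe).ncard := (Set.ncard_pos (Set.toFinite _)).2 ⟨_, hl⟩
      omega
/-- If `k ≥ 2`, `G` is connected and `d(x) + d(y) ≥ t_{k+1} - k + 1`
for every pair of nonadjacent vertices, then `G` has a spanning tree with at most `k`
leaves. -/
theorem spanning_k_ended_tree_of_treeOrd {V : Type*} [Fintype V] (k : ℕ) (hk : 2 ≤ k)
    (G : SimpleGraph V) (hconn : G.Connected)
    (hdeg : ∀ x y : V, x ≠ y → ¬ G.Adj x y →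
      (treeOrd G (k + 1) : ℤ) - k + 1 ≤ (deg G x : ℤ) + deg G y) :
    ∃ H : G.Subgraph, H.IsSpanning ∧ IsEndedTree H k := by
  classical
  by_contra hno
  set S : Set ℕ := {m | ∃ H : G.Subgraph, IsEndedTree H (k + 1) ∧ H.verts.ncard = m} with hS
  have hbdd : BddAbove S := by
    refine ⟨Nat.card V, ?_⟩
    rintro m ⟨H, -, rfl⟩
    exact Set.ncard_le_card _
  have hne : S.Nonempty := by
    obtain ⟨v⟩ := hconn.nonempty
    have ht := SimpleGraph.IsTree.coe_singletonSubgraph G v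
    refine ⟨_, G.singletonSubgraph v, ⟨ht, ?_⟩, rfl⟩
    unfold leafCount
    refine (Set.ncard_le_card _).trans ?_
    rw [Nat.card_coe_set_eq]
    simp
  have hmax : ∀ H : G.Subgraph, IsEndedTree H (k + 1) → H.verts.ncard ≤ treeOrd G (k + 1) :=
    fun H hH => le_csSup hbdd ⟨H, hH, rfl⟩
  obtain ⟨H, hH, hHt⟩ : ∃ H : G.Subgraph, IsEndedTree H (k + 1) ∧
      H.verts.ncard = treeOrd G (k + 1) := Nat.sSup_mem hne hbdd
  have claim : ∀ K : G.Subgraph, IsEndedTree K k → K.verts.ncard ≠ treeOrd G (k + 1) := by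
    intro K hK hc
    by_cases hsp : K.IsSpanning
    · exact hno ⟨K, hsp, hK⟩
    have : ∃ z, z ∉ K.verts := by
      by_contra h
      push Not at h
      exact hsp h
    obtain ⟨z, hz⟩ := this
    obtain ⟨⟨a, ha⟩⟩ := hK.1.1.nonempty
    obtain ⟨p⟩ := hconn.preconnected a z
    obtain ⟨d, -, hd1, hd2⟩ := p.exists_boundary_dart K.verts ha hz
    obtain ⟨K', h1, h2, h3, -⟩ := extend_tree K hK.1 hd1 hd2 d.adj
    have h4 := hK.2
    have := hmax K' ⟨h1, h3.trans (max_le (by omega) (by omega))⟩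
    omega
  have hcount : (lset H.coe).ncard = k + 1 := by
    rw [← leafCount_eq]
    refine le_antisymm hH.2 ?_
    by_contra h
    exact claim H ⟨hH.1, by omega⟩ hHt
  have hle : H.coe ≤ G.induce H.verts := fun a b h => H.adj_sub h
  have hmin : ∀ T' : SimpleGraph H.verts, T'.IsTree → T' ≤ G.induce H.verts →
      ¬ (lset T').ncard ≤ k := by
    intro T' h1 h2 h3
    refine claim (mkSub H.verts T' h2) ⟨?_, ?_⟩ hHt
    · rw [mkSub_coe]; exact h1
    · rw [leafCount_eq, mkSub_coe]; exact h3
  obtain ⟨x, hx, y, hy, hxy⟩ := (Set.one_lt_ncard (Set.toFinite (lset H.coe))).1 (by omega)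
  obtain ⟨hna, hsum⟩ := core hH.1 hle hk hcount hmin hx hy hxy
  have hdg : ∀ z ∈ lset H.coe, deg G z.1 = ((G.induce H.verts).neighborSet z).ncard := by
    intro z hz
    unfold deg
    rw [← Set.ncard_image_of_injective _ (Subtype.val_injective)]
    congr 1
    ext w
    constructor
    · intro hw
      have hwH : w ∈ H.verts := by
        by_contra hw'
        obtain ⟨K', h1, h2, -, h4⟩ := extend_tree H hH.1 z.2 hw' hw
        have := hmax K' ⟨h1, (h4 hz).trans hH.2⟩
        omega
      exact ⟨⟨w, hwH⟩, hw, rfl⟩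
    · rintro ⟨w', hw', rfl⟩
      exact hw'
  have hfin := hdeg x.1 y.1 (fun h => hxy (Subtype.ext h)) hna
  rw [hdg x hx, hdg y hy] at hfin
  rw [← Nat.card_eq_fintype_card, Nat.card_coe_set_eq, hHt] at hsum
  omega
end

section
/- Let k ≥ 2 be an integer and let G be a connected simple graph such that d(x) + d(y) + d(z) ≥ t_{k+1} − 2k + 4 for every independent set {x, y, z} of three pairwise nonadjacent vertices, where t_{k+1} is the maximum number of vertices of a subgraph of G that is a tree with at most k+1 leaves. Then G has a dominating k-ended tree, i.e., a subgraph T that is a tree with at most k leaves such that the set of vertices of G not in T is an independent set. -/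
open SimpleGraph

namespace DomTree

set_option linter.unusedSectionVars false

variable {V : Type*} [Fintype V]

lemma deg_add {T : SimpleGraph V} {a b : V} (hab : a ≠ b) (h : ¬ T.Adj a b) (v : V) [Decidable (v = a ∨ v = b)] :
    deg (T ⊔ edge a b) v = deg T v + if v = a ∨ v = b then 1 else 0 := by
  classical
  unfold deg
  split_ifs with hv
  · rcases hv with rfl | rfl
    · have : (T ⊔ edge v b).neighborSet v = insert b (T.neighborSet v) := by
        ext w
        simp only [mem_neighborSet, sup_adj, edge_adj, Set.mem_insert_iff]
        grind
      rw [this, Set.ncard_insert_of_notMem (by simpa using h) (Set.toFinite _)]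
    · have : (T ⊔ edge a v).neighborSet v = insert a (T.neighborSet v) := by
        ext w
        simp only [mem_neighborSet, sup_adj, edge_adj, Set.mem_insert_iff]
        grind
      rw [this, Set.ncard_insert_of_notMem (by simpa [T.adj_comm] using h) (Set.toFinite _)]
  · have : (T ⊔ edge a b).neighborSet v = T.neighborSet v := by
      ext w
      simp only [mem_neighborSet, sup_adj, edge_adj]
      grind
    rw [this]; rfl

lemma del_adj {T : SimpleGraph V} {u v p q : V} :
    (T.deleteEdges {s(u, v)}).Adj p q ↔ T.Adj p q ∧ ¬ ((p = u ∧ q = v) ∨ (p = v ∧ q = u)) := by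
  simp [deleteEdges_adj]

lemma deg_del {T : SimpleGraph V} {u v : V} (h : T.Adj u v) (p : V) [Decidable (p = u ∨ p = v)] :
    deg (T.deleteEdges {s(u, v)}) p + (if p = u ∨ p = v then 1 else 0) = deg T p := by
  rw [← deg_add (T := T.deleteEdges {s(u, v)}) h.ne (by simp) p]
  congr 1
  ext a b
  simp only [sup_adj, del_adj, edge_adj]
  have := h.symm
  have h3 : a ≠ b ∨ a = b := by tauto
  constructor
  · rintro (h1 | ⟨(⟨rfl, rfl⟩ | ⟨rfl, rfl⟩), h2⟩) <;> tauto
  · intro h1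
    have := h1.ne
    tauto

/-- edge exchange -/
def exch (T : SimpleGraph V) (u v a b : V) : SimpleGraph V :=
  T.deleteEdges {s(u, v)} ⊔ edge a b

lemma exch_adj {T : SimpleGraph V} {u v a b p q : V} :
    (exch T u v a b).Adj p q ↔ (T.Adj p q ∧ ¬ ((p = u ∧ q = v) ∨ (p = v ∧ q = u))) ∨
      (((p = a ∧ q = b) ∨ (p = b ∧ q = a)) ∧ p ≠ q) := by
  simp only [exch, sup_adj, del_adj, edge_adj]

structure TreeOn (G T : SimpleGraph V) (U : Finset V) : Prop where
  le : T ≤ G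
  acyc : T.IsAcyclic
  mem : ∀ u v, T.Adj u v → u ∈ U
  ne : U.Nonempty
  conn : ∀ u ∈ U, ∀ v ∈ U, T.Reachable u v

noncomputable def lv (T : SimpleGraph V) : Finset V := by
  classical exact Finset.univ.filter (fun v => deg T v = 1)

@[simp] lemma mem_lv {T : SimpleGraph V} {v : V} : v ∈ lv T ↔ deg T v = 1 := by
  simp [lv]

lemma reach_mono {T H : SimpleGraph V} (h : ∀ p q, T.Adj p q → H.Reachable p q) {a b : V}
    (hab : T.Reachable a b) : H.Reachable a b := by
  obtain ⟨w⟩ := hab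
  induction w with
  | nil => exact Reachable.refl _
  | cons h1 _ ih => exact (h _ _ h1).trans ih

lemma bridge {T : SimpleGraph V} (hT : T.IsAcyclic) {u v : V} (h : T.Adj u v) :
    ¬ (T.deleteEdges {s(u, v)}).Reachable u v :=
  isAcyclic_iff_forall_adj_isBridge.1 hT h

lemma TreeOn.exch {G T : SimpleGraph V} {U : Finset V} (h : TreeOn G T U) {u v a b : V}
    (huv : T.Adj u v) (hab : G.Adj a b)
    (hua : (T.deleteEdges {s(u, v)}).Reachable u a)
    (hvb : (T.deleteEdges {s(u, v)}).Reachable v b) :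
    TreeOn G (exch T u v a b) U ∧ ∀ p [Decidable (p = u ∨ p = v)] [Decidable (p = a ∨ p = b)],
      deg (DomTree.exch T u v a b) p + (if p = u ∨ p = v then 1 else 0) =
      deg T p + (if p = a ∨ p = b then 1 else 0) := by
  have hbr := bridge h.acyc huv
  have hn : ¬ (T.deleteEdges {s(u, v)}).Reachable a b := fun hh =>
    hbr (hua.trans (hh.trans hvb.symm))
  have le1 : T.deleteEdges {s(u, v)} ≤ DomTree.exch T u v a b := le_sup_left
  have hab' : (DomTree.exch T u v a b).Adj a b := by
    rw [exch_adj]; right; exact ⟨Or.inl ⟨rfl, rfl⟩, hab.ne⟩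
  have huv' : (DomTree.exch T u v a b).Reachable u v :=
    (hua.mono le1).trans (hab'.reachable.trans (hvb.mono le1).symm)
  have ha : a ∈ U := by
    by_contra hc
    have : T.Reachable a u := (hua.mono (deleteEdges_le _)).symm
    obtain ⟨w⟩ := this
    cases w with
    | nil => exact hc (h.mem _ _ huv)
    | cons h1 _ => exact hc (h.mem _ _ h1)
  have hb : b ∈ U := by
    by_contra hc
    have : T.Reachable b v := (hvb.mono (deleteEdges_le _)).symm
    obtain ⟨w⟩ := this
    cases w with
    | nil => exact hc (h.mem _ _ huv.symm)
    | cons h1 _ => exact hc (h.mem _ _ h1)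
  refine ⟨⟨?_, ?_, ?_, h.ne, ?_⟩, ?_⟩
  · intro p q hpq
    rw [exch_adj] at hpq
    rcases hpq with ⟨h1, -⟩ | ⟨⟨rfl, rfl⟩ | ⟨rfl, rfl⟩, -⟩
    · exact h.le h1
    · exact hab
    · exact hab.symm
  · exact IsAcyclic.sup_edge_of_not_reachable hn (h.acyc.anti (deleteEdges_le _))
  · intro p q hpq
    rw [exch_adj] at hpq
    rcases hpq with ⟨h1, -⟩ | ⟨⟨rfl, rfl⟩ | ⟨rfl, rfl⟩, -⟩
    · exact h.mem _ _ h1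
    · exact ha
    · exact hb
  · intro p hp q hq
    refine reach_mono ?_ (h.conn p hp q hq)
    intro c d hcd
    by_cases hh : (c = u ∧ d = v) ∨ (c = v ∧ d = u)
    · rcases hh with ⟨rfl, rfl⟩ | ⟨rfl, rfl⟩
      · exact huv'
      · exact huv'.symm
    · exact Adj.reachable (exch_adj.2 (Or.inl ⟨hcd, hh⟩))
  · intro p _ _
    have e1 := deg_del huv p
    have e2 := deg_add (T := T.deleteEdges {s(u, v)}) hab.ne (fun hh => hn hh.reachable) p
    unfold DomTree.exch
    omega

lemma TreeOn.addLeaf {G T : SimpleGraph V} [DecidableEq V] {U : Finset V} (h : TreeOn G T U) {p a : V}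
    (hp : p ∈ U) (ha : a ∉ U) (hpa : G.Adj p a) :
    TreeOn G (T ⊔ edge p a) (insert a U) ∧
      ∀ q, deg (T ⊔ edge p a) q = deg T q + if q = p ∨ q = a then 1 else 0 := by
  have hiso : ∀ q, ¬ T.Adj a q := fun q hq => ha (h.mem _ _ hq)
  have hn : ¬ T.Reachable p a := by
    intro hh
    obtain ⟨w⟩ := hh.symm
    cases w with
    | nil => exact ha hp
    | cons h1 _ => exact hiso _ h1
  have hadj : (T ⊔ edge p a).Adj p a := by
    rw [sup_adj, edge_adj]; right; exact ⟨Or.inl ⟨rfl, rfl⟩, hpa.ne⟩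
  refine ⟨⟨?_, IsAcyclic.sup_edge_of_not_reachable hn h.acyc, ?_, ⟨a, by simp⟩, ?_⟩, ?_⟩
  · intro c d hcd
    rw [sup_adj, edge_adj] at hcd
    rcases hcd with h1 | ⟨⟨rfl, rfl⟩ | ⟨rfl, rfl⟩, -⟩
    · exact h.le h1
    · exact hpa
    · exact hpa.symm
  · intro c d hcd
    rw [sup_adj, edge_adj] at hcd
    rcases hcd with h1 | ⟨⟨rfl, rfl⟩ | ⟨rfl, rfl⟩, -⟩
    · exact Finset.mem_insert_of_mem (h.mem _ _ h1)
    · exact Finset.mem_insert_of_mem hp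
    · simp
  · have key : ∀ c ∈ insert a U, (T ⊔ edge p a).Reachable p c := by
      intro c hc
      rcases Finset.mem_insert.1 hc with rfl | hc
      · exact hadj.reachable
      · exact (h.conn p hp c hc).mono le_sup_left
    intro c hc d hd
    exact (key c hc).symm.trans (key d hd)
  · intro q
    exact deg_add hpa.ne (fun hh => hiso _ hh.symm) q

lemma split_reach {T : SimpleGraph V} {u v p : V} (h : T.Reachable p u) :
    (T.deleteEdges {s(u, v)}).Reachable p u ∨ (T.deleteEdges {s(u, v)}).Reachable p v := by
  obtain ⟨w⟩ := h
  induction w with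
  | nil => exact Or.inl (Reachable.refl _)
  | @cons c d e h1 _ ih =>
    by_cases hh : (c = e ∧ d = v) ∨ (c = v ∧ d = e)
    · rcases hh with ⟨rfl, rfl⟩ | ⟨rfl, rfl⟩
      · exact Or.inl (Reachable.refl _)
      · exact Or.inr (Reachable.refl _)
    · have := (del_adj.2 ⟨h1, hh⟩).reachable
      rcases ih with ih | ih
      · exact Or.inl (this.trans ih)
      · exact Or.inr (this.trans ih)

lemma closed_reach {T : SimpleGraph V} (P : V → Prop) (hP : ∀ a b, P a → T.Adj a b → P b) {a b : V}
    (h : T.Reachable a b) (ha : P a) : P b := by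
  obtain ⟨w⟩ := h
  induction w with
  | nil => exact ha
  | cons h1 _ ih => exact ih (hP _ _ ha h1)

lemma deg_pos {T : SimpleGraph V} {a b : V} (h : T.Adj a b) : 1 ≤ deg T a := by
  have : 0 < (T.neighborSet a).ncard := (Set.ncard_pos (Set.toFinite _)).2 ⟨b, h⟩
  exact this

lemma deg_one {T : SimpleGraph V} {a b c : V} (h : deg T a = 1) (hb : T.Adj a b) (hc : T.Adj a c) :
    b = c := by
  obtain ⟨d, hd⟩ := Set.ncard_eq_one.1 h
  have h1 : b ∈ T.neighborSet a := hb
  have h2 : c ∈ T.neighborSet a := hc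
  rw [hd] at h1 h2
  exact h1.trans h2.symm

lemma deg_two {T : SimpleGraph V} {a b c : V} (hb : T.Adj a b) (hc : T.Adj a c) (hbc : b ≠ c) :
    2 ≤ deg T a := by
  by_contra hh
  have := deg_pos hb
  exact hbc (deg_one (by omega) hb hc)

lemma deg_three {T : SimpleGraph V} {a b c d : V} (hb : T.Adj a b) (hc : T.Adj a c) (hd : T.Adj a d)
    (hbc : b ≠ c) (hbd : b ≠ d) (hcd : c ≠ d) : 3 ≤ deg T a :=
  (Set.two_lt_ncard_iff (Set.toFinite _)).2 ⟨b, c, d, hb, hc, hd, hbc, hbd, hcd⟩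

lemma three_of_deg {T : SimpleGraph V} {a : V} (h : 3 ≤ deg T a) :
    ∃ b c d, T.Adj a b ∧ T.Adj a c ∧ T.Adj a d ∧ b ≠ c ∧ b ≠ d ∧ c ≠ d :=
  (Set.two_lt_ncard_iff (Set.toFinite _)).1 h

lemma TreeOn.delLeaf {G T : SimpleGraph V} [DecidableEq V] {U : Finset V} (h : TreeOn G T U) {l q : V}
    (hl : deg T l = 1) (hlq : T.Adj l q) :
    TreeOn G (T.deleteEdges {s(l, q)}) (U.erase l) := by
  have hiso : ∀ c, ¬ (T.deleteEdges {s(l, q)}).Adj l c := by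
    intro c hc
    rw [del_adj] at hc
    exact hc.2 (Or.inl ⟨rfl, deg_one hl hc.1 hlq⟩)
  have key : ∀ c ∈ U.erase l, (T.deleteEdges {s(l, q)}).Reachable c q := by
    intro c hc
    rw [Finset.mem_erase] at hc
    rcases split_reach (v := q) (h.conn c hc.2 l (h.mem _ _ hlq)) with h1 | h1
    · exfalso
      obtain ⟨w⟩ := h1.symm
      cases w with
      | nil => exact hc.1 rfl
      | cons h1 _ => exact hiso _ h1
    · exact h1
  refine ⟨(deleteEdges_le _).trans h.le, h.acyc.anti (deleteEdges_le _), ?_, ?_, ?_⟩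
  · intro c d hcd
    rw [Finset.mem_erase]
    refine ⟨?_, h.mem _ _ (del_adj.1 hcd).1⟩
    rintro rfl
    exact hiso _ hcd
  · exact ⟨q, Finset.mem_erase.2 ⟨hlq.ne', h.mem _ _ hlq.symm⟩⟩
  · intro c hc d hd
    exact (key c hc).trans (key d hd).symm

lemma TreeOn.toSub {G T : SimpleGraph V} {U : Finset V} (h : TreeOn G T U) {k : ℕ}
    (hk : (lv T).card ≤ k) : ∃ H : G.Subgraph, IsEndedTree H k ∧ H.verts = (U : Set V) := by
  classical
  let H : G.Subgraph :=
    { verts := (U : Set V)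
      Adj := T.Adj
      adj_sub := fun hh => h.le hh
      edge_vert := fun hh => h.mem _ _ hh
      symm := ⟨fun _ _ hh => hh.symm⟩ }
  have hconn : H.coe.Connected := by
    have : Nonempty H.verts := ⟨⟨h.ne.choose, h.ne.choose_spec⟩⟩
    refine ⟨?_⟩
    rintro ⟨u, hu⟩ ⟨v, hv⟩
    obtain ⟨w⟩ := h.conn u hu v hv
    induction w with
    | nil => exact Reachable.refl _
    | @cons a b c h1 _ ih =>
      have hb : b ∈ U := h.mem _ _ h1.symm
      have : H.coe.Adj ⟨a, hu⟩ ⟨b, hb⟩ := h1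
      exact this.reachable.trans (ih hb hv)
  have hacyc : H.coe.IsAcyclic := by
    refine IsAcyclic.comap (G' := T) ⟨fun x => x.1, fun {a b} hab => hab⟩ ?_ h.acyc
    exact Subtype.val_injective
  refine ⟨H, ⟨⟨hconn, hacyc⟩, ?_⟩, rfl⟩
  refine le_trans ?_ hk
  unfold leafCount
  have hd : ∀ v : H.verts, (H.coe.neighborSet v).ncard = deg T v.1 := by
    intro v
    unfold deg
    have : T.neighborSet v.1 = Subtype.val '' (H.coe.neighborSet v) := by
      ext w
      simp only [mem_neighborSet, Set.mem_image]
      constructor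
      · intro hw
        exact ⟨⟨w, h.mem _ _ hw.symm⟩, hw, rfl⟩
      · rintro ⟨x, hx, rfl⟩
        exact hx
    rw [this, Set.ncard_image_of_injective _ Subtype.val_injective]
  rw [← Set.ncard_image_of_injective _ Subtype.val_injective, ← Set.ncard_coe_finset]
  refine Set.ncard_le_ncard ?_ (Set.toFinite _)
  rintro _ ⟨v, hv, rfl⟩
  rw [Set.mem_ofPred_eq, hd] at hv
  simpa using hv

lemma TreeOn.le_ord {G T : SimpleGraph V} {U : Finset V} (h : TreeOn G T U) {k : ℕ}
    (hk : (lv T).card ≤ k) : U.card ≤ treeOrd G k := by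
  classical
  obtain ⟨H, hH, hv⟩ := h.toSub hk
  refine le_csSup ⟨Fintype.card V, ?_⟩ ⟨H, hH, by rw [hv, Set.ncard_coe_finset]⟩
  rintro m ⟨H', -, rfl⟩
  rw [← Nat.card_eq_fintype_card]
  exact Set.ncard_le_card _

lemma exists_deg_three {G T : SimpleGraph V} {U : Finset V} (h : TreeOn G T U)
    (hl : 3 ≤ (lv T).card) : ∃ r, 3 ≤ deg T r := by
  classical
  by_contra! hc
  obtain ⟨x, y, z, hx, hy, hz, hxy, hxz, hyz⟩ := Finset.two_lt_card_iff.1 hl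
  rw [mem_lv] at hx hy hz
  have hU : ∀ v, deg T v = 1 → v ∈ U := by
    intro v hv
    obtain ⟨d, hd⟩ := Set.ncard_eq_one.1 hv
    have : d ∈ T.neighborSet v := by rw [hd]; rfl
    exact h.mem _ _ this
  obtain ⟨p, hp⟩ := (h.conn x (hU x hx) y (hU y hy)).exists_isPath
  have hlen : p.length ≠ 0 := fun h0 => hxy (Walk.eq_of_length_eq_zero h0)
  have hinj := hp.getVert_injOn
  have nxt : ∀ i, i < p.length → T.Adj (p.getVert i) (p.getVert (i+1)) := fun i hi =>
    p.adj_getVert_succ hi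
  have hmid : ∀ i, i + 2 ≤ p.length → p.getVert i ≠ p.getVert (i+2) := by
    intro i hi he
    have := hinj (show i ∈ {i | i ≤ p.length} by simp; omega)
      (show i+2 ∈ {i | i ≤ p.length} by simp; omega) he
    omega
  have hz' : ∃ i ≤ p.length, z = p.getVert i := by
    refine closed_reach (fun v => ∃ i ≤ p.length, v = p.getVert i) ?_
      (h.conn x (hU x hx) z (hU z hz)) ⟨0, by omega, by simp⟩
    rintro a b ⟨i, hi, rfl⟩ hab
    rcases Nat.eq_zero_or_pos i with rfl | hi0
    · have := nxt 0 (by omega)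
      refine ⟨1, by omega, ?_⟩
      rw [Walk.getVert_zero] at *
      exact deg_one hx hab this
    · obtain ⟨j, rfl⟩ : ∃ j, i = j + 1 := ⟨i - 1, by omega⟩
      have h1 := (nxt j (by omega)).symm
      by_cases hil : j + 1 = p.length
      · refine ⟨j, by omega, ?_⟩
        rw [hil, Walk.getVert_length] at hab h1
        exact deg_one hy hab h1
      · have h2 := nxt (j+1) (by omega)
        by_contra hcon
        push Not at hcon
        have := deg_three h1 h2 hab (hmid j (by omega)) (hcon j (by omega)).symm
          (hcon (j+2) (by omega)).symm
        have := hc (p.getVert (j+1))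
        omega
  obtain ⟨i, hi, rfl⟩ := hz'
  have h0 : i ≠ 0 := by rintro rfl; simp at hxz
  have h1 : i ≠ p.length := by rintro rfl; simp at hyz
  obtain ⟨j, rfl⟩ : ∃ j, i = j + 1 := ⟨i - 1, by omega⟩
  have := deg_two (nxt j (by omega)).symm (nxt (j+1) (by omega)) (hmid j (by omega))
  omega

end DomTree

namespace DomTree

variable {V : Type*} [Fintype V]

structure Spider (T : SimpleGraph V) (L : Fin 3 → ℕ → V) (m : Fin 3 → ℕ) : Prop where
  zero : ∀ a b, L a 0 = L b 0
  pos : ∀ a, 1 ≤ m a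
  adj : ∀ a i, i < m a → T.Adj (L a i) (L a (i+1))
  inj : ∀ a b i j, i ≤ m a → j ≤ m b → L a i = L b j → (a = b ∧ i = j) ∨ (i = 0 ∧ j = 0)

lemma chain {H : SimpleGraph V} (f : ℕ → V) (i j : ℕ) (hij : i ≤ j)
    (h : ∀ l, i ≤ l → l < j → H.Adj (f l) (f (l+1))) : H.Reachable (f i) (f j) := by
  induction j, hij using Nat.le_induction with
  | base => exact Reachable.refl _
  | succ n hn ih =>
    exact (ih (fun l h1 h2 => h l h1 (by omega))).trans (h n hn (by omega)).reachable

lemma Spider.ext {T T' : SimpleGraph V} {L : Fin 3 → ℕ → V} {m : Fin 3 → ℕ} (S : Spider T L m)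
    (a : Fin 3) (p : V) (hT' : ∀ a i, i < m a → T'.Adj (L a i) (L a (i+1)))
    (hp : T'.Adj (L a (m a)) p) (hpS : ∀ b i, i ≤ m b → p ≠ L b i) :
    Spider T' (Function.update L a (fun i => if i ≤ m a then L a i else p))
      (Function.update m a (m a + 1)) := by
  have hz := S.zero
  have hi := S.inj
  have hpos := S.pos
  have key : ∀ b i, Function.update L a (fun i => if i ≤ m a then L a i else p) b i =
      if b = a ∧ m a < i then p else L b i := by
    intro b i
    by_cases hb : b = a
    · subst hb
      simp only [Function.update_self]
      grind
    · simp [hb]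
  have key2 : ∀ b, Function.update m a (m a + 1) b = if b = a then m a + 1 else m b := by
    intro b
    rw [Function.update_apply]
  refine ⟨?_, ?_, ?_, ?_⟩
  · intro b c
    rw [key, key]
    simp [hz b c]
  · intro b
    rw [key2]
    have := hpos b
    split_ifs <;> omega
  · intro b i h
    rw [key2] at h
    rw [key, key]
    by_cases hb : b = a
    · subst hb
      rw [if_pos rfl] at h
      by_cases hh : i = m b
      · subst hh
        simpa using hp
      · rw [if_neg (by omega), if_neg (by omega)]
        exact hT' b i (by omega)
    · rw [if_neg (by tauto), if_neg (by tauto)]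
      rw [if_neg hb] at h
      exact hT' b i h
  · intro b c i j h1 h2 h3
    rw [key2] at h1 h2
    rw [key, key] at h3
    have A := hpS b i
    have B := hpS c j
    have C := hi b c i j
    by_cases hb : b = a ∧ m a < i
    · by_cases hc : c = a ∧ m a < j
      · left
        obtain ⟨rfl, hb⟩ := hb
        obtain ⟨rfl, hc⟩ := hc
        simp at h1 h2
        exact ⟨rfl, by omega⟩
      · rw [if_pos hb, if_neg hc] at h3
        refine absurd h3 (B ?_)
        split_ifs at h2 with hca
        · subst hca; by_contra; exact hc ⟨rfl, by omega⟩
        · exact h2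
    · by_cases hc : c = a ∧ m a < j
      · rw [if_neg hb, if_pos hc] at h3
        refine absurd h3.symm (A ?_)
        split_ifs at h1 with hca
        · subst hca; by_contra; exact hb ⟨rfl, by omega⟩
        · exact h1
      · rw [if_neg hb, if_neg hc] at h3
        refine C ?_ ?_ h3
        · split_ifs at h1 with hca
          · subst hca; by_contra; exact hb ⟨rfl, by omega⟩
          · exact h1
        · split_ifs at h2 with hca
          · subst hca; by_contra; exact hc ⟨rfl, by omega⟩
          · exact h2

lemma sum_ext (m : Fin 3 → ℕ) (a : Fin 3) :
    ∑ b, Function.update m a (m a + 1) b = ∑ b, m b + 1 := by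
  fin_cases a <;> simp [Fin.sum_univ_three, Function.update_apply] <;> omega

structure Good (G : SimpleGraph V) (k t : ℕ) (T : SimpleGraph V) (U : Finset V) : Prop where
  tree : TreeOn G T U
  lvs : (lv T).card ≤ k + 1
  card : U.card = t

structure Cfg (G : SimpleGraph V) (k t : ℕ) (T : SimpleGraph V) (U : Finset V)
    (L : Fin 3 → ℕ → V) (m : Fin 3 → ℕ) : Prop where
  good : Good G k t T U
  hF : ∀ T U, TreeOn G T U → (lv T).card ≤ k → U.card + 2 ≤ t
  hmax : ∀ T U, TreeOn G T U → (lv T).card ≤ k + 1 → U.card ≤ t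
  sp : Spider T L m
  smax : ∀ T' U' L' m', Good G k t T' U' → Spider T' L' m' → ∑ a, m' a ≤ ∑ a, m a

lemma no_leaf_branch {G : SimpleGraph V} {k t : ℕ} {T : SimpleGraph V} {U : Finset V}
    (hF : ∀ T U, TreeOn G T U → (lv T).card ≤ k → U.card + 2 ≤ t) (h : Good G k t T U)
    {l q : V} (hl : deg T l = 1) (hlq : T.Adj l q) (hq : 3 ≤ deg T q) : False := by
  classical
  have h1 := h.tree.delLeaf hl hlq
  have h2 : lv (T.deleteEdges {s(l, q)}) ⊆ (lv T).erase l := by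
    intro v hv
    rw [mem_lv] at hv
    rw [Finset.mem_erase, mem_lv]
    have := deg_del hlq v
    have : v ≠ l := by
      rintro rfl
      simp at this
      omega
    have : v ≠ q := by
      rintro rfl
      simp at this
      omega
    simp_all
  have h3 := Finset.card_le_card h2
  have h4 : l ∈ lv T := by simpa using hl
  rw [Finset.card_erase_of_mem h4] at h3
  have h5 := hF _ _ h1 (by have := h.lvs; omega)
  have hlU := h.tree.mem _ _ hlq
  rw [Finset.card_erase_of_mem hlU] at h5
  have := h.card
  have := Finset.card_pos.2 ⟨l, hlU⟩
  omega

section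
variable {G : SimpleGraph V} {k t : ℕ} {T : SimpleGraph V} {U : Finset V}
    {L : Fin 3 → ℕ → V} {m : Fin 3 → ℕ}

lemma Spider.eq_iff (S : Spider T L m) {a b : Fin 3} {i j : ℕ} (hi : i ≤ m a) (hj : j ≤ m b) :
    L a i = L b j ↔ (a = b ∧ i = j) ∨ (i = 0 ∧ j = 0) := by
  refine ⟨S.inj a b i j hi hj, ?_⟩
  rintro (⟨rfl, rfl⟩ | ⟨rfl, rfl⟩)
  · rfl
  · exact S.zero a b

lemma Spider.deg_root (S : Spider T L m) (a : Fin 3) : 3 ≤ deg T (L a 0) := by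
  have h : ∀ b, T.Adj (L a 0) (L b 1) := by
    intro b
    rw [S.zero a b]
    exact S.adj b 0 (S.pos b)
  have hne : ∀ b c, b ≠ c → L b 1 ≠ L c 1 := by
    intro b c hbc he
    have := S.inj b c 1 1 (S.pos b) (S.pos c) he
    tauto
  exact deg_three (h 0) (h 1) (h 2) (hne _ _ (by decide)) (hne _ _ (by decide)) (hne _ _ (by decide))

lemma Spider.deg_mid (S : Spider T L m) (a : Fin 3) {i : ℕ} (hi : i < m a) : 2 ≤ deg T (L a i) := by
  rcases Nat.eq_zero_or_pos i with rfl | h0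
  · have := S.deg_root a; omega
  · obtain ⟨j, rfl⟩ : ∃ j, i = j + 1 := ⟨i - 1, by omega⟩
    refine deg_two (S.adj a j (by omega)).symm (S.adj a (j+1) hi) ?_
    intro he
    have := S.inj a a j (j+2) (by omega) (by omega) he
    omega

lemma Spider.chord (hT : T.IsAcyclic) (S : Spider T L m) {a b : Fin 3} {j : ℕ} (hj : j ≤ m b)
    (h : T.Adj (L a (m a)) (L b j)) : L b j = L a (m a - 1) := by
  have hp := S.pos a
  have hpb := S.pos b
  by_contra hne
  have main : ∀ b j, j ≤ m b → (b = a ∨ 0 < j) → T.Adj (L a (m a)) (L b j) →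
      L b j ≠ L a (m a - 1) → False := by
    intro b j hj hbj h hne
    have hpb := S.pos b
    have hjm : L b j ≠ L a (m a) := h.ne'
    apply bridge hT h
    by_cases hba : b = a
    · subst hba
      apply Reachable.symm
      refine chain (L b) j (m b) hj ?_
      intro l h1 h2
      rw [del_adj]
      refine ⟨S.adj b l h2, ?_⟩
      have e1 := S.eq_iff (a := b) (b := b) (i := l) (j := m b) (by omega) (by omega)
      have e2 := S.eq_iff (a := b) (b := b) (i := l+1) (j := j) (by omega) (by omega)
      have e3 := S.eq_iff (a := b) (b := b) (i := l) (j := j) (by omega) (by omega)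
      have e4 := S.eq_iff (a := b) (b := b) (i := l+1) (j := m b) (by omega) (by omega)
      rw [e1, e2, e3, e4]
      rintro (h5 | ⟨h5, h6⟩)
      · omega
      · have : j = m b - 1 := by omega
        subst this
        exact hne rfl
    · have hj0 : 0 < j := by tauto
      have c1 : (T.deleteEdges {s(L a (m a), L b j)}).Reachable (L a 0) (L a (m a)) := by
        refine chain (L a) 0 (m a) (by omega) ?_
        intro l h1 h2
        rw [del_adj]
        refine ⟨S.adj a l h2, ?_⟩
        have e2 := S.eq_iff (a := a) (b := b) (i := l+1) (j := j) (by omega) (by omega)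
        have e3 := S.eq_iff (a := a) (b := b) (i := l) (j := j) (by omega) (by omega)
        rw [e2, e3]
        have : a ≠ b := fun hh => hba hh.symm
        simp only [this, false_and, false_or]
        omega
      have c2 : (T.deleteEdges {s(L a (m a), L b j)}).Reachable (L b 0) (L b j) := by
        refine chain (L b) 0 j (by omega) ?_
        intro l h1 h2
        rw [del_adj]
        refine ⟨S.adj b l (by omega), ?_⟩
        have e2 := S.eq_iff (a := b) (b := a) (i := l+1) (j := m a) (by omega) (by omega)
        have e3 := S.eq_iff (a := b) (b := a) (i := l) (j := m a) (by omega) (by omega)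
        rw [e2, e3]
        simp only [hba, false_and, false_or]
        omega
      rw [S.zero b a] at c2
      exact c1.symm.trans c2
  rcases Nat.eq_zero_or_pos j with rfl | hj0
  · rw [S.zero b a] at h hne
    exact main a 0 (by omega) (Or.inl rfl) h hne
  · exact main b j hj (Or.inr hj0) h hne

lemma Cfg.endDeg (C : Cfg G k t T U L m) (a : Fin 3) : deg T (L a (m a)) = 1 := by
  have hp := C.sp.pos a
  have hadj : T.Adj (L a (m a)) (L a (m a - 1)) := by
    have := C.sp.adj a (m a - 1) (by omega)
    rw [show m a - 1 + 1 = m a by omega] at this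
    exact this.symm
  have h1 := deg_pos hadj
  by_contra hne
  have h2 : 1 < (T.neighborSet (L a (m a))).ncard := by
    unfold deg at *; omega
  obtain ⟨p, hpn, hpp⟩ := Set.exists_ne_of_one_lt_ncard h2 (L a (m a - 1))
  have hpS : ∀ b i, i ≤ m b → p ≠ L b i := by
    rintro b i hi rfl
    exact hpp (C.sp.chord C.good.tree.acyc hi hpn)
  have := C.smax T U _ _ C.good (C.sp.ext a p C.sp.adj hpn hpS)
  rw [sum_ext] at this
  omega

lemma Cfg.memU (C : Cfg G k t T U L m) (a : Fin 3) {i : ℕ} (hi : i ≤ m a) : L a i ∈ U := by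
  have hp := C.sp.pos a
  rcases Nat.eq_zero_or_pos i with rfl | h0
  · exact C.good.tree.mem _ _ (C.sp.adj a 0 (by omega))
  · have := C.sp.adj a (i - 1) (by omega)
    rw [show i - 1 + 1 = i by omega] at this
    exact C.good.tree.mem _ _ this.symm

lemma Cfg.nbr (C : Cfg G k t T U L m) (a : Fin 3) {p : V} (h : G.Adj (L a (m a)) p) :
    ∃ b i, i ≤ m b ∧ p = L b i := by
  classical
  have hx := C.endDeg a
  have hp := C.sp.pos a
  by_contra! hpS
  by_cases hpU : p ∈ U
  · -- exchange
    have hxp : L a (m a) ≠ p := (hpS a (m a) le_rfl).symm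
    obtain ⟨w, hw⟩ := (C.good.tree.conn p hpU _ (C.memU a le_rfl)).exists_isPath
    cases w with
    | nil => exact hxp rfl
    | @cons _ q _ hpq w =>
      rw [Walk.cons_isPath_iff] at hw
      have hreach : (T.deleteEdges {s(q, p)}).Reachable q (L a (m a)) := by
        rw [reachable_deleteEdges_iff_exists_walk]
        refine ⟨w, fun hh => hw.2 ?_⟩
        exact w.snd_mem_support_of_mem_edges hh
      obtain ⟨h1, h2⟩ := C.good.tree.exch hpq.symm h hreach (Reachable.refl _)
      have hqx : q ≠ L a (m a) := by
        rintro rfl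
        have h3 : T.Adj (L a (m a)) (L a (m a - 1)) := by
          have := C.sp.adj a (m a - 1) (by omega)
          rw [show m a - 1 + 1 = m a by omega] at this
          exact this.symm
        exact hpS a (m a - 1) (by omega) (deg_one hx hpq.symm h3)
      have hsub : lv (exch T q p (L a (m a)) p) ⊆ insert q ((lv T).erase (L a (m a))) := by
        intro v hv
        rw [mem_lv] at hv
        rw [Finset.mem_insert, Finset.mem_erase, mem_lv]
        have := h2 v
        grind
      have hc := (Finset.card_le_card hsub).trans (Finset.card_insert_le _ _)
      rw [Finset.card_erase_of_mem (by simpa using hx)] at hc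
      have hpos : 0 < (lv T).card := Finset.card_pos.2 ⟨_, by simpa using hx⟩
      have hl := C.good.lvs
      have hg : Good G k t (exch T q p (L a (m a)) p) U := ⟨h1, by omega, C.good.card⟩
      have hS := C.sp.ext (T' := exch T q p (L a (m a)) p) a p ?_ ?_ (fun b i hi => hpS b i hi)
      · have := C.smax _ _ _ _ hg hS
        rw [sum_ext] at this
        omega
      · intro b i hi
        rw [exch_adj]
        left
        refine ⟨C.sp.adj b i hi, ?_⟩
        have e1 := hpS b i (by omega)
        have e2 := hpS b (i+1) (by omega)
        rintro (⟨_, h5⟩ | ⟨h5, _⟩)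
        · exact e2 h5.symm
        · exact e1 h5.symm
      · rw [exch_adj]; right; exact ⟨Or.inl ⟨rfl, rfl⟩, hxp⟩
  · obtain ⟨h1, h2⟩ := C.good.tree.addLeaf (C.memU a le_rfl) hpU h
    have hsub : lv (T ⊔ edge (L a (m a)) p) ⊆ insert p ((lv T).erase (L a (m a))) := by
      intro v hv
      rw [mem_lv] at hv
      rw [Finset.mem_insert, Finset.mem_erase, mem_lv]
      have := h2 v
      grind
    have hc := (Finset.card_le_card hsub).trans (Finset.card_insert_le _ _)
    rw [Finset.card_erase_of_mem (by simpa using hx)] at hc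
    have hpos : 0 < (lv T).card := Finset.card_pos.2 ⟨_, by simpa using hx⟩
    have hl := C.good.lvs
    have := C.hmax _ _ h1 (by omega)
    rw [Finset.card_insert_of_notMem hpU] at this
    have := C.good.card
    omega

end

end DomTree

namespace DomTree

variable {V : Type*} [Fintype V]

section
variable {G : SimpleGraph V} {k t : ℕ} {T : SimpleGraph V} {U : Finset V}
    {L : Fin 3 → ℕ → V} {m : Fin 3 → ℕ}

lemma Spider.edge_ne (S : Spider T L m) {a b : Fin 3} {j l : ℕ} (hl : l < m b) (hj : j < m a)
    (h : ¬ (b = a ∧ l = j)) :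
    ¬ ((L b l = L a j ∧ L b (l+1) = L a (j+1)) ∨ (L b l = L a (j+1) ∧ L b (l+1) = L a j)) := by
  rw [S.eq_iff (by omega) (by omega), S.eq_iff (by omega) (by omega), S.eq_iff (by omega) (by omega),
    S.eq_iff (by omega) (by omega)]
  rintro (⟨h1, h2⟩ | ⟨h1, h2⟩)
  · omega
  · omega

lemma Spider.del_up (S : Spider T L m) {a : Fin 3} {j i : ℕ} (hj : j < m a) (hi : i ≤ j) :
    (T.deleteEdges {s(L a j, L a (j+1))}).Reachable (L a 0) (L a i) := by
  refine chain (L a) 0 i (by omega) fun l h1 h2 => ?_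
  rw [del_adj]
  exact ⟨S.adj a l (by omega), S.edge_ne (by omega) hj (by omega)⟩

lemma Spider.del_down (S : Spider T L m) {a : Fin 3} {j i i' : ℕ} (hj : j < m a) (hi : j + 1 ≤ i)
    (hii : i ≤ i') (hi' : i' ≤ m a) :
    (T.deleteEdges {s(L a j, L a (j+1))}).Reachable (L a i) (L a i') := by
  refine chain (L a) i i' (by omega) fun l h1 h2 => ?_
  rw [del_adj]
  exact ⟨S.adj a l (by omega), S.edge_ne (by omega) hj (by omega)⟩

lemma Spider.del_other (S : Spider T L m) {a b : Fin 3} (hab : a ≠ b) {j i : ℕ} (hj : j < m a)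
    (hi : i ≤ m b) :
    (T.deleteEdges {s(L a j, L a (j+1))}).Reachable (L a 0) (L b i) := by
  rw [S.zero a b]
  refine chain (L b) 0 i (by omega) fun l h1 h2 => ?_
  rw [del_adj]
  exact ⟨S.adj b l (by omega), S.edge_ne (by omega) hj (by tauto)⟩

lemma Cfg.kill2 (C : Cfg G k t T U L m) {T' : SimpleGraph V} (h : TreeOn G T' U) {a b : Fin 3}
    (hab : a ≠ b) {q : V}
    (hs : ∀ v, deg T' v = 1 → v = q ∨ (deg T v = 1 ∧ v ≠ L a (m a) ∧ v ≠ L b (m b))) : False := by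
  classical
  have hsub : lv T' ⊆ insert q (((lv T).erase (L a (m a))).erase (L b (m b))) := by
    intro v hv
    have := hs v (by simpa using hv)
    simp only [Finset.mem_insert, Finset.mem_erase, mem_lv]
    tauto
  have hc := (Finset.card_le_card hsub).trans (Finset.card_insert_le _ _)
  have ha := C.endDeg a
  have hb := C.endDeg b
  have hne : L b (m b) ≠ L a (m a) := by
    intro he
    have h9 := C.sp.inj b a _ _ le_rfl le_rfl he
    have := C.sp.pos a
    rcases h9 with ⟨rfl, -⟩ | this
    · exact hab rfl
    · omega
  have hma : L a (m a) ∈ lv T := by simpa using ha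
  have hmb : L b (m b) ∈ (lv T).erase (L a (m a)) := by
    rw [Finset.mem_erase]; exact ⟨hne, by simpa using hb⟩
  have hpos := Finset.card_pos.2 ⟨_, hmb⟩
  rw [Finset.card_erase_of_mem hmb] at hc
  rw [Finset.card_erase_of_mem hma] at hc hpos
  have := C.hF _ _ h (by have := C.good.lvs; omega)
  have := C.good.card
  omega

lemma Cfg.kill1 (C : Cfg G k t T U L m) {T' : SimpleGraph V} (h : TreeOn G T' U) {a : Fin 3}
    (hs : ∀ v, deg T' v = 1 → (deg T v = 1 ∧ v ≠ L a (m a))) : False := by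
  classical
  have hsub : lv T' ⊆ ((lv T).erase (L a (m a))) := by
    intro v hv
    have := hs v (by simpa using hv)
    simp only [Finset.mem_erase, mem_lv]
    tauto
  have hc := (Finset.card_le_card hsub)
  have ha := C.endDeg a
  have hma : L a (m a) ∈ lv T := by simpa using ha
  rw [Finset.card_erase_of_mem hma] at hc
  have hpos := Finset.card_pos.2 ⟨_, hma⟩
  have := C.hF _ _ h (by have := C.good.lvs; omega)
  have := C.good.card
  omega

lemma Cfg.ends_ne (C : Cfg G k t T U L m) {a b : Fin 3} (hab : a ≠ b) {i : ℕ} (hi : i ≤ m a) :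
    L b (m b) ≠ L a i := by
  intro he
  have h9 := C.sp.inj b a _ _ le_rfl hi he
  have := C.sp.pos b
  rcases h9 with ⟨rfl, -⟩ | this
  · exact hab rfl
  · omega

lemma Cfg.lemA (C : Cfg G k t T U L m) {a b : Fin 3} (hab : a ≠ b) :
    ¬ G.Adj (L b (m b)) (L a (m a)) := by
  classical
  intro h
  have S := C.sp
  have hpa := S.pos a
  obtain ⟨h1, h2⟩ := C.good.tree.exch (S.adj a 0 hpa) h (S.del_other hab hpa le_rfl)
    (S.del_down hpa le_rfl hpa le_rfl)
  refine C.kill2 h1 hab (q := L a (0+1)) fun v hv => ?_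
  have e := h2 v
  have ha := C.endDeg a
  have hb := C.endDeg b
  have hr := S.deg_root a
  have n1 := C.ends_ne hab (i := 0+1) hpa
  have n2 := C.ends_ne hab (i := 0) (by omega)
  have n3 : L a (m a) ≠ L a 0 := by rw [Ne, S.eq_iff le_rfl (by omega)]; omega
  have n4 := C.ends_ne hab (i := m a) le_rfl
  grind

lemma Cfg.lemB (C : Cfg G k t T U L m) {a b : Fin 3} (hab : a ≠ b) {j : ℕ} (hj : j < m a)
    (hd : 3 ≤ deg T (L a j)) :
    ¬ G.Adj (L b (m b)) (L a (j+1)) := by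
  classical
  intro h
  have S := C.sp
  have hpa := S.pos a
  obtain ⟨h1, h2⟩ := C.good.tree.exch (S.adj a j hj) h
    ((S.del_up hj le_rfl).symm.trans (S.del_other hab hj le_rfl)) (Reachable.refl _)
  refine C.kill1 h1 (a := b) fun v hv => ?_
  have e := h2 v
  have hb := C.endDeg b
  have n1 := C.ends_ne hab (i := j+1) hj
  have n2 := C.ends_ne hab (i := j) (by omega)
  have n3 : L a j ≠ L a (j+1) := by rw [Ne, S.eq_iff (by omega) (by omega)]; omega
  grind

/-- double exchange -/
lemma Cfg.dbl (C : Cfg G k t T U L m) {a b : Fin 3} (hab : a ≠ b) {i j : ℕ} (hij : i ≤ j)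
    (hj : j < m a) (h1 : G.Adj (L a (m a)) (L a i)) (h2 : G.Adj (L b (m b)) (L a (j+1))) :
    ∃ T', TreeOn G T' U ∧ (∀ v [DecidableEq V], deg T' v + (if v = L a j ∨ v = L a (j+1) then 1 else 0)
      + (if v = L b 0 ∨ v = L b 1 then 1 else 0) = deg T v +
        (if v = L a i ∨ v = L a (m a) then 1 else 0) +
        (if v = L a (j+1) ∨ v = L b (m b) then 1 else 0)) ∧
      (i + 1 = j → T'.Adj (L a i) (L a j)) := by
  classical
  have S := C.sp
  have hpa := S.pos a
  have hpb := S.pos b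
  obtain ⟨t1, d1⟩ := C.good.tree.exch (S.adj a j hj) h1.symm
    ((S.del_up hj le_rfl).symm.trans (S.del_up hj hij)) (S.del_down hj le_rfl hj le_rfl)
  have adj2 : ∀ c l, l < m c → ¬ (c = a ∧ l = j) → ¬ (c = b ∧ l = 0) →
      ((exch T (L a j) (L a (j+1)) (L a i) (L a (m a))).deleteEdges {s(L b 0, L b (0+1))}).Adj
        (L c l) (L c (l+1)) := by
    intro c l hl e1 e2
    rw [del_adj, exch_adj]
    exact ⟨Or.inl ⟨S.adj c l hl, S.edge_ne hl hj e1⟩, S.edge_ne hl hpb e2⟩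
  have new : ((exch T (L a j) (L a (j+1)) (L a i) (L a (m a))).deleteEdges {s(L b 0, L b (0+1))}).Adj
        (L a i) (L a (m a)) := by
    rw [del_adj, exch_adj]
    refine ⟨Or.inr ⟨Or.inl ⟨rfl, rfl⟩, h1.ne'⟩, ?_⟩
    have n1 := C.ends_ne hab.symm (i := 0) (by omega)
    have n2 := C.ends_ne hab.symm (i := 0+1) hpb
    tauto
  have old : (exch T (L a j) (L a (j+1)) (L a i) (L a (m a))).Adj (L b 0) (L b (0+1)) := by
    rw [exch_adj]
    exact Or.inl ⟨S.adj b 0 hpb, S.edge_ne hpb hj (fun hh => hab hh.1.symm)⟩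
  have r1 : ((exch T (L a j) (L a (j+1)) (L a i) (L a (m a))).deleteEdges
      {s(L b 0, L b (0+1))}).Reachable (L b 0) (L a (j+1)) := by
    rw [S.zero b a]
    have c1 := chain (H := ((exch T (L a j) (L a (j+1)) (L a i) (L a (m a))).deleteEdges
      {s(L b 0, L b (0+1))})) (L a) 0 i (by omega)
      (fun l h1 h2 => adj2 a l (by omega) (by omega) (fun hh => hab hh.1))
    have c2 := chain (H := ((exch T (L a j) (L a (j+1)) (L a i) (L a (m a))).deleteEdges
      {s(L b 0, L b (0+1))})) (L a) (j+1) (m a) (by omega)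
      (fun l h1 h2 => adj2 a l (by omega) (by omega) (fun hh => hab hh.1))
    rw [S.zero b a] at c1 c2 new
    exact c1.trans (new.reachable.trans c2.symm)
  have r2 : ((exch T (L a j) (L a (j+1)) (L a i) (L a (m a))).deleteEdges
      {s(L b 0, L b (0+1))}).Reachable (L b (0+1)) (L b (m b)) :=
    chain (L b) (0+1) (m b) hpb (fun l h1 h2 => adj2 b l (by omega) (fun hh => hab hh.1.symm) (by omega))
  obtain ⟨t2, d2⟩ := t1.exch old h2.symm r1 r2
  refine ⟨_, t2, ?_, ?_⟩
  · intro v _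
    have e1 := d1 v
    have e2 := d2 v
    rw [zero_add] at e2
    rw [zero_add]
    split_ifs at * <;> omega
  · intro hij'
    rw [exch_adj]
    left
    have := adj2 a i (by omega) (by omega) (fun hh => hab hh.1)
    rw [del_adj, hij'] at this
    exact this

lemma Cfg.lemC (C : Cfg G k t T U L m) {a b : Fin 3} (hab : a ≠ b) {i : ℕ} (hj : i < m a)
    (h1 : G.Adj (L a (m a)) (L a i)) (h2 : G.Adj (L b (m b)) (L a (i+1))) : False := by
  classical
  obtain ⟨T', t1, d, -⟩ := C.dbl hab le_rfl hj h1 h2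
  have S := C.sp
  have hpa := S.pos a
  have hpb := S.pos b
  refine C.kill2 t1 hab (q := L b 1) fun v hv => ?_
  have e := d v
  have ha := C.endDeg a
  have hb := C.endDeg b
  have hr := S.deg_root b
  have n1 := C.ends_ne hab (i := i+1) hj
  have n2 := C.ends_ne hab (i := i) (by omega)
  have n3 : L a (m a) ≠ L a i := by rw [Ne, S.eq_iff le_rfl (by omega)]; omega
  have n3' : L a (m a) ≠ L a (i+1) := by
    intro hh; rw [← hh] at h2; exact C.lemA hab h2
  have n4 := C.ends_ne hab (i := m a) le_rfl
  have n5 := C.ends_ne hab.symm (i := 0) (by omega)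
  have n6 := C.ends_ne hab.symm (i := 1) (by omega)
  have n7 : L b (m b) ≠ L b 0 := by rw [Ne, S.eq_iff le_rfl (by omega)]; omega
  have n8 : L b 0 ≠ L a (i+1) := by rw [Ne, S.eq_iff (by omega) (by omega)]; omega
  have n9 : L a i ≠ L a (i+1) := by rw [Ne, S.eq_iff (by omega) (by omega)]; omega
  grind

lemma Cfg.lemE (C : Cfg G k t T U L m) {a b : Fin 3} (hab : a ≠ b) {i : ℕ} (hj : i + 1 < m a)
    (h1 : G.Adj (L a (m a)) (L a i)) (h2 : G.Adj (L b (m b)) (L a (i+2))) : False := by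
  classical
  have S := C.sp
  have hpa := S.pos a
  have hpb := S.pos b
  have hd2 := S.deg_mid a hj
  by_cases hd3 : 3 ≤ deg T (L a (i+1))
  · exact C.lemB hab hj hd3 h2
  obtain ⟨T', t1, d, hadj⟩ := C.dbl hab (by omega : i ≤ i + 1) hj h1 h2
  have hadj := hadj rfl
  have ha := C.endDeg a
  have hb := C.endDeg b
  have hr := S.deg_root b
  have hdi := S.deg_mid a (i := i) (by omega)
  have n1 := C.ends_ne hab (i := i+1) (by omega)
  have n1' := C.ends_ne hab (i := i+2) (by omega)
  have n2 := C.ends_ne hab (i := i) (by omega)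
  have n3 : L a (m a) ≠ L a i := by rw [Ne, S.eq_iff le_rfl (by omega)]; omega
  have n3' : L a (m a) ≠ L a (i+1) := by rw [Ne, S.eq_iff le_rfl (by omega)]; omega
  have n3'' : L a (m a) ≠ L a (i+2) := by
    intro hh; rw [← hh] at h2; exact C.lemA hab h2
  have n4 := C.ends_ne hab (i := m a) le_rfl
  have n5 := C.ends_ne hab.symm (i := 0) (by omega)
  have n6 := C.ends_ne hab.symm (i := 1) (by omega)
  have n7 : L b (m b) ≠ L b 0 := by rw [Ne, S.eq_iff le_rfl (by omega)]; omega
  have n8 : L b 0 ≠ L a (i+1) := by rw [Ne, S.eq_iff (by omega) (by omega)]; omega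
  have n8' : L b 0 ≠ L a (i+2) := by rw [Ne, S.eq_iff (by omega) (by omega)]; omega
  have n8'' : L b 0 ≠ L b 1 := by rw [Ne, S.eq_iff (by omega) (by omega)]; omega
  have n9 : L a i ≠ L a (i+1) := by rw [Ne, S.eq_iff (by omega) (by omega)]; omega
  have n9' : L a i ≠ L a (i+2) := by rw [Ne, S.eq_iff (by omega) (by omega)]; omega
  have n9'' : L a (i+1) ≠ L a (i+2) := by rw [Ne, S.eq_iff (by omega) (by omega)]; omega
  have n10 : ∀ j ≤ m a, L b 1 ≠ L a j := by
    intro j hj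
    rw [Ne, S.eq_iff (by omega) (by omega)]
    rintro (⟨rfl, _⟩ | h)
    · exact hab rfl
    · omega
  have n11 := n10 i (by omega)
  have n12 := n10 (i+1) (by omega)
  have n13 := n10 (i+2) (by omega)
  have hleaf : deg T' (L a (i+1)) = 1 := by
    have e := d (L a (i+1))
    grind
  have hbig : 3 ≤ deg T' (L a i) := by
    have e := d (L a i)
    by_cases hi0 : L a i = L b 0
    · have hr' : 3 ≤ deg T (L a i) := by rw [hi0]; exact hr
      clear hr hi0
      grind
    · grind
  have hsub : lv T' ⊆ insert (L a (i+1)) (insert (L b 1) (((lv T).erase (L a (m a))).erase (L b (m b)))) := by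
    intro v hv
    rw [mem_lv] at hv
    simp only [Finset.mem_insert, Finset.mem_erase, mem_lv]
    have e := d v
    grind
  have hc := (Finset.card_le_card hsub).trans (Finset.card_insert_le _ _)
  have hc := hc.trans (Nat.add_le_add_right (Finset.card_insert_le _ _) 1)
  have hma : L a (m a) ∈ lv T := by simpa using ha
  have hmb : L b (m b) ∈ (lv T).erase (L a (m a)) := by
    rw [Finset.mem_erase]; exact ⟨n4, by simpa using hb⟩
  have hpos := Finset.card_pos.2 ⟨_, hmb⟩
  rw [Finset.card_erase_of_mem hmb] at hc
  rw [Finset.card_erase_of_mem hma] at hc hpos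
  have hl := C.good.lvs
  exact no_leaf_branch C.hF (⟨t1, by omega, C.good.card⟩ : Good G k t T' U) hleaf hadj.symm hbig

lemma Cfg.lemD (C : Cfg G k t T U L m) {a b c : Fin 3} (hab : a ≠ b) (hac : a ≠ c) (hbc : b ≠ c)
    {i : ℕ} (hi : 1 ≤ i) (hj : i < m a)
    (h1 : G.Adj (L b (m b)) (L a i)) (h2 : G.Adj (L c (m c)) (L a (i+1))) : False := by
  classical
  have S := C.sp
  have hpa := S.pos a
  have hpb := S.pos b
  have hpc := S.pos c
  obtain ⟨t1, d1⟩ := C.good.tree.exch (S.adj a i hj) h2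
    ((S.del_up hj le_rfl).symm.trans (S.del_other hac hj le_rfl)) (Reachable.refl _)
  have adj2 : ∀ e l, l < m e → ¬ (e = a ∧ l = i) → ¬ (e = a ∧ l = 0) →
      ((exch T (L a i) (L a (i+1)) (L c (m c)) (L a (i+1))).deleteEdges {s(L a 0, L a (0+1))}).Adj
        (L e l) (L e (l+1)) := by
    intro c l hl e1 e2
    rw [del_adj, exch_adj]
    exact ⟨Or.inl ⟨S.adj c l hl, S.edge_ne hl hj e1⟩, S.edge_ne hl hpa e2⟩
  have old : (exch T (L a i) (L a (i+1)) (L c (m c)) (L a (i+1))).Adj (L a 0) (L a (0+1)) := by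
    rw [exch_adj]
    exact Or.inl ⟨S.adj a 0 hpa, S.edge_ne hpa hj (by omega)⟩
  have r1 : ((exch T (L a i) (L a (i+1)) (L c (m c)) (L a (i+1))).deleteEdges
      {s(L a 0, L a (0+1))}).Reachable (L a 0) (L b (m b)) := by
    have := chain (H := (exch T (L a i) (L a (i+1)) (L c (m c)) (L a (i+1))).deleteEdges
      {s(L a 0, L a (0+1))}) (L b) 0 (m b) (by omega)
      (fun l h1 h2 => adj2 b l (by omega) (fun hh => hab hh.1.symm) (fun hh => hab hh.1.symm))
    rwa [S.zero b a] at this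
  have r2 : ((exch T (L a i) (L a (i+1)) (L c (m c)) (L a (i+1))).deleteEdges
      {s(L a 0, L a (0+1))}).Reachable (L a (0+1)) (L a i) :=
    chain (L a) (0+1) i hi (fun l h1 h2 => adj2 a l (by omega) (by omega) (by omega))
  obtain ⟨t2, d2⟩ := t1.exch old h1 r1 r2
  refine C.kill2 t2 hbc (q := L a (0+1)) fun v hv => ?_
  have e1 := d1 v
  have e2 := d2 v
  have hb := C.endDeg b
  have hc := C.endDeg c
  have hr := S.deg_root a
  have n1 := C.ends_ne hab (i := i+1) (by omega)
  have n2 := C.ends_ne hab (i := i) (by omega)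
  have n3 := C.ends_ne hab (i := 0) (by omega)
  have n4 := C.ends_ne hab (i := 0+1) (by omega)
  have m1 := C.ends_ne hac (i := i+1) (by omega)
  have m2 := C.ends_ne hac (i := i) (by omega)
  have m3 := C.ends_ne hac (i := 0) (by omega)
  have m4 := C.ends_ne hac (i := 0+1) (by omega)
  have m5 := C.ends_ne hbc (i := m b) le_rfl
  have n5 : L a 0 ≠ L a i := by rw [Ne, S.eq_iff (by omega) (by omega)]; omega
  have n6 : L a 0 ≠ L a (i+1) := by rw [Ne, S.eq_iff (by omega) (by omega)]; omega
  have n7 : L a i ≠ L a (i+1) := by rw [Ne, S.eq_iff (by omega) (by omega)]; omega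
  grind

end

end DomTree

namespace DomTree

variable {V : Type*} [Fintype V]

section
variable {G : SimpleGraph V} {k t : ℕ} {T : SimpleGraph V} {U : Finset V}
    {L : Fin 3 → ℕ → V} {m : Fin 3 → ℕ}

lemma Spider.finset (S : Spider T L m) : ∃ F : Finset V, F.card = ∑ a, m a + 1 ∧
    ∀ v, v ∈ F ↔ ∃ a i, i ≤ m a ∧ v = L a i := by
  classical
  let F1 : Finset V := ((Finset.univ : Finset (Fin 3)).sigma (fun a => Finset.Icc 1 (m a))).image
    (fun x => L x.1 x.2)
  have hF1 : ∀ v, v ∈ F1 ↔ ∃ a i, 1 ≤ i ∧ i ≤ m a ∧ v = L a i := by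
    intro v
    simp only [F1, Finset.mem_image, Finset.mem_sigma, Finset.mem_univ, true_and, Finset.mem_Icc]
    constructor
    · rintro ⟨⟨a, i⟩, ⟨h1, h2⟩, rfl⟩
      exact ⟨a, i, h1, h2, rfl⟩
    · rintro ⟨a, i, h1, h2, rfl⟩
      exact ⟨⟨a, i⟩, ⟨h1, h2⟩, rfl⟩
  have hc : F1.card = ∑ a, m a := by
    rw [Finset.card_image_of_injOn, Finset.card_sigma]
    · simp
    · rintro ⟨a, i⟩ h1 ⟨b, j⟩ h2 he
      simp at h1 h2 he
      rcases S.inj a b i j h1.2 h2.2 he with ⟨rfl, rfl⟩ | h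
      · rfl
      · omega
  have hn : L 0 0 ∉ F1 := by
    rw [hF1]
    rintro ⟨a, i, h1, h2, h3⟩
    have := S.inj _ _ _ _ (by omega) h2 h3
    omega
  refine ⟨insert (L 0 0) F1, by rw [Finset.card_insert_of_notMem hn, hc], ?_⟩
  intro v
  rw [Finset.mem_insert, hF1]
  constructor
  · rintro (rfl | ⟨a, i, h1, h2, rfl⟩)
    · exact ⟨0, 0, by omega, rfl⟩
    · exact ⟨a, i, h2, rfl⟩
  · rintro ⟨a, i, h2, rfl⟩
    rcases Nat.eq_zero_or_pos i with rfl | h0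
    · exact Or.inl (S.zero a 0)
    · exact Or.inr ⟨a, i, h0, h2, rfl⟩

lemma Cfg.degSum (C : Cfg G k t T U L m) : ∑ a, deg G (L a (m a)) ≤ ∑ a, m a := by
  classical
  have S := C.sp
  let A : Fin 3 → Finset ℕ := fun a =>
    (Finset.range (m a)).filter fun i => G.Adj (L a (m a)) (L a i)
  let B : Fin 3 → Finset ℕ := fun a =>
    (Finset.range (m a)).filter fun i => G.Adj (L (a+1) (m (a+1))) (L a (i+1))
  let D : Fin 3 → Finset ℕ := fun a =>
    (Finset.range (m a)).filter fun i => i + 2 ≤ m a ∧ G.Adj (L (a+2) (m (a+2))) (L a (i+2))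
  have ne1 : ∀ a : Fin 3, a ≠ a + 1 := by decide
  have ne2 : ∀ a : Fin 3, a ≠ a + 2 := by decide
  have ne3 : ∀ a : Fin 3, a + 1 ≠ a + 2 := by decide
  have s1 : ∀ a : Fin 3, a + 2 + 1 = a := by decide
  have s2 : ∀ a : Fin 3, a + 1 + 2 = a := by decide
  have s3 : ∀ a b : Fin 3, b = a ∨ b = a + 2 ∨ b = a + 1 := by decide
  have leg : ∀ a, (A a).card + (B a).card + (D a).card ≤ m a := by
    intro a
    have d1 : Disjoint (A a) (B a) := by
      rw [Finset.disjoint_left]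
      intro i h1 h2
      simp only [A, B, Finset.mem_filter, Finset.mem_range] at h1 h2
      exact C.lemC (ne1 a) h1.1 h1.2 h2.2
    have d2 : Disjoint (A a ∪ B a) (D a) := by
      rw [Finset.disjoint_left]
      intro i h1 h2
      simp only [A, B, D, Finset.mem_union, Finset.mem_filter, Finset.mem_range] at h1 h2
      rcases h1 with h1 | h1
      · exact C.lemE (ne2 a) (by omega) h1.2 h2.2.2
      · exact C.lemD (ne1 a) (ne2 a) (ne3 a) (i := i + 1) (by omega) (by omega) h1.2 h2.2.2
    rw [← Finset.card_union_of_disjoint d1, ← Finset.card_union_of_disjoint d2]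
    calc _ ≤ (Finset.range (m a)).card := by
          apply Finset.card_le_card
          refine Finset.union_subset (Finset.union_subset ?_ ?_) ?_ <;> exact Finset.filter_subset _ _
      _ = m a := by simp
  have dg : ∀ a, deg G (L a (m a)) ≤ (A a).card + (B (a+2)).card + (D (a+1)).card := by
    intro a
    have hsub : G.neighborSet (L a (m a)) ⊆ (((A a).image (L a) ∪ (B (a+2)).image (fun i => L (a+2) (i+1)) ∪
        (D (a+1)).image (fun i => L (a+1) (i+2)) : Finset V) : Set V) := by
      intro p hp
      have hp : G.Adj (L a (m a)) p := hp
      obtain ⟨b, i, hi, rfl⟩ := C.nbr a hp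
      rw [Finset.mem_coe, Finset.mem_union, Finset.mem_union]
      have hpos := S.pos a
      rcases Nat.eq_zero_or_pos i with rfl | h0
      · left; left
        rw [Finset.mem_image]
        refine ⟨0, ?_, S.zero a b⟩
        rw [S.zero b a] at hp
        simp only [A, Finset.mem_filter, Finset.mem_range]
        exact ⟨by omega, hp⟩
      · rcases s3 a b with rfl | rfl | rfl
        · left; left
          rw [Finset.mem_image]
          refine ⟨i, ?_, rfl⟩
          simp only [A, Finset.mem_filter, Finset.mem_range]
          refine ⟨?_, hp⟩
          rcases Nat.lt_or_ge i (m b) with h | h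
          · exact h
          · exfalso
            have : i = m b := by omega
            subst this
            exact G.irrefl hp
        · left; right
          rw [Finset.mem_image]
          obtain ⟨j, rfl⟩ : ∃ j, i = j + 1 := ⟨i - 1, by omega⟩
          refine ⟨j, ?_, rfl⟩
          simp only [B, Finset.mem_filter, Finset.mem_range]
          rw [s1]
          exact ⟨by omega, hp⟩
        · right
          rw [Finset.mem_image]
          have h1 : i ≠ 1 := by
            rintro rfl
            exact C.lemB (ne1 a).symm (j := 0) (by omega) (S.deg_root _) hp
          obtain ⟨j, rfl⟩ : ∃ j, i = j + 2 := ⟨i - 2, by omega⟩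
          refine ⟨j, ?_, rfl⟩
          simp only [D, Finset.mem_filter, Finset.mem_range]
          rw [s2]
          exact ⟨by omega, by omega, hp⟩
    have h1 := Set.ncard_le_ncard hsub (Set.toFinite _)
    rw [Set.ncard_coe_finset] at h1
    refine h1.trans ((Finset.card_union_le _ _).trans ?_)
    refine Nat.add_le_add ((Finset.card_union_le _ _).trans ?_) Finset.card_image_le
    exact Nat.add_le_add Finset.card_image_le Finset.card_image_le
  have l0 := leg 0
  have l1 := leg 1
  have l2 := leg 2
  have e0 := dg 0
  have e1 := dg 1
  have e2 := dg 2
  rw [Fin.sum_univ_three, Fin.sum_univ_three]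
  rw [show (0 : Fin 3) + 2 = 2 by rfl, show (0 : Fin 3) + 1 = 1 by rfl] at e0
  rw [show (1 : Fin 3) + 2 = 0 by rfl, show (1 : Fin 3) + 1 = 2 by rfl] at e1
  rw [show (2 : Fin 3) + 2 = 1 by rfl, show (2 : Fin 3) + 1 = 0 by rfl] at e2
  omega

lemma Cfg.count (C : Cfg G k t T U L m) (hk : 2 ≤ k) : ∑ a, m a + 1 + 2 * (k - 2) ≤ t := by
  classical
  have S := C.sp
  obtain ⟨F, hFc, hFm⟩ := S.finset
  have hlv : k + 1 ≤ (lv T).card := by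
    by_contra hh
    have := C.hF _ _ C.good.tree (by omega)
    have := C.good.card
    omega
  have hrU := C.memU 0 (i := 0) (by omega)
  have hr := S.deg_root 0
  let O : Finset V := lv T \ (Finset.univ : Finset (Fin 3)).image (fun a => L a (m a))
  have hO : k - 2 ≤ O.card := by
    have h1 := Finset.le_card_sdiff ((Finset.univ : Finset (Fin 3)).image (fun a => L a (m a))) (lv T)
    have h2 : ((Finset.univ : Finset (Fin 3)).image (fun a => L a (m a))).card ≤ 3 :=
      Finset.card_image_le.trans (by simp)
    have h3 : O.card = (lv T \ (Finset.univ : Finset (Fin 3)).image (fun a => L a (m a))).card := rfl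
    omega
  have hOm : ∀ l ∈ O, deg T l = 1 ∧ l ∉ F := by
    intro l hl
    simp only [O, Finset.mem_sdiff, mem_lv, Finset.mem_image, Finset.mem_univ, true_and] at hl
    refine ⟨hl.1, ?_⟩
    rw [hFm]
    rintro ⟨a, i, hi, rfl⟩
    rcases Nat.lt_or_ge i (m a) with h | h
    · have := S.deg_mid a h
      omega
    · have : i = m a := by omega
      subst this
      exact hl.2 ⟨a, rfl⟩
  have hex : ∀ l, ∃ q, deg T l = 1 → T.Adj l q := by
    intro l
    by_cases h : deg T l = 1
    · obtain ⟨d, hd⟩ := Set.ncard_eq_one.1 h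
      have : d ∈ T.neighborSet l := by rw [hd]; rfl
      exact ⟨d, fun _ => this⟩
    · exact ⟨l, fun h' => absurd h' h⟩
  choose π hπ using hex
  have hq2 : ∀ l, deg T l = 1 → deg T (π l) ≤ 2 := by
    intro l hl
    by_contra hh
    exact no_leaf_branch C.hF C.good hl (hπ l hl) (by omega)
  have hq1 : ∀ l, deg T l = 1 → deg T (π l) ≠ 1 := by
    intro l hl h1
    have hadj := hπ l hl
    have := closed_reach (T := T) (fun v => v = l ∨ v = π l) (by
      rintro a b (rfl | rfl) hab
      · exact Or.inr (deg_one hl hab hadj)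
      · exact Or.inl (deg_one h1 hab hadj.symm))
      (C.good.tree.conn l (C.good.tree.mem _ _ hadj) _ hrU) (Or.inl rfl)
    rcases this with h | h <;> rw [h] at hr <;> omega
  have hinj : ∀ l l', deg T l = 1 → deg T l' = 1 → π l = π l' → l = l' := by
    intro l l' hl hl' he
    by_contra hne
    have hadj := hπ l hl
    have hadj' := hπ l' hl'
    rw [← he] at hadj'
    have h2 := hq2 l hl
    have := closed_reach (T := T) (fun v => v = l ∨ v = π l ∨ v = l') (by
      rintro a b (rfl | rfl | rfl) hab
      · exact Or.inr (Or.inl (deg_one hl hab hadj))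
      · by_contra! hcon
        have := deg_three hadj.symm hadj'.symm hab hne hcon.1.symm hcon.2.2.symm
        omega
      · exact Or.inr (Or.inl (deg_one hl' hab hadj')))
      (C.good.tree.conn l (C.good.tree.mem _ _ hadj) _ hrU) (Or.inl rfl)
    rcases this with h | h | h <;> rw [h] at hr <;> omega
  have hPF : ∀ l ∈ O, π l ∉ F := by
    intro l hl hF
    obtain ⟨h1, h2⟩ := hOm l hl
    have hadj := hπ l h1
    have hle := hq2 l h1
    have hl0 : ∀ a i, i ≤ m a → L a i ≠ l := by
      rintro a i hi rfl
      exact h2 ((hFm _).2 ⟨a, i, hi, rfl⟩)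
    obtain ⟨a, i, hi, he⟩ := (hFm _).1 hF
    rw [he] at hadj hle
    rcases Nat.eq_zero_or_pos i with rfl | h0
    · have := S.deg_root a
      omega
    · obtain ⟨j, rfl⟩ : ∃ j, i = j + 1 := ⟨i - 1, by omega⟩
      have hj := (S.adj a j (by omega)).symm
      rcases Nat.lt_or_ge (j+1) (m a) with h | h
      · have := deg_three hj (S.adj a (j+1) h) hadj.symm (by
          intro he
          have := S.inj a a j (j+2) (by omega) (by omega) he
          omega) (hl0 a j (by omega)) (hl0 a (j+2) (by omega))
        omega
      · have hm : j + 1 = m a := by omega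
        have hd := C.endDeg a
        rw [← hm] at hd
        exact hl0 a j (by omega) (deg_one hd hj hadj.symm)
  have dFO : Disjoint F O := by
    rw [Finset.disjoint_right]
    exact fun l hl => (hOm l hl).2
  have dP : Disjoint (F ∪ O) (O.image π) := by
    rw [Finset.disjoint_right]
    intro q hq hh
    obtain ⟨l, hl, rfl⟩ := Finset.mem_image.1 hq
    rcases Finset.mem_union.1 hh with hh | hh
    · exact hPF l hl hh
    · exact hq1 l (hOm l hl).1 (hOm _ hh).1
  have hsub : F ∪ O ∪ O.image π ⊆ U := by
    refine Finset.union_subset (Finset.union_subset ?_ ?_) ?_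
    · intro v hv
      obtain ⟨a, i, hi, rfl⟩ := (hFm v).1 hv
      exact C.memU a hi
    · intro l hl
      exact C.good.tree.mem _ _ (hπ l (hOm l hl).1)
    · intro q hq
      obtain ⟨l, hl, rfl⟩ := Finset.mem_image.1 hq
      exact C.good.tree.mem _ _ (hπ l (hOm l hl).1).symm
  have hc := Finset.card_le_card hsub
  rw [Finset.card_union_of_disjoint dP, Finset.card_union_of_disjoint dFO,
    Finset.card_image_of_injOn (fun l hl l' hl' he => hinj l l' (hOm l hl).1 (hOm l' hl').1 he),
    C.good.card] at hc
  omega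

end

lemma find_edge {G : SimpleGraph V} (hconn : G.Connected) {U : Finset V} (hne : U.Nonempty)
    {u v : V} (hu : u ∉ U) (hv : v ∉ U) (huv : G.Adj u v) :
    ∃ p a b, p ∈ U ∧ a ∉ U ∧ b ∉ U ∧ G.Adj p a ∧ G.Adj a b := by
  obtain ⟨s, hs⟩ := hne
  obtain ⟨w⟩ := hconn.preconnected u s
  induction w generalizing v with
  | nil => exact absurd hs hu
  | @cons a b c h1 _ ih =>
    by_cases hb : b ∈ U
    · exact ⟨b, a, v, hb, hu, hv, h1.symm, huv⟩
    · exact ih hb hu h1.symm hs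

lemma extend {G : SimpleGraph V} (hconn : G.Connected) {k t : ℕ} (hk : 2 ≤ k)
    (hmax : ∀ T U, TreeOn G T U → (lv T).card ≤ k + 1 → U.card ≤ t)
    {T : SimpleGraph V} {U : Finset V} (h : TreeOn G T U) (hl : (lv T).card ≤ k)
    {u v : V} (hu : u ∉ U) (hv : v ∉ U) (huv : G.Adj u v) : U.card + 2 ≤ t := by
  classical
  obtain ⟨p, a, b, hp, ha, hb, hpa, hab⟩ := find_edge hconn h.ne hu hv huv
  obtain ⟨t1, d1⟩ := h.addLeaf hp ha hpa
  have hb' : b ∉ insert a U := by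
    rw [Finset.mem_insert]
    rintro (rfl | h)
    · exact G.irrefl hab
    · exact hb h
  obtain ⟨t2, d2⟩ := t1.addLeaf (Finset.mem_insert_self a U) hb' hab
  have hc : (lv (T ⊔ edge p a ⊔ edge a b)).card ≤ k + 1 := by
    by_cases hp0 : deg T p = 0
    · have hiso : ∀ q, ¬ T.Adj p q := by
        intro q hq
        have := deg_pos hq
        omega
      have hT0 : ∀ v, deg T v ≠ 1 := by
        intro v hv
        obtain ⟨d, hd⟩ := Set.ncard_eq_one.1 hv
        have hvd : T.Adj v d := by
          have : d ∈ T.neighborSet v := by rw [hd]; rfl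
          exact this
        obtain ⟨w⟩ := h.conn p hp v (h.mem _ _ hvd)
        cases w with
        | nil => exact hiso _ hvd
        | cons h1 _ => exact hiso _ h1
      have hsub : lv (T ⊔ edge p a ⊔ edge a b) ⊆ {p, b} := by
        intro v hv
        rw [mem_lv] at hv
        have e1 := d1 v
        have e2 := d2 v
        have e3 := hT0 v
        have := hpa.ne
        have := hab.ne
        simp only [Finset.mem_insert, Finset.mem_singleton]
        grind
      have := (Finset.card_le_card hsub).trans Finset.card_le_two
      omega
    · have hsub : lv (T ⊔ edge p a ⊔ edge a b) ⊆ insert b (lv T) := by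
        intro v hv
        rw [mem_lv] at hv
        have e1 := d1 v
        have e2 := d2 v
        have := hpa.ne
        have := hab.ne
        simp only [Finset.mem_insert, mem_lv]
        grind
      have := (Finset.card_le_card hsub).trans (Finset.card_insert_le _ _)
      omega
  have := hmax _ _ t2 hc
  rw [Finset.card_insert_of_notMem hb', Finset.card_insert_of_notMem ha] at this
  omega

end DomTree

namespace DomTree
theorem spider0 {V : Type*} {T : SimpleGraph V} {r b c d : V} (hb : T.Adj r b) (hc : T.Adj r c)
    (hd : T.Adj r d) (hbc : b ≠ c) (hbd : b ≠ d) (hcd : c ≠ d) :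
    Spider T (fun a i => if i = 0 then r else ![b, c, d] a) (fun _ => 1) := by
  have h1 := hb.ne
  have h2 := hc.ne
  have h3 := hd.ne
  refine ⟨fun _ _ => rfl, fun _ => le_rfl, ?_, ?_⟩
  · intro a i hi
    have : i = 0 := by omega
    subst this
    fin_cases a <;> simp [hb, hc, hd]
  · intro a e i j hi hj he
    interval_cases i <;> interval_cases j <;> fin_cases a <;> fin_cases e <;>
      simp [h1, h2, h3, h1.symm, h2.symm, h3.symm, hbc, hbd, hcd, hbc.symm, hbd.symm, hcd.symm] at he ⊢
end DomTree

/-- If `k ≥ 2`, `G` is connected and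
`d(x) + d(y) + d(z) ≥ t_{k+1} - 2k + 4` for every independent triple `{x, y, z}`,
then `G` has a dominating tree with at most `k` leaves. -/
theorem dominating_k_ended_tree_of_treeOrd {V : Type*} [Fintype V] (k : ℕ) (hk : 2 ≤ k)
    (G : SimpleGraph V) (hconn : G.Connected)
    (hdeg : ∀ x y z : V, x ≠ y → x ≠ z → y ≠ z →
      ¬G.Adj x y → ¬G.Adj x z → ¬G.Adj y z →
      (treeOrd G (k + 1) : ℤ) - 2 * k + 4 ≤ (deg G x : ℤ) + deg G y + deg G z) :
    ∃ H : G.Subgraph, IsEndedTree H k ∧ IsIndep G H.vertsᶜ := by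
  classical
  by_contra hno
  have hno' : ∀ T U, DomTree.TreeOn G T U → (DomTree.lv T).card ≤ k →
      ∃ u v, u ∉ U ∧ v ∉ U ∧ G.Adj u v := by
    intro T U h hl
    obtain ⟨H, hH, hv⟩ := h.toSub hl
    by_contra! hcon
    refine hno ⟨H, hH, ?_⟩
    intro a ha b hb _
    rw [hv] at ha hb
    exact hcon a b (by simpa using ha) (by simpa using hb)
  obtain ⟨v0⟩ := hconn.nonempty
  have h0 : DomTree.TreeOn G ⊥ {v0} := by
    refine ⟨bot_le, isAcyclic_bot, fun u v h => absurd h (by simp), by simp, ?_⟩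
    intro u hu v hv
    rw [Finset.mem_singleton] at hu hv
    subst hu; subst hv
    exact Reachable.refl _
  have hl0 : (DomTree.lv (⊥ : SimpleGraph V)).card ≤ k + 1 := by
    have : DomTree.lv (⊥ : SimpleGraph V) = ∅ := by
      ext v
      simp [deg]
    simp [this]
  obtain ⟨⟨T, U⟩, ⟨hT, hTl⟩, hTmax⟩ := Set.exists_max_image
    {p : SimpleGraph V × Finset V | DomTree.TreeOn G p.1 p.2 ∧ (DomTree.lv p.1).card ≤ k + 1}
    (fun p => p.2.card) (Set.toFinite _) ⟨(⊥, {v0}), h0, hl0⟩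
  replace hT : DomTree.TreeOn G T U := hT
  replace hTl : (DomTree.lv T).card ≤ k + 1 := hTl
  have hmax : ∀ T' U', DomTree.TreeOn G T' U' → (DomTree.lv T').card ≤ k + 1 → U'.card ≤ U.card :=
    fun T' U' h1 h2 => hTmax (T', U') ⟨h1, h2⟩
  have hF : ∀ T' U', DomTree.TreeOn G T' U' → (DomTree.lv T').card ≤ k → U'.card + 2 ≤ U.card := by
    intro T' U' h1 h2
    obtain ⟨u, v, hu, hv, huv⟩ := hno' T' U' h1 h2
    exact DomTree.extend hconn hk hmax h1 h2 hu hv huv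
  have hgood : DomTree.Good G k U.card T U := ⟨hT, hTl, rfl⟩
  have hl3 : 3 ≤ (DomTree.lv T).card := by
    by_contra hh
    have := hF T U hT (by omega)
    omega
  obtain ⟨r, hr⟩ := DomTree.exists_deg_three hT hl3
  obtain ⟨b, c, d, hb, hc, hd, hbc, hbd, hcd⟩ := DomTree.three_of_deg hr
  have hsp : DomTree.Spider T (fun a i => if i = 0 then r else ![b, c, d] a) (fun _ => 1) := DomTree.spider0 hb hc hd hbc hbd hcd
  let P : Set ℕ := {n | ∃ T' U' L m, DomTree.Good G k U.card T' U' ∧ DomTree.Spider T' L m ∧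
    ∑ a, m a = n}
  have hPne : P.Nonempty := ⟨_, T, U, _, _, hgood, hsp, rfl⟩
  have hPb : BddAbove P := by
    refine ⟨Fintype.card V, ?_⟩
    rintro n ⟨T', U', L, m, -, hS, rfl⟩
    obtain ⟨F, hF, -⟩ := hS.finset
    have := Finset.card_le_univ F
    omega
  obtain ⟨T', U', L, m, hg, hS, hsum⟩ := Nat.sSup_mem hPne hPb
  have C : DomTree.Cfg G k U.card T' U' L m := by
    refine ⟨hg, hF, hmax, hS, ?_⟩
    intro T2 U2 L2 m2 hg2 hS2
    rw [hsum]
    exact le_csSup hPb ⟨T2, U2, L2, m2, hg2, hS2, rfl⟩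
  have h1 := C.degSum
  have h2 := C.count hk
  have h3 := hT.le_ord hTl
  have h4 := hdeg (L 0 (m 0)) (L 1 (m 1)) (L 2 (m 2))
    (C.ends_ne (by decide) le_rfl) (C.ends_ne (by decide) le_rfl) (C.ends_ne (by decide) le_rfl)
    (C.lemA (by decide)) (C.lemA (by decide)) (C.lemA (by decide))
  rw [Fin.sum_univ_three] at h1
  omega
end

section
/- Let k ≥ 2 be an integer and let G be a connected simple graph of order n such that d(x) + d(y) + d(z) ≥ n − 2k + 4 for every independent set {x, y, z} of three pairwise nonadjacent vertices. Then G has a dominating k-ended tree, i.e., a subgraph T that is a tree with at most k leaves such that the set of vertices of G not in T is an independent set. -/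
open SimpleGraph

namespace DKT

variable {V : Type*}

structure Conn (F : SimpleGraph V) (S : Set V) : Prop where
  supp : ∀ a b, F.Adj a b → a ∈ S
  reach : ∀ a ∈ S, ∀ b ∈ S, F.Reachable a b

noncomputable def exc [Fintype V] (F : SimpleGraph V) : ℕ := ∑ v, (deg F v - 2)

noncomputable def dsum [Fintype V] (F : SimpleGraph V) : ℕ := ∑ v, deg F v

def PathIn (F : SimpleGraph V) (p : ℕ → V) (m : ℕ) : Prop :=
  (∀ i j, i ≤ m → j ≤ m → p i = p j → i = j) ∧ ∀ i, i < m → F.Adj (p i) (p (i+1))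

def addE (F : SimpleGraph V) (a b : V) : SimpleGraph V := F ⊔ SimpleGraph.edge a b

def delE (F : SimpleGraph V) (a b : V) : SimpleGraph V := F \ SimpleGraph.edge a b

lemma addE_adj {F : SimpleGraph V} {a b c d : V} :
    (addE F a b).Adj c d ↔ F.Adj c d ∨ ((c = a ∧ d = b ∨ c = b ∧ d = a) ∧ c ≠ d) := by
  simp only [addE, sup_adj, edge_adj]

lemma delE_adj {F : SimpleGraph V} {a b c d : V} :
    (delE F a b).Adj c d ↔ F.Adj c d ∧ ¬ (c = a ∧ d = b ∨ c = b ∧ d = a) := by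
  simp only [delE, sdiff_adj, edge_adj]
  constructor
  · rintro ⟨h, h2⟩
    exact ⟨h, fun h3 => h2 ⟨h3, h.ne⟩⟩
  · rintro ⟨h, h2⟩
    exact ⟨h, fun h3 => h2 h3.1⟩

lemma addE_self {F : SimpleGraph V} {a b : V} (h : a ≠ b) : (addE F a b).Adj a b := by
  rw [addE_adj]; exact Or.inr ⟨Or.inl ⟨rfl, rfl⟩, h⟩

lemma addE_le {F G : SimpleGraph V} {a b : V} (h : F ≤ G) (hab : G.Adj a b) : addE F a b ≤ G := by
  intro c d hcd
  rw [addE_adj] at hcd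
  rcases hcd with h1 | ⟨⟨rfl, rfl⟩ | ⟨rfl, rfl⟩, _⟩
  · exact h h1
  · exact hab
  · exact hab.symm

lemma delE_le {F G : SimpleGraph V} {a b : V} (h : F ≤ G) : delE F a b ≤ G := by
  intro c d hcd
  rw [delE_adj] at hcd
  exact h hcd.1

open Classical in
lemma deg_addE [Finite V] (F : SimpleGraph V) (a b v : V) :
    deg (addE F a b) v ≤ deg F v + (if v = a then 1 else 0) + (if v = b then 1 else 0) := by
  unfold deg
  by_cases h1 : v = a
  · subst h1
    have : (addE F v b).neighborSet v ⊆ insert b (F.neighborSet v) := by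
      intro d hd
      simp only [mem_neighborSet, addE_adj] at hd
      simp only [Set.mem_insert_iff, mem_neighborSet]
      rcases hd with h | ⟨⟨_, rfl⟩ | ⟨h, h'⟩, h2⟩
      · exact Or.inr h
      · exact Or.inl rfl
      · exact absurd h'.symm h2
    have h3 := Set.ncard_le_ncard this (Set.toFinite _)
    have h4 := Set.ncard_insert_le b (F.neighborSet v)
    simp only [if_true]
    omega
  · by_cases h2 : v = b
    · subst h2
      have : (addE F a v).neighborSet v ⊆ insert a (F.neighborSet v) := by
        intro d hd
        simp only [mem_neighborSet, addE_adj] at hd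
        simp only [Set.mem_insert_iff, mem_neighborSet]
        rcases hd with h | ⟨⟨h, rfl⟩ | ⟨h, h'⟩, h2⟩
        · exact Or.inr h
        · exact absurd h h1
        · exact Or.inl h'
      have h3 := Set.ncard_le_ncard this (Set.toFinite _)
      have h4 := Set.ncard_insert_le a (F.neighborSet v)
      simp only [if_true]
      omega
    · have : (addE F a b).neighborSet v ⊆ (F.neighborSet v) := by
        intro d hd
        simp only [mem_neighborSet, addE_adj] at hd
        simp only [mem_neighborSet]
        tauto
      have h3 := Set.ncard_le_ncard this (Set.toFinite _)
      omega

open Classical in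
lemma deg_delE [Finite V] (F : SimpleGraph V) (a b v : V) (hab : F.Adj a b) :
    deg (delE F a b) v + (if v = a then 1 else 0) + (if v = b then 1 else 0) ≤ deg F v := by
  unfold deg
  have key : ∀ c, F.Adj v c → ¬ (delE F a b).Adj v c →
      ((delE F a b).neighborSet v).ncard + 1 ≤ (F.neighborSet v).ncard := by
    intro c h1 h2
    apply Set.ncard_lt_ncard _ (Set.toFinite _)
    refine ⟨fun d hd => ?_, fun h => h2 (h h1)⟩
    simp only [mem_neighborSet, delE_adj] at hd
    exact hd.1
  by_cases h1 : v = a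
  · subst h1
    have := key b hab (by simp [delE_adj])
    have h2 : v ≠ b := hab.ne
    simp only [if_true, if_neg h2]
    omega
  · by_cases h2 : v = b
    · subst h2
      have := key a hab.symm (by simp [delE_adj])
      simp only [if_true, if_neg h1]
      omega
    · have : (delE F a b).neighborSet v ⊆ (F.neighborSet v) := by
        intro d hd
        simp only [mem_neighborSet, delE_adj] at hd
        exact hd.1
      have h3 := Set.ncard_le_ncard this (Set.toFinite _)
      simp only [if_neg h1, if_neg h2]
      omega

lemma deg_mono [Finite V] {F F' : SimpleGraph V} (h : F' ≤ F) (v : V) : deg F' v ≤ deg F v :=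
  Set.ncard_le_ncard (fun _ hd => h hd) (Set.toFinite _)

lemma exc_le [Fintype V] {F F' : SimpleGraph V} (h : ∀ v, deg F' v ≤ max (deg F v) 2) :
    exc F' ≤ exc F := by
  apply Finset.sum_le_sum
  intro v _
  have := h v
  omega

lemma exc_lt [Fintype V] {F F' : SimpleGraph V} (h : ∀ v, deg F' v ≤ max (deg F v) 2)
    (w : V) (hw : 3 ≤ deg F w) (hw' : deg F' w < deg F w) :
    exc F' + 1 ≤ exc F := by
  apply Nat.succ_le_of_lt
  apply Finset.sum_lt_sum
  · intro v _
    have := h v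
    omega
  · exact ⟨w, Finset.mem_univ _, by omega⟩

lemma reach_of {F F' : SimpleGraph V} (φ : V → V)
    (hadj : ∀ a b, F.Adj a b → F'.Reachable (φ a) (φ b)) {a b : V} (h : F.Reachable a b) :
    F'.Reachable (φ a) (φ b) := by
  obtain ⟨w⟩ := h
  induction w with
  | nil => exact Reachable.refl _
  | cons h _ ih => exact (hadj _ _ h).trans ih

lemma Conn.of {F F' : SimpleGraph V} {S S' : Set V} (hF : Conn F S) (φ : V → V)
    (hS : ∀ a ∈ S', a ∈ S ∧ φ a = a) (hsupp : ∀ a b, F'.Adj a b → a ∈ S')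
    (hadj : ∀ a b, F.Adj a b → F'.Reachable (φ a) (φ b)) : Conn F' S' := by
  refine ⟨hsupp, fun a ha b hb => ?_⟩
  have := reach_of φ hadj (hF.reach a (hS a ha).1 b (hS b hb).1)
  rwa [(hS a ha).2, (hS b hb).2] at this

lemma deg_zero {F : SimpleGraph V} {S : Set V} (h : Conn F S) {v : V} (hv : v ∉ S) :
    deg F v = 0 := by
  unfold deg
  have : F.neighborSet v = ∅ := by
    ext d
    simp only [mem_neighborSet, Set.mem_empty_iff_false, iff_false]
    exact fun h' => hv (h.supp _ _ h')
  simp [this]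

lemma Conn.addE_in {F : SimpleGraph V} {S : Set V} (h : Conn F S) {a b : V} (ha : a ∈ S)
    (hb : b ∉ S) : Conn (addE F a b) (insert b S) := by
  have hab : a ≠ b := fun h' => hb (h' ▸ ha)
  have hmono : F ≤ addE F a b := le_sup_left
  refine ⟨?_, ?_⟩
  · intro c d hcd
    rw [addE_adj] at hcd
    rcases hcd with h1 | ⟨⟨rfl, rfl⟩ | ⟨rfl, rfl⟩, _⟩
    · exact Or.inr (h.supp _ _ h1)
    · exact Or.inr ha
    · exact Or.inl rfl
  · have key : ∀ c ∈ insert b S, (addE F a b).Reachable a c := by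
      rintro c (rfl | hc)
      · exact (addE_self hab).reachable
      · exact (h.reach a ha c hc).mono hmono
    intro c hc d hd
    exact (key c hc).symm.trans (key d hd)

open Classical in
lemma exc_addE [Fintype V] (F : SimpleGraph V) (a b : V) (hb : deg F b ≤ 1) :
    exc (addE F a b) ≤ exc F + (if deg F a ≤ 1 then 0 else 1) := by
  have : exc (addE F a b) ≤ ∑ v, ((deg F v - 2) + if v = a then (if deg F a ≤ 1 then 0 else 1) else 0) := by
    apply Finset.sum_le_sum
    intro v _
    have := deg_addE F a b v
    by_cases h1 : v = a
    · subst h1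
      by_cases h2 : v = b
      · subst h2
        have h3 : addE F v v = F := by simp [addE]
        rw [h3]; omega
      · simp only [if_true, if_neg h2] at this ⊢
        split_ifs <;> omega
    · by_cases h2 : v = b
      · subst h2
        simp only [if_true, if_neg h1] at this ⊢
        omega
      · simp only [if_neg h1, if_neg h2] at this ⊢
        omega
  rw [Finset.sum_add_distrib] at this
  simpa [exc] using this

/-! transfer to the induced graph -/

lemma deg_map {S : Set V} (T : SimpleGraph S) (v : S) :
    deg (T.map (Function.Embedding.subtype _)) (v : V) = deg T v := by
  unfold deg
  have h : (T.map (Function.Embedding.subtype (· ∈ S))).neighborSet (v : V)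
      = (Function.Embedding.subtype (· ∈ S)) '' (T.neighborSet v) := 
    neighborSet_map T (Function.Embedding.subtype (· ∈ S)) v
  exact (congrArg Set.ncard h).trans (Set.ncard_image_of_injective _ Subtype.val_injective)

lemma map_induce {F : SimpleGraph V} {S : Set V} (h : Conn F S) :
    (F.induce S).map (Function.Embedding.subtype _) = F := by
  ext a b
  simp only [map_adj, comap_adj, Function.Embedding.subtype_apply]
  constructor
  · rintro ⟨x, y, h1, rfl, rfl⟩
    exact h1
  · intro h1
    exact ⟨⟨a, h.supp _ _ h1⟩, ⟨b, h.supp _ _ h1.symm⟩, h1, rfl, rfl⟩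

lemma supp_map {S : Set V} (T : SimpleGraph S) (a b : V)
    (h : (T.map (Function.Embedding.subtype _)).Adj a b) : a ∈ S := by
  simp only [map_adj, Function.Embedding.subtype_apply] at h
  obtain ⟨x, y, _, rfl, rfl⟩ := h
  exact x.2

lemma conn_map {S : Set V} (T : SimpleGraph S) (h : T.Connected) :
    Conn (T.map (Function.Embedding.subtype (· ∈ S))) S := by
  refine ⟨supp_map T, fun a ha b hb => ?_⟩
  exact (h.preconnected ⟨a, ha⟩ ⟨b, hb⟩).map (Embedding.map _ T).toHom

lemma Conn.induce {F : SimpleGraph V} {S : Set V} (h : Conn F S) (hS : S.Nonempty) :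
    (F.induce S).Connected := by
  have : Nonempty S := hS.to_subtype
  refine ⟨fun a b => ?_⟩
  obtain ⟨w⟩ := h.reach a a.2 b b.2
  have : ∀ (c d : V) (w : F.Walk c d) (hc : c ∈ S) (hd : d ∈ S),
      (F.induce S).Reachable ⟨c, hc⟩ ⟨d, hd⟩ := by
    intro c d w
    induction w with
    | nil => intro _ _; exact Reachable.refl _
    | cons h1 _ ih =>
      intro hc hd
      have h2 := h.supp _ _ h1.symm
      have h3 : (F.induce S).Adj ⟨_, hc⟩ ⟨_, h2⟩ := h1
      exact h3.reachable.trans (ih h2 hd)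
  exact this _ _ w a.2 b.2

open Classical in
lemma sum_deg [Fintype V] (T : SimpleGraph V) : ∑ v, deg T v = 2 * Nat.card T.edgeSet := by
  have := T.sum_degrees_eq_twice_card_edges
  rw [Nat.card_eq_fintype_card, ← edgeFinset_card, ← this]
  apply Finset.sum_congr rfl
  intro v _
  unfold deg
  rw [← T.card_neighborSet_eq_degree, Set.ncard_eq_toFinset_card', Set.toFinset_card]

open Classical in
lemma sum_supp [Fintype V] (S : Set V) (f : V → ℕ) (hf : ∀ v, v ∉ S → f v = 0) :
    ∑ v, f v = ∑ v : S, f v := by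
  rw [← Finset.sum_subset (Finset.subset_univ S.toFinset) (by
    intro v _ hv; exact hf v (by simpa using hv))]
  rw [← Finset.sum_coe_sort]
  apply Fintype.sum_equiv (Equiv.subtypeEquivRight (by simp))
  intro x; rfl

open Classical in
lemma dsum_eq [Fintype V] {F : SimpleGraph V} {S : Set V} (h : Conn F S) :
    dsum F = 2 * Nat.card (F.induce S).edgeSet := by
  rw [← sum_deg, dsum, sum_supp S _ (fun v hv => deg_zero h hv)]
  apply Finset.sum_congr rfl
  intro v _
  rw [← deg_map, map_induce h]

lemma dsum_ge [Fintype V] {F : SimpleGraph V} {S : Set V} (h : Conn F S) (hS : S.Nonempty) :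
    2 * S.ncard ≤ dsum F + 2 := by
  have := (h.induce hS).card_vert_le_card_edgeSet_add_one
  rw [dsum_eq h]
  rw [Nat.card_coe_set_eq] at this
  omega

lemma isTree_of [Fintype V] {F : SimpleGraph V} {S : Set V} (h : Conn F S) (hS : S.Nonempty)
    (hd : dsum F + 2 = 2 * S.ncard) : (F.induce S).IsTree := by
  rw [isTree_iff_connected_and_card]
  refine ⟨h.induce hS, ?_⟩
  rw [dsum_eq h] at hd
  rw [Nat.card_coe_set_eq S]
  omega

lemma exists_tree [Fintype V] {F : SimpleGraph V} {S : Set V} (h : Conn F S) (hS : S.Nonempty) :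
    ∃ F' ≤ F, Conn F' S ∧ dsum F' + 2 = 2 * S.ncard := by
  obtain ⟨T, hT, hT2⟩ := (h.induce hS).exists_isTree_le
  refine ⟨T.map (Function.Embedding.subtype (· ∈ S)), ?_, conn_map T hT2.connected, ?_⟩
  · conv_rhs => rw [← map_induce h]
    exact map_monotone _ hT
  · rw [dsum_eq (conn_map T hT2.connected)]
    have h2 : (T.map (Function.Embedding.subtype (· ∈ S))).induce S = T := induce_spanningCoe
    rw [h2]
    have := (isTree_iff_connected_and_card.1 hT2).2
    rw [Nat.card_coe_set_eq S] at this
    omega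


structure Ctx [Fintype V] (G : SimpleGraph V) (k : ℕ) (F : SimpleGraph V) (S : Set V)
    (p : ℕ → V) (m : ℕ) (u v : V) : Prop where
  le : F ≤ G
  conn : Conn F S
  hex : exc F + 2 ≤ k
  tree : dsum F + 2 = 2 * S.ncard
  path : PathIn F p m
  maxS : ∀ F' S', F' ≤ G → Conn F' S' → exc F' + 2 ≤ k → S'.ncard ≤ S.ncard
  maxP : ∀ F' q m', F' ≤ G → Conn F' S → exc F' + 2 ≤ k → dsum F' + 2 = 2 * S.ncard →
    PathIn F' q m' → m' ≤ m
  hu : u ∉ S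
  hv : v ∉ S
  huv : G.Adj u v
  hA : ∃ a ∈ S, G.Adj a u

section
variable [Fintype V] {G F : SimpleGraph V} {k : ℕ} {S : Set V} {p : ℕ → V} {m : ℕ} {u v : V}

lemma PathIn.rev (h : PathIn F p m) : PathIn F (fun i => p (m - i)) m := by
  refine ⟨fun i j hi hj hij => ?_, fun i hi => ?_⟩
  · have := h.1 _ _ (by omega) (by omega) hij
    omega
  · have := (h.2 (m - (i+1)) (by omega)).symm
    rwa [show m - (i+1) + 1 = m - i by omega] at this

lemma Ctx.rev (h : Ctx G k F S p m u v) : Ctx G k F S (fun i => p (m - i)) m u v :=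
  { h with path := h.path.rev }

lemma Ctx.kill (h : Ctx G k F S p m u v) {F' : SimpleGraph V} {S' : Set V} (hS : S' ⊆ S)
    (hc : S.ncard ≤ S'.ncard + 1) (hle : F' ≤ G) (hconn : Conn F' S') (hex : exc F' + 2 ≤ k)
    {a : V} (ha : a ∈ S') (hau : G.Adj a u) (hor : exc F' + 3 ≤ k ∨ deg F' a ≤ 1) : False := by
  have hu' : u ∉ S' := fun h' => h.hu (hS h')
  have hv' : v ∉ insert u S' := by
    rintro (h' | h')
    · exact h.huv.ne h'.symm
    · exact h.hv (hS h')
  have c1 := hconn.addE_in ha hu'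
  have c2 := c1.addE_in (Set.mem_insert u S') hv'
  have l2 := addE_le (addE_le hle hau) h.huv
  have e1 := exc_addE F' a u (by rw [deg_zero hconn hu']; omega)
  have d1 := deg_addE F' a u u
  rw [deg_zero hconn hu'] at d1
  have hne : u ≠ a := hau.ne'
  simp only [if_neg hne, if_true] at d1
  have e2 := exc_addE (addE F' a u) u v (by rw [deg_zero c1 hv']; omega)
  rw [if_pos (by omega)] at e2
  have := h.maxS _ _ l2 c2 (by
    rcases hor with h1 | h1
    · split_ifs at e1 <;> omega
    · rw [if_pos h1] at e1; omega)
  rw [Set.ncard_insert_of_notMem hv', Set.ncard_insert_of_notMem hu'] at this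
  omega

lemma Ctx.exc_eq (h : Ctx G k F S p m u v) : exc F + 2 = k := by
  by_contra hne
  have := h.hex
  obtain ⟨a, ha, hau⟩ := h.hA
  exact h.kill subset_rfl (by omega) h.le h.conn h.hex ha hau (Or.inl (by omega))

lemma Ctx.leaf_out (h : Ctx G k F S p m u v) {a w : V} (ha : a ∈ S) (hd : deg F a ≤ 1)
    (haw : G.Adj a w) : w ∈ S := by
  by_contra hw
  have e1 := exc_addE F a w (by rw [deg_zero h.conn hw]; omega)
  rw [if_pos hd] at e1
  have := h.maxS _ _ (addE_le h.le haw) (h.conn.addE_in ha hw) (by have := h.hex; omega)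
  rw [Set.ncard_insert_of_notMem hw] at this
  omega

def Hub (G F : SimpleGraph V) (u h : V) : Prop := G.Adj h u ∨ 3 ≤ deg F h

lemma Ctx.killHub (h : Ctx G k F S p m u v) {F' : SimpleGraph V} {S' : Set V} (hS : S' ⊆ S)
    (hc : S.ncard ≤ S'.ncard + 1) (hle : F' ≤ G) (hconn : Conn F' S')
    (hdeg : ∀ w, deg F' w ≤ max (deg F w) 2) (ha : ∃ a ∈ S', G.Adj a u) {b : V}
    (hb : b ∈ S') (hh : Hub G F u b) (hlt : deg F' b < deg F b) : False := by
  have e1 := exc_le hdeg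
  have := h.hex
  by_cases h3 : 3 ≤ deg F b
  · have e2 := exc_lt hdeg b h3 hlt
    obtain ⟨a, ha, hau⟩ := ha
    exact h.kill hS hc hle hconn (by omega) ha hau (Or.inl (by omega))
  · have hbu : G.Adj b u := hh.resolve_right h3
    exact h.kill hS hc hle hconn (by omega) hb hbu (Or.inr (by omega))

lemma deg_pos_of_adj {a b : V} (h : F.Adj a b) : 1 ≤ deg F a := by
  unfold deg
  rw [Nat.one_le_iff_ne_zero, ← Nat.pos_iff_ne_zero, Set.ncard_pos]
  exact ⟨b, h⟩

lemma deg_le_one_of {a b : V} (h : ∀ c, F.Adj a c → c = b) : deg F a ≤ 1 := by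
  unfold deg
  have : F.neighborSet a ⊆ {b} := fun c hc => h c hc
  simpa using Set.ncard_le_ncard this

lemma deg_ge_three {a b c d : V} (h1 : F.Adj a b) (h2 : F.Adj a c) (h3 : F.Adj a d)
    (hbc : b ≠ c) (hbd : b ≠ d) (hcd : c ≠ d) : 3 ≤ deg F a := by
  unfold deg
  have h : ({b, c, d} : Set V).ncard = 3 := by
    rw [Set.ncard_eq_three]; exact ⟨b, c, d, hbc, hbd, hcd, rfl⟩
  rw [← h]
  apply Set.ncard_le_ncard _ (Set.toFinite _)
  rintro x (rfl | rfl | rfl) <;> assumption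

lemma Ctx.m_pos (h : Ctx G k F S p m u v) : 0 < m := by
  by_contra hm
  obtain ⟨a, ha, hau⟩ := h.hA
  have : deg F a ≤ 1 := by
    apply deg_le_one_of (b := a)
    intro c hc
    exfalso
    have := h.maxP F (fun i => if i = 0 then a else c) 1 h.le h.conn h.hex h.tree (by
      refine ⟨fun i j hi hj hij => ?_, fun i hi => ?_⟩
      · have := hc.ne
        have := hc.ne'
        simp only at hij
        split_ifs at hij <;> first | omega | contradiction
      · obtain rfl : i = 0 := by omega
        simpa using hc)
    omega
  exact h.kill subset_rfl (by omega) h.le h.conn h.hex ha hau (Or.inr this)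

lemma Ctx.mem (h : Ctx G k F S p m u v) {i : ℕ} (hi : i ≤ m) : p i ∈ S := by
  have := h.m_pos
  by_cases hi' : i < m
  · exact h.conn.supp _ _ (h.path.2 i hi')
  · obtain rfl : i = m := by omega
    have := h.path.2 (i-1) (by omega)
    rw [show i - 1 + 1 = i by omega] at this
    exact h.conn.supp _ _ this.symm

lemma PathIn.cons (hp : PathIn F p m) {w : V} (hw : F.Adj w (p 0)) (hoff : ∀ i ≤ m, p i ≠ w) :
    PathIn F (fun i => if i = 0 then w else p (i-1)) (m+1) := by
  refine ⟨fun i j hi hj hij => ?_, fun i hi => ?_⟩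
  · simp only at hij
    split_ifs at hij with h1 h2 h2
    · omega
    · exact absurd hij.symm (hoff _ (by omega))
    · exact absurd hij (hoff _ (by omega))
    · have := hp.1 _ _ (by omega) (by omega) hij
      omega
  · by_cases h0 : i = 0
    · subst h0; simpa using hw
    · have := hp.2 (i-1) (by omega)
      simp only [if_neg h0, Nat.succ_ne_zero, if_false, Nat.add_sub_cancel]
      rwa [show i - 1 + 1 = i by omega] at this

lemma seg {F' : SimpleGraph V} {p : ℕ → V} {i j : ℕ} (hij : i ≤ j)
    (h : ∀ t, i ≤ t → t < j → F'.Adj (p t) (p (t+1))) : F'.Reachable (p i) (p j) := by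
  induction j, hij using Nat.le_induction with
  | base => exact Reachable.refl _
  | succ n hn ih =>
    exact (ih (fun t h1 h2 => h t h1 (by omega))).trans (h n hn (by omega)).reachable

/-- the end of the path has no tree-neighbours off the path -/
lemma Ctx.end_off (h : Ctx G k F S p m u v) {w : V} (hw : F.Adj (p 0) w)
    (hoff : ∀ i ≤ m, p i ≠ w) : False := by
  have := h.maxP F _ _ h.le h.conn h.hex h.tree (h.path.cons hw.symm hoff)
  omega

lemma Conn.delE {F : SimpleGraph V} {S : Set V} (h : Conn F S) {a b : V}
    (hr : (delE F a b).Reachable a b) : Conn (delE F a b) S := by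
  apply h.of id (fun a ha => ⟨ha, rfl⟩)
  · intro c d hcd
    rw [delE_adj] at hcd
    exact h.supp _ _ hcd.1
  · intro c d hcd
    by_cases h1 : c = a ∧ d = b ∨ c = b ∧ d = a
    · rcases h1 with ⟨rfl, rfl⟩ | ⟨rfl, rfl⟩
      · exact hr
      · exact hr.symm
    · exact (delE_adj.2 ⟨hcd, h1⟩ : (DKT.delE F a b).Adj c d).reachable

lemma dsum_delE {a b : V} (hab : F.Adj a b) : dsum (delE F a b) + 2 ≤ dsum F := by
  classical
  have : ∑ w, (deg (delE F a b) w + (if w = a then 1 else 0) + (if w = b then 1 else 0)) ≤ dsum F :=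
    Finset.sum_le_sum (fun w _ => deg_delE F a b w hab)
  rw [Finset.sum_add_distrib, Finset.sum_add_distrib] at this
  simp only [Finset.sum_ite_eq', Finset.mem_univ, if_true] at this
  unfold dsum at *
  omega

lemma dsum_addE (a b : V) : dsum (addE F a b) ≤ dsum F + 2 := by
  classical
  have : dsum (addE F a b) ≤ ∑ w, (deg F w + (if w = a then 1 else 0) + (if w = b then 1 else 0)) :=
    Finset.sum_le_sum (fun w _ => deg_addE F a b w)
  rw [Finset.sum_add_distrib, Finset.sum_add_distrib] at this
  simp only [Finset.sum_ite_eq', Finset.mem_univ, if_true] at this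
  unfold dsum at *
  omega

lemma Ctx.deg_end (h : Ctx G k F S p m u v) : deg F (p 0) ≤ 1 := by
  apply deg_le_one_of (b := p 1)
  intro c hc
  by_contra hne
  have hm := h.m_pos
  by_cases hoff : ∀ i ≤ m, p i ≠ c
  · exact h.end_off hc hoff
  push Not at hoff
  obtain ⟨i, hi, rfl⟩ := hoff
  have hi0 : i ≠ 0 := by rintro rfl; exact hc.ne rfl
  have hi1 : i ≠ 1 := by rintro rfl; exact hne rfl
  have hr : (delE F (p 0) (p i)).Reachable (p 0) (p i) := by
    apply seg (by omega)
    intro t h1 h2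
    rw [delE_adj]
    refine ⟨h.path.2 t (by omega), ?_⟩
    rintro (⟨e1, e2⟩ | ⟨e1, e2⟩)
    · have := h.path.1 _ _ (by omega) (by omega) e1
      have := h.path.1 _ _ (by omega) (by omega) e2
      omega
    · have := h.path.1 _ _ (by omega) (by omega) e2
      omega
  have c1 := h.conn.delE hr
  have := dsum_ge c1 ⟨_, h.mem (Nat.zero_le _)⟩
  have := dsum_delE hc
  have := h.tree
  omega

lemma Ctx.deg_end' (h : Ctx G k F S p m u v) : deg F (p m) ≤ 1 := by
  simpa using h.rev.deg_end

/-- N(x) is contained in the path -/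
lemma Ctx.nbr_on (h : Ctx G k F S p m u v) {w : V} (hw : G.Adj (p 0) w) : ∃ i ≤ m, p i = w := by
  classical
  by_contra hoff
  push Not at hoff
  have hwS : w ∈ S := h.leaf_out (h.mem (Nat.zero_le _)) h.deg_end hw
  obtain ⟨q⟩ := h.conn.reach w hwS (p 0) (h.mem (Nat.zero_le _))
  obtain ⟨q, hq⟩ : ∃ q : F.Walk w (p 0), q.IsPath := ⟨q.bypass, q.bypass_isPath⟩
  cases q with
  | nil => exact hoff 0 (Nat.zero_le _) rfl
  | @cons _ c _ hwc q' =>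
    have hq' := hq
    rw [Walk.cons_isPath_iff] at hq'
    have hr : (delE F w c).Reachable c (p 0) := by
      refine ⟨q'.transfer _ ?_⟩
      intro e he
      induction e with
      | h a b =>
        rw [mem_edgeSet, delE_adj]
        refine ⟨q'.adj_of_mem_edges he, ?_⟩
        rintro (⟨rfl, rfl⟩ | ⟨rfl, rfl⟩)
        · exact hq'.2 (q'.fst_mem_support_of_mem_edges he)
        · exact hq'.2 (q'.snd_mem_support_of_mem_edges he)
    have hF' : delE F w c ≤ addE (delE F w c) (p 0) w := le_sup_left
    have hadd := addE_self (F := delE F w c) hw.ne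
    have hpath : PathIn (addE (delE F w c) (p 0) w) p m := by
      refine ⟨h.path.1, fun i hi => hF' ?_⟩
      rw [delE_adj]
      refine ⟨h.path.2 i hi, ?_⟩
      rintro (⟨e1, _⟩ | ⟨_, e1⟩)
      · exact hoff _ (by omega) e1
      · exact hoff _ (by omega) e1
    have hconn : Conn (addE (delE F w c) (p 0) w) S := by
      apply h.conn.of id (fun a ha => ⟨ha, rfl⟩)
      · intro a b hab
        rw [addE_adj, delE_adj] at hab
        rcases hab with h1 | ⟨⟨rfl, rfl⟩ | ⟨rfl, rfl⟩, _⟩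
        · exact h.conn.supp _ _ h1.1
        · exact h.mem (Nat.zero_le _)
        · exact hwS
      · have key : (addE (delE F w c) (p 0) w).Reachable w c :=
          hadd.symm.reachable.trans (hr.symm.mono hF')
        intro a b hab
        by_cases h1 : a = w ∧ b = c ∨ a = c ∧ b = w
        · rcases h1 with ⟨rfl, rfl⟩ | ⟨rfl, rfl⟩
          · exact key
          · exact key.symm
        · exact (hF' (delE_adj.2 ⟨hab, h1⟩)).reachable
    have hdeg : ∀ x, deg (addE (delE F w c) (p 0) w) x ≤ max (deg F x) 2 := by
      intro x
      have h1 := deg_addE (delE F w c) (p 0) w x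
      have h2 := deg_delE F w c x hwc
      have h3 := h.deg_end
      by_cases hx : x = p 0
      · subst hx
        rw [if_neg hw.ne] at h1
        simp only [if_true] at h1
        omega
      · rw [if_neg hx] at h1
        omega
    have hle := addE_le (delE_le (a := w) (b := c) h.le) hw
    have e1 := exc_le hdeg
    have hex := h.hex
    have ht := h.tree
    have d1 := dsum_delE hwc
    have d2 := dsum_addE (F := delE F w c) (p 0) w
    have d3 := dsum_ge hconn ⟨w, hwS⟩
    have := h.maxP _ _ _ hle hconn (by omega) (by omega) (hpath.cons hadd.symm hoff)
    omega

/-- existence of a hub -/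
lemma Ctx.exists_hub (h : Ctx G k F S p m u v) : ∃ j, 0 < j ∧ j < m ∧ Hub G F u (p j) := by
  obtain ⟨a, ha, hau⟩ := h.hA
  have hm := h.m_pos
  by_cases hP : ∃ i ≤ m, p i = a
  · obtain ⟨i, hi, rfl⟩ := hP
    refine ⟨i, ?_, ?_, Or.inl hau⟩
    · by_contra h0
      obtain rfl : i = 0 := by omega
      exact h.hu (h.leaf_out ha h.deg_end hau)
    · by_contra h0
      obtain rfl : i = m := by omega
      exact h.hu (h.leaf_out ha h.deg_end' hau)
  · have key : ∀ (c d : V) (w : F.Walk c d), (∃ i ≤ m, p i = c) → ¬ (∃ i ≤ m, p i = d) →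
        ∃ j ≤ m, ∃ b, F.Adj (p j) b ∧ ¬ (∃ i ≤ m, p i = b) := by
      intro c d w
      induction w with
      | nil => intro h1 h2; exact absurd h1 h2
      | @cons c b d hcb w ih =>
        intro h1 h2
        by_cases h3 : ∃ i ≤ m, p i = b
        · exact ih h3 h2
        · obtain ⟨j, hj, rfl⟩ := h1
          exact ⟨j, hj, b, hcb, h3⟩
    obtain ⟨w⟩ := h.conn.reach (p 0) (h.mem (Nat.zero_le _)) a ha
    obtain ⟨j, hj, b, hb, hoff⟩ := key _ _ w ⟨0, Nat.zero_le _, rfl⟩ hP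
    push Not at hoff
    have h0 : 0 < j := by
      by_contra h0
      obtain rfl : j = 0 := by omega
      exact h.end_off hb hoff
    have h1 : j < m := by
      by_contra h0
      obtain rfl : j = m := by omega
      exact h.rev.end_off (by simpa using hb) (fun i hi => hoff _ (by omega))
    refine ⟨j, h0, h1, Or.inr ?_⟩
    have a1 := h.path.2 (j-1) (by omega)
    rw [show j - 1 + 1 = j by omega] at a1
    refine deg_ge_three a1.symm (h.path.2 j h1) hb ?_ (hoff _ (by omega)) (hoff _ (by omega))
    intro e
    have := h.path.1 _ _ (by omega) (by omega) e
    omega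


lemma delE_path {F F' : SimpleGraph V} (hp : PathIn F p m) {i t : ℕ} (hi : i < m) (ht : t < m)
    (hne : t ≠ i) (h : F'.Adj (p t) (p (t+1))) :
    (delE F' (p i) (p (i+1))).Adj (p t) (p (t+1)) := by
  rw [delE_adj]
  refine ⟨h, ?_⟩
  rintro (⟨e1, _⟩ | ⟨e1, e2⟩)
  · have := hp.1 _ _ (by omega) (by omega) e1
    omega
  · have := hp.1 _ _ (by omega) (by omega) e1
    have := hp.1 _ _ (by omega) (by omega) e2
    omega

lemma le_addE {F : SimpleGraph V} (a b : V) : F ≤ addE F a b := le_sup_left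

lemma Ctx.end_deg (h : Ctx G k F S p m u v) {t : ℕ} (ht : t = 0 ∨ t = m) : deg F (p t) ≤ 1 := by
  rcases ht with rfl | rfl
  · exact h.deg_end
  · exact h.deg_end'

lemma Ctx.inj (h : Ctx G k F S p m u v) {i j : ℕ} (hi : i ≤ m) (hj : j ≤ m) :
    (p i = p j) = (i = j) :=
  propext ⟨h.path.1 _ _ hi hj, fun e => e ▸ rfl⟩

lemma Ctx.supp_add {F' : SimpleGraph V} {S : Set V} {a b : V} (h : ∀ c d, F'.Adj c d → c ∈ S)
    (ha : a ∈ S) (hb : b ∈ S) : ∀ c d, (addE F' a b).Adj c d → c ∈ S := by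
  intro c d hcd
  rw [addE_adj] at hcd
  rcases hcd with h1 | ⟨⟨rfl, rfl⟩ | ⟨rfl, rfl⟩, _⟩
  · exact h _ _ h1
  · exact ha
  · exact hb

lemma Ctx.supp_del {F' : SimpleGraph V} {S : Set V} {a b : V} (h : ∀ c d, F'.Adj c d → c ∈ S) :
    ∀ c d, (DKT.delE F' a b).Adj c d → c ∈ S := by
  intro c d hcd
  rw [delE_adj] at hcd
  exact h _ _ hcd.1

lemma reach_del {F F' : SimpleGraph V} {a b : V} (hr : F'.Reachable a b)
    (h : ∀ c d, (delE F a b).Adj c d → F'.Reachable c d) (c d : V) (hcd : F.Adj c d) :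
    F'.Reachable c d := by
  by_cases h1 : c = a ∧ d = b ∨ c = b ∧ d = a
  · rcases h1 with ⟨rfl, rfl⟩ | ⟨rfl, rfl⟩
    · exact hr
    · exact hr.symm
  · exact h _ _ (delE_adj.2 ⟨hcd, h1⟩)

/-- the ends of the path are not adjacent -/
lemma Ctx.ends (h : Ctx G k F S p m u v) : ¬ G.Adj (p 0) (p m) := by
  classical
  intro hxy
  obtain ⟨j, hj0, hjm, hub⟩ := h.exists_hub
  obtain ⟨i, rfl⟩ : ∃ i, j = i + 1 := ⟨j - 1, by omega⟩
  set D := delE F (p i) (p (i+1)) with hD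
  set F' := addE D (p 0) (p m) with hF'
  have hpe : ∀ t, t < m → t ≠ i → F'.Adj (p t) (p (t+1)) := fun t ht hne =>
    le_addE _ _ (delE_path h.path (by omega) ht hne (h.path.2 t ht))
  have hadd : F'.Adj (p 0) (p m) := addE_self hxy.ne
  have r1 : F'.Reachable (p 0) (p i) := seg (by omega) (fun t _ _ => hpe t (by omega) (by omega))
  have r2 : F'.Reachable (p (i+1)) (p m) :=
    seg (by omega) (fun t _ _ => hpe t (by omega) (by omega))
  have hconn : Conn F' S := by
    apply h.conn.of id (fun a ha => ⟨ha, rfl⟩)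
    · exact Ctx.supp_add (Ctx.supp_del h.conn.supp) (h.mem (by omega)) (h.mem (by omega))
    · apply reach_del (r1.symm.trans (hadd.reachable.trans r2.symm))
      intro c d hcd
      exact (le_addE _ _ hcd).reachable
  have hdeg : ∀ w, deg F' w ≤ max (deg F w) 2 ∧ (w = p (i+1) → deg F' w < deg F w) := by
    intro w
    have h1 := deg_addE D (p 0) (p m) w
    have h2 := deg_delE F _ _ w (h.path.2 i (by omega))
    by_cases hw : ∃ t ≤ m, w = p t
    · obtain ⟨t, ht, rfl⟩ := hw
      have h3 := fun e => h.end_deg (t := t) e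
      simp only [h.inj ht (show 0 ≤ m by omega), h.inj ht (show m ≤ m by omega),
        h.inj ht (show i ≤ m by omega), h.inj ht (show i + 1 ≤ m by omega)] at h1 h2 ⊢
      grind
    · push Not at hw
      simp only [if_neg (hw 0 (by omega)), if_neg (hw m (by omega))] at h1
      exact ⟨by grind, fun e => absurd e (hw _ (by omega))⟩
  exact h.killHub subset_rfl (by omega) (addE_le (delE_le h.le) hxy) hconn
    (fun w => (hdeg w).1) h.hA (h.mem (by omega)) hub ((hdeg _).2 rfl)

/-- successor of a hub is not adjacent to x -/
lemma Ctx.hub_succ (h : Ctx G k F S p m u v) {i : ℕ} (hi : 0 < i) (him : i < m)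
    (hub : Hub G F u (p i)) : ¬ G.Adj (p 0) (p (i+1)) := by
  classical
  intro hxy
  set D := delE F (p i) (p (i+1)) with hD
  set F' := addE D (p 0) (p (i+1)) with hF'
  have hpe : ∀ t, t < m → t ≠ i → F'.Adj (p t) (p (t+1)) := fun t ht hne =>
    le_addE _ _ (delE_path h.path (by omega) ht hne (h.path.2 t ht))
  have hadd : F'.Adj (p 0) (p (i+1)) := addE_self hxy.ne
  have r1 : F'.Reachable (p 0) (p i) := seg (by omega) (fun t _ _ => hpe t (by omega) (by omega))
  have hconn : Conn F' S := by
    apply h.conn.of id (fun a ha => ⟨ha, rfl⟩)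
    · exact Ctx.supp_add (Ctx.supp_del h.conn.supp) (h.mem (by omega)) (h.mem (by omega))
    · apply reach_del (r1.symm.trans hadd.reachable)
      intro c d hcd
      exact (le_addE _ _ hcd).reachable
  have hdeg : ∀ w, deg F' w ≤ max (deg F w) 2 ∧ (w = p i → deg F' w < deg F w) := by
    intro w
    have h1 := deg_addE D (p 0) (p (i+1)) w
    have h2 := deg_delE F _ _ w (h.path.2 i (by omega))
    by_cases hw : ∃ t ≤ m, w = p t
    · obtain ⟨t, ht, rfl⟩ := hw
      have h3 := fun e => h.end_deg (t := t) e
      simp only [h.inj ht (show 0 ≤ m by omega), 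
        h.inj ht (show i ≤ m by omega), h.inj ht (show i + 1 ≤ m by omega)] at h1 h2 ⊢
      grind
    · push Not at hw
      simp only [if_neg (hw 0 (by omega)), if_neg (hw (i+1) (by omega))] at h1
      exact ⟨by grind, fun e => absurd e (hw _ (by omega))⟩
  exact h.killHub subset_rfl (by omega) (addE_le (delE_le h.le) hxy) hconn
    (fun w => (hdeg w).1) h.hA (h.mem (by omega)) hub ((hdeg _).2 rfl)

lemma Ctx.hub_pred (h : Ctx G k F S p m u v) {i : ℕ} (him : i + 1 < m)
    (hub : Hub G F u (p (i+1))) : ¬ G.Adj (p m) (p i) := by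
  have := h.rev.hub_succ (i := m - (i+1)) (by omega) (by omega)
    (by simpa [show m - (m - (i+1)) = i + 1 by omega] using hub)
  simpa [show m - (m - (i+1) + 1) = i by omega] using this

/-- no crossing, hub to the left -/
lemma Ctx.cross_left (h : Ctx G k F S p m u v) {i j : ℕ} (hji : j + 1 ≤ i) (him : i + 1 < m)
    (hub : Hub G F u (p (j+1))) (hy : G.Adj (p m) (p i)) (hx : G.Adj (p 0) (p (i+1))) : False := by
  classical
  set D1 := delE F (p j) (p (j+1)) with hD1
  set D := delE D1 (p i) (p (i+1)) with hD
  set E := addE D (p 0) (p (i+1)) with hE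
  set F' := addE E (p m) (p i) with hF'
  have hDF : D ≤ F' := (le_addE _ _).trans (le_addE _ _)
  have hpe : ∀ t, t < m → t ≠ i → t ≠ j → F'.Adj (p t) (p (t+1)) := fun t ht hne hne' =>
    hDF (delE_path h.path (by omega) ht hne (delE_path h.path (by omega) ht hne' (h.path.2 t ht)))
  have hadd1 : F'.Adj (p 0) (p (i+1)) := le_addE _ _ (addE_self hx.ne)
  have hadd2 : F'.Adj (p m) (p i) := addE_self hy.ne
  have r1 : F'.Reachable (p 0) (p j) :=
    seg (by omega) (fun t _ _ => hpe t (by omega) (by omega) (by omega))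
  have r2 : F'.Reachable (p (j+1)) (p i) :=
    seg (by omega) (fun t _ _ => hpe t (by omega) (by omega) (by omega))
  have r3 : F'.Reachable (p (i+1)) (p m) :=
    seg (by omega) (fun t _ _ => hpe t (by omega) (by omega) (by omega))
  have q1 : F'.Reachable (p i) (p (i+1)) := hadd2.symm.reachable.trans r3.symm
  have q2 : F'.Reachable (p j) (p (j+1)) :=
    r1.symm.trans (hadd1.reachable.trans (q1.symm.trans r2.symm))
  have hconn : Conn F' S := by
    apply h.conn.of id (fun a ha => ⟨ha, rfl⟩)
    · exact Ctx.supp_add (Ctx.supp_add (Ctx.supp_del (Ctx.supp_del h.conn.supp))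
        (h.mem (by omega)) (h.mem (by omega))) (h.mem (by omega)) (h.mem (by omega))
    · apply reach_del q2
      apply reach_del q1
      intro c d hcd
      exact (hDF hcd).reachable
  have hdeg : ∀ w, deg F' w ≤ max (deg F w) 2 ∧ (w = p (j+1) → deg F' w < deg F w) := by
    intro w
    have h0 := deg_addE E (p m) (p i) w
    have h1 := deg_addE D (p 0) (p (i+1)) w
    have h2 := deg_delE F _ _ w (h.path.2 j (by omega))
    have h2' := deg_delE D1 _ _ w
      (delE_path h.path (by omega) (by omega) (by omega) (h.path.2 i (by omega)))
    by_cases hw : ∃ t ≤ m, w = p t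
    · obtain ⟨t, ht, rfl⟩ := hw
      have h3 := fun e => h.end_deg (t := t) e
      simp only [h.inj ht (show 0 ≤ m by omega), h.inj ht (show m ≤ m by omega),
        h.inj ht (show j ≤ m by omega), h.inj ht (show j + 1 ≤ m by omega),
        h.inj ht (show i ≤ m by omega), h.inj ht (show i + 1 ≤ m by omega)] at h0 h1 h2 h2' ⊢
      grind
    · push Not at hw
      simp only [if_neg (hw 0 (by omega)), if_neg (hw (i+1) (by omega)),
        if_neg (hw m (by omega)), if_neg (hw i (by omega))] at h0 h1
      exact ⟨by grind, fun e => absurd e (hw _ (by omega))⟩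
  exact h.killHub subset_rfl (by omega) (addE_le (addE_le (delE_le (delE_le h.le)) hx) hy) hconn
    (fun w => (hdeg w).1) h.hA (h.mem (by omega)) hub ((hdeg _).2 rfl)

lemma Ctx.cross (h : Ctx G k F S p m u v) {i : ℕ} (him : i < m)
    (hy : G.Adj (p m) (p i)) (hx : G.Adj (p 0) (p (i+1))) : False := by
  have hi0 : 0 < i := by
    by_contra h0
    obtain rfl : i = 0 := by omega
    exact h.ends hy.symm
  have him' : i + 1 < m := by
    by_contra h0
    obtain rfl : i + 1 = m := by omega
    exact h.ends hx
  obtain ⟨j, hj0, hjm, hub⟩ := h.exists_hub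
  by_cases hji : j ≤ i
  · obtain ⟨j, rfl⟩ : ∃ i, j = i + 1 := ⟨j - 1, by omega⟩
    exact h.cross_left hji him' hub hy hx
  · refine h.rev.cross_left (i := m - (i+1)) (j := m - j - 1) (by omega) (by omega) ?_ ?_ ?_
    · simpa [show m - (m - j - 1 + 1) = j by omega] using hub
    · simpa [show m - (m - (i+1)) = i + 1 by omega] using hx
    · simpa [show m - (m - (i+1) + 1) = i by omega] using hy

/-- no gap-two crossing, hub to the left -/
lemma Ctx.gap_left (h : Ctx G k F S p m u v) {i j : ℕ} (hji : j + 1 ≤ i) (him : i + 2 < m)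
    (hub : Hub G F u (p (j+1))) (hnot : ¬ Hub G F u (p (i+1)))
    (hy : G.Adj (p m) (p i)) (hx : G.Adj (p 0) (p (i+2))) : False := by
  classical
  set D1 := delE F (p j) (p (j+1)) with hD1
  set D2 := delE D1 (p i) (p (i+1)) with hD2
  set D := delE D2 (p (i+1)) (p (i+1+1)) with hD
  set E := addE D (p 0) (p (i+2)) with hE
  set F' := addE E (p m) (p i) with hF'
  have hDF : D ≤ F' := (le_addE _ _).trans (le_addE _ _)
  have hpe : ∀ t, t < m → t ≠ i → t ≠ i + 1 → t ≠ j → F'.Adj (p t) (p (t+1)) :=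
    fun t ht hne hne1 hne' =>
    hDF (delE_path h.path (by omega) ht hne1 (delE_path h.path (by omega) ht hne
      (delE_path h.path (by omega) ht hne' (h.path.2 t ht))))
  have hadd1 : F'.Adj (p 0) (p (i+2)) := le_addE _ _ (addE_self hx.ne)
  have hadd2 : F'.Adj (p m) (p i) := addE_self hy.ne
  have r1 : F'.Reachable (p 0) (p j) :=
    seg (by omega) (fun t _ _ => hpe t (by omega) (by omega) (by omega) (by omega))
  have r2 : F'.Reachable (p (j+1)) (p i) :=
    seg (by omega) (fun t _ _ => hpe t (by omega) (by omega) (by omega) (by omega))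
  have r3 : F'.Reachable (p (i+2)) (p m) :=
    seg (by omega) (fun t _ _ => hpe t (by omega) (by omega) (by omega) (by omega))
  have q1 : F'.Reachable (p i) (p (i+2)) := hadd2.symm.reachable.trans r3.symm
  have q2 : F'.Reachable (p j) (p (j+1)) :=
    r1.symm.trans (hadd1.reachable.trans (q1.symm.trans r2.symm))
  -- the neighbours of the removed vertex
  have hnb : ∀ c, F.Adj (p (i+1)) c → c = p i ∨ c = p (i+2) := by
    intro c hc
    by_contra hcc
    push Not at hcc
    apply hnot
    right
    refine deg_ge_three hc (h.path.2 i (by omega)).symm (h.path.2 (i+1) (by omega)) hcc.1 hcc.2 ?_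
    intro e
    have := h.path.1 _ _ (by omega) (by omega) e
    omega
  have hDc : ∀ c d, D.Adj c d → c ≠ p (i+1) := by
    rintro c d hcd rfl
    rw [hD, hD2, hD1, delE_adj, delE_adj, delE_adj] at hcd
    have := hnb d hcd.1.1.1
    tauto
  have hS : ∀ {t}, t ≤ m → t ≠ i + 1 → p t ∈ S \ {p (i+1)} := by
    intro t ht hne
    refine ⟨h.mem ht, fun e => hne (h.path.1 _ _ ht (by omega) e)⟩
  have hconn : Conn F' (S \ {p (i+1)}) := by
    apply h.conn.of (fun a => if a = p (i+1) then p i else a)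
    · rintro a ⟨ha, ha'⟩
      exact ⟨ha, if_neg ha'⟩
    · refine Ctx.supp_add (Ctx.supp_add ?_ ?_ ?_) ?_ ?_
      · intro c d hcd
        exact ⟨Ctx.supp_del (Ctx.supp_del (Ctx.supp_del h.conn.supp)) _ _ hcd, hDc _ _ hcd⟩
      all_goals exact hS (by omega) (by omega)
    · intro a b hab
      have hmid : ∀ c, F.Adj (p (i+1)) c → F'.Reachable (p i) c := by
        intro c hc
        rcases hnb c hc with rfl | rfl
        · exact Reachable.refl _
        · exact q1
      by_cases ha : a = p (i+1)
      · subst ha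
        have hb : b ≠ p (i+1) := hab.ne'
        simp only [if_true, if_neg hb]
        exact hmid _ hab
      · by_cases hb : b = p (i+1)
        · subst hb
          simp only [if_true, if_neg ha]
          exact (hmid _ hab.symm).symm
        · simp only [if_neg ha, if_neg hb]
          by_cases h1 : a = p j ∧ b = p (j+1) ∨ a = p (j+1) ∧ b = p j
          · rcases h1 with ⟨rfl, rfl⟩ | ⟨rfl, rfl⟩
            · exact q2
            · exact q2.symm
          · apply Adj.reachable
            apply hDF
            rw [hD, hD2, hD1, delE_adj, delE_adj, delE_adj]
            tauto
  have hdeg : ∀ w, deg F' w ≤ max (deg F w) 2 ∧ (w = p (j+1) → deg F' w < deg F w) := by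
    intro w
    have h0 := deg_addE E (p m) (p i) w
    have h1 := deg_addE D (p 0) (p (i+2)) w
    have h2 := deg_delE F _ _ w (h.path.2 j (by omega))
    have h2' := deg_delE D1 _ _ w
      (delE_path h.path (by omega) (by omega) (by omega) (h.path.2 i (by omega)))
    have h2'' := deg_delE D2 _ _ w
      (delE_path h.path (by omega) (by omega) (by omega) 
        (delE_path h.path (by omega) (by omega) (by omega) (h.path.2 (i+1) (by omega))))
    by_cases hw : ∃ t ≤ m, w = p t
    · obtain ⟨t, ht, rfl⟩ := hw
      have h3 := fun e => h.end_deg (t := t) e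
      simp only [h.inj ht (show 0 ≤ m by omega), h.inj ht (show m ≤ m by omega),
        h.inj ht (show j ≤ m by omega), h.inj ht (show j + 1 ≤ m by omega),
        h.inj ht (show i ≤ m by omega), h.inj ht (show i + 1 ≤ m by omega),
        h.inj ht (show i + 2 ≤ m by omega)] at h0 h1 h2 h2' h2'' ⊢
      grind
    · push Not at hw
      simp only [if_neg (hw 0 (by omega)), if_neg (hw (i+2) (by omega)),
        if_neg (hw m (by omega)), if_neg (hw i (by omega))] at h0 h1
      exact ⟨by grind, fun e => absurd e (hw _ (by omega))⟩
  have hcard := Set.ncard_sdiff_singleton_add_one (h.mem (show i + 1 ≤ m by omega)) (Set.toFinite S)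
  refine h.killHub Set.sdiff_subset (by omega)
    (addE_le (addE_le (delE_le (delE_le (delE_le h.le))) hx) hy) hconn
    (fun w => (hdeg w).1) ?_ (hS (by omega) (by omega)) hub ((hdeg _).2 rfl)
  obtain ⟨a, ha, hau⟩ := h.hA
  refine ⟨a, ⟨ha, ?_⟩, hau⟩
  rintro rfl
  exact hnot (Or.inl hau)

lemma Ctx.gap (h : Ctx G k F S p m u v) {i : ℕ} (him : i + 1 < m)
    (hy : G.Adj (p m) (p i)) (hx : G.Adj (p 0) (p (i+2))) : False := by
  have hi0 : 0 < i := by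
    by_contra h0
    obtain rfl : i = 0 := by omega
    exact h.ends hy.symm
  have him' : i + 2 < m := by
    by_contra h0
    obtain rfl : i + 2 = m := by omega
    exact h.ends hx
  have hnot : ¬ Hub G F u (p (i+1)) := fun hub => h.hub_pred (by omega) hub hy
  obtain ⟨j, hj0, hjm, hub⟩ := h.exists_hub
  have hji1 : j ≠ i + 1 := by rintro rfl; exact hnot hub
  by_cases hji : j ≤ i
  · obtain ⟨j, rfl⟩ : ∃ i, j = i + 1 := ⟨j - 1, by omega⟩
    exact h.gap_left hji him' hub hnot hy hx
  · refine h.rev.gap_left (i := m - (i+2)) (j := m - j - 1) (by omega) (by omega) ?_ ?_ ?_ ?_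
    · simpa [show m - (m - j - 1 + 1) = j by omega] using hub
    · simpa [show m - (m - (i+2) + 1) = i + 1 by omega] using hnot
    · simpa [show m - (m - (i+2)) = i + 2 by omega] using hx
    · simpa [show m - (m - (i+2) + 2) = i by omega] using hy


lemma ncard_sum (B : Set V) [DecidablePred (· ∈ B)] : B.ncard = ∑ w, if w ∈ B then 1 else 0 := by
  rw [Finset.sum_boole, Set.ncard_eq_toFinset_card']
  simp

lemma leaves_le {F : SimpleGraph V} {S : Set V} (h : Conn F S) (ht : dsum F + 2 = 2 * S.ncard) :
    {w | deg F w = 1}.ncard ≤ exc F + 2 := by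
  classical
  have : ∑ w, ((if w ∈ {w | deg F w = 1} then 1 else 0) + deg F w) ≤
      ∑ w, (2 * (if w ∈ S then 1 else 0) + (deg F w - 2)) := by
    apply Finset.sum_le_sum
    intro w _
    by_cases hw : w ∈ S
    · simp only [hw, if_true, Set.mem_setOf_eq]
      split_ifs <;> omega
    · simp [hw, deg_zero h hw]
  rw [Finset.sum_add_distrib, Finset.sum_add_distrib, ← Finset.mul_sum, ← ncard_sum,
    ← ncard_sum] at this
  unfold dsum exc at *
  omega

lemma le_leaves {F : SimpleGraph V} {S : Set V} (h : Conn F S) (ht : dsum F + 2 = 2 * S.ncard)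
    (hpos : ∀ w ∈ S, 1 ≤ deg F w) : exc F + 2 ≤ {w | deg F w = 1}.ncard := by
  classical
  have : ∑ w, (2 * (if w ∈ S then 1 else 0) + (deg F w - 2)) ≤
      ∑ w, ((if w ∈ {w | deg F w = 1} then 1 else 0) + deg F w) := by
    apply Finset.sum_le_sum
    intro w _
    by_cases hw : w ∈ S
    · have := hpos w hw
      simp only [hw, if_true, Set.mem_setOf_eq]
      split_ifs <;> omega
    · simp [hw, deg_zero h hw]
  rw [Finset.sum_add_distrib, Finset.sum_add_distrib, ← Finset.mul_sum, ← ncard_sum,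
    ← ncard_sum] at this
  unfold dsum exc at *
  omega

lemma exists_nbr {F : SimpleGraph V} {S : Set V} (h : Conn F S) {a b : V} (ha : a ∈ S) (hb : b ∈ S)
    (hab : a ≠ b) : ∃ c, F.Adj a c := by
  obtain ⟨w⟩ := h.reach a ha b hb
  cases w with
  | nil => exact absurd rfl hab
  | cons h _ => exact ⟨_, h⟩

lemma closed_reach {F : SimpleGraph V} {B : Set V} (hB : ∀ a ∈ B, ∀ b, F.Adj a b → b ∈ B) {a b : V}
    (ha : a ∈ B) (h : F.Reachable a b) : b ∈ B := by
  obtain ⟨w⟩ := h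
  induction w with
  | nil => exact ha
  | cons h _ ih => exact ih (hB _ ha _ h)

lemma deg_one_unique {a b c : V} (hd : deg F a ≤ 1) (h1 : F.Adj a b) (h2 : F.Adj a c) : b = c := by
  unfold deg at hd
  exact (Set.ncard_le_one (Set.toFinite _)).1 hd b h1 c h2

lemma Ctx.p_ne (h : Ctx G k F S p m u v) {i j : ℕ} (hi : i ≤ m) (hj : j ≤ m) (hij : i ≠ j) :
    p i ≠ p j := fun e => hij (h.path.1 _ _ hi hj e)

lemma Ctx.deg_pos (h : Ctx G k F S p m u v) {w : V} (hw : w ∈ S) : 1 ≤ deg F w := by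
  have hm := h.m_pos
  have : ∃ b ∈ S, w ≠ b := by
    by_contra hcon
    push Not at hcon
    exact h.p_ne (Nat.zero_le m) le_rfl hm.ne
      ((hcon _ (h.mem (Nat.zero_le _))).symm.trans (hcon _ (h.mem le_rfl)))
  obtain ⟨b, hb, hwb⟩ := this
  obtain ⟨c, hc⟩ := exists_nbr h.conn hw hb hwb
  exact deg_pos_of_adj hc

lemma Ctx.leaf_hub (h : Ctx G k F S p m u v) {q r : V} (hq : deg F q = 1)
    (hqr : F.Adj q r) : ¬ Hub G F u r := by
  classical
  intro hub
  have hqS := h.conn.supp _ _ hqr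
  have hrS := h.conn.supp _ _ hqr.symm
  have huniq : ∀ c, F.Adj q c → c = r := fun c hc => deg_one_unique hq.le hc hqr
  have hconn : Conn (DKT.delE F q r) (S \ {q}) := by
    apply h.conn.of (fun a => if a = q then r else a)
    · rintro a ⟨ha, ha'⟩
      exact ⟨ha, if_neg ha'⟩
    · intro a b hab
      rw [delE_adj] at hab
      refine ⟨h.conn.supp _ _ hab.1, ?_⟩
      rintro rfl
      exact hab.2 (Or.inl ⟨rfl, huniq _ hab.1⟩)
    · intro a b hab
      by_cases ha : a = q
      · subst ha
        obtain rfl := huniq _ hab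
        simp [hab.ne']
      · by_cases hb : b = q
        · subst hb
          obtain rfl := huniq _ hab.symm
          simp [hab.ne]
        · simp only [if_neg ha, if_neg hb]
          apply Adj.reachable
          rw [delE_adj]
          tauto
  have hdeg := fun w => deg_delE F q r w hqr
  have hcard := Set.ncard_sdiff_singleton_add_one hqS (Set.toFinite S)
  refine h.killHub (b := r) Set.sdiff_subset (by omega) (delE_le h.le) hconn
    (fun w => by have := hdeg w; omega) ?_ ⟨hrS, hqr.ne'⟩ hub
    (by have := hdeg r; simp only [if_true] at this; omega)
  obtain ⟨a, ha, hau⟩ := h.hA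
  refine ⟨a, ⟨ha, ?_⟩, hau⟩
  rintro rfl
  exact h.hu (h.leaf_out ha hq.le hau)

lemma Ctx.leaf_nb_off (h : Ctx G k F S p m u v) {q r : V} (hq : deg F q = 1)
    (hoff : ∀ i ≤ m, p i ≠ q) (hqr : F.Adj q r) : ∀ i ≤ m, p i ≠ r := by
  rintro i hi rfl
  by_cases h0 : i = 0
  · subst h0; exact h.end_off hqr.symm hoff
  by_cases h1 : i = m
  · subst h1
    exact h.rev.end_off (by simpa using hqr.symm) (fun i hi => hoff _ (by omega))
  have a1 := h.path.2 (i-1) (by omega)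
  rw [show i - 1 + 1 = i by omega] at a1
  have a2 := h.path.2 i (by omega)
  exact h.leaf_hub hq hqr (Or.inr (deg_ge_three a1.symm a2 hqr.symm
    (h.p_ne (by omega) (by omega) (by omega)) (hoff _ (by omega)) (hoff _ (by omega))))

lemma Ctx.off_count (h : Ctx G k F S p m u v) :
    {a | a ∈ S ∧ G.Adj a u ∧ ∀ i ≤ m, p i ≠ a}.ncard + 2 * k + (m + 1) ≤ S.ncard + 4 := by
  classical
  set A := {a | a ∈ S ∧ G.Adj a u ∧ ∀ i ≤ m, p i ≠ a} with hA
  set Q := {q | deg F q = 1 ∧ ∀ i ≤ m, p i ≠ q} with hQ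
  set P := p '' (Set.Iic m) with hP
  have hQS : ∀ q ∈ Q, q ∈ S := by
    intro q hq
    by_contra hqS
    have := deg_zero h.conn hqS
    have := hq.1
    omega
  have hnb : ∀ q : V, ∃ r, q ∈ Q → F.Adj q r := by
    intro q
    by_cases hq : q ∈ Q
    · obtain ⟨r, hr⟩ := exists_nbr h.conn (hQS q hq) (h.mem (Nat.zero_le _))
        (hq.2 0 (Nat.zero_le _)).symm
      exact ⟨r, fun _ => hr⟩
    · exact ⟨q, fun h => absurd h hq⟩
  choose nb hnb using hnb
  have hroff : ∀ q ∈ Q, ∀ i ≤ m, p i ≠ nb q := fun q hq => h.leaf_nb_off hq.1 hq.2 (hnb q hq)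
  have hrhub : ∀ q ∈ Q, ¬ Hub G F u (nb q) := fun q hq => h.leaf_hub hq.1 (hnb q hq)
  -- no closed set off the path
  have hcl : ∀ B : Set V, (∀ a ∈ B, ∀ b, F.Adj a b → b ∈ B) → ∀ a ∈ B, a ∈ S → 
      (∀ b ∈ B, b ≠ p 0) → False := by
    intro B hB a ha haS hb
    exact hb _ (closed_reach hB ha (h.conn.reach a haS _ (h.mem (Nat.zero_le _)))) rfl
  have hdisj : Disjoint Q (nb '' Q) := by
    rw [Set.disjoint_left]
    rintro r hr ⟨q, hq, rfl⟩
    apply hcl {q, nb q} _ q (by simp) (hQS q hq)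
    · rintro b (rfl | rfl)
      · exact (hq.2 0 (Nat.zero_le _)).symm
      · exact (hr.2 0 (Nat.zero_le _)).symm
    · rintro a (rfl | rfl) b hab
      · exact Or.inr (deg_one_unique hq.1.le hab (hnb _ hq))
      · exact Or.inl (deg_one_unique hr.1.le hab (hnb _ hq).symm)
  have hinj : Set.InjOn nb Q := by
    intro q hq q' hq' e
    by_contra hne
    have a1 := (hnb q hq).symm
    have a2 := (hnb q' hq').symm
    rw [← e] at a2
    have hr := hrhub q hq
    apply hcl {nb q, q, q'} _ q (by simp) (hQS q hq)
    · rintro b (rfl | rfl | rfl)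
      · exact (hroff q hq 0 (Nat.zero_le _)).symm
      · exact (hq.2 0 (Nat.zero_le _)).symm
      · exact (hq'.2 0 (Nat.zero_le _)).symm
    · rintro a (rfl | rfl | rfl) b hab
      · by_contra hb
        simp only [Set.mem_insert_iff, Set.mem_singleton_iff, not_or] at hb
        exact hr (Or.inr (deg_ge_three hab a1 a2 hb.2.1 hb.2.2 hne))
      · exact Or.inl (deg_one_unique hq.1.le hab (hnb _ hq))
      · exact Or.inl ((deg_one_unique hq'.1.le hab (hnb _ hq')).trans e.symm)
  have hcardR : (nb '' Q).ncard = Q.ncard := Set.ncard_image_of_injOn hinj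
  have hcardP : P.ncard = m + 1 := by
    have hi : Set.InjOn p (Set.Iic m) := fun i hi j hj e => h.path.1 i j hi hj e
    rw [hP, Set.ncard_image_of_injOn hi]
    rw [Set.ncard_eq_toFinset_card']
    simp
  have hAQ : Disjoint A (Q ∪ nb '' Q) := by
    rw [Set.disjoint_left]
    rintro a ha (hq | ⟨q, hq, rfl⟩)
    · exact h.hu (h.leaf_out ha.1 hq.1.le ha.2.1)
    · exact hrhub q hq (Or.inl ha.2.1)
  have hPd : Disjoint P (A ∪ (Q ∪ nb '' Q)) := by
    rw [Set.disjoint_left]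
    rintro _ ⟨i, hi, rfl⟩ (ha | hq | ⟨q, hq, e⟩)
    · exact ha.2.2 i hi rfl
    · exact hq.2 i hi rfl
    · exact hroff q hq i hi e.symm
  have hsub : P ∪ (A ∪ (Q ∪ nb '' Q)) ⊆ S := by
    rintro _ (⟨i, hi, rfl⟩ | ha | hq | ⟨q, hq, rfl⟩)
    · exact h.mem hi
    · exact ha.1
    · exact hQS _ hq
    · exact h.conn.supp _ _ (hnb q hq).symm
  have hle := Set.ncard_le_ncard hsub (Set.toFinite _)
  rw [Set.ncard_union_eq hPd, Set.ncard_union_eq hAQ, Set.ncard_union_eq hdisj, hcardR, hcardP]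
    at hle
  -- the number of leaves
  have hleaf := le_leaves h.conn h.tree (fun w hw => h.deg_pos hw)
  have hsub2 : {w | deg F w = 1} ⊆ {p 0, p m} ∪ Q := by
    intro w hw
    by_cases hoff : ∀ i ≤ m, p i ≠ w
    · exact Or.inr ⟨hw, hoff⟩
    · push Not at hoff
      obtain ⟨i, hi, rfl⟩ := hoff
      left
      by_cases h0 : i = 0
      · subst h0; simp
      by_cases h1 : i = m
      · subst h1; simp
      exfalso
      have a1 := h.path.2 (i-1) (by omega)
      rw [show i - 1 + 1 = i by omega] at a1
      have := deg_one_unique (le_of_eq hw) a1.symm (h.path.2 i (by omega))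
      exact h.p_ne (by omega) (by omega) (by omega) this
  have h1 := Set.ncard_le_ncard hsub2 (Set.toFinite _)
  have h2 := Set.ncard_union_le {p 0, p m} Q
  have h3 : ({p 0, p m} : Set V).ncard ≤ 2 := Set.ncard_insert_le _ _ |>.trans (by simp)
  have := h.exc_eq
  omega

open Classical in
/-- Number of indices below `n` satisfying `X`. -/
noncomputable def cnt (X : ℕ → Prop) (n : ℕ) : ℕ :=
  ((Finset.range n).filter X).card

lemma cnt_zero (X : ℕ → Prop) : cnt X 0 = 0 := by simp [cnt]

lemma cnt_pos {X : ℕ → Prop} {n : ℕ} (h : X n) : cnt X (n+1) = cnt X n + 1 := by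
  unfold cnt
  rw [Finset.range_add_one, Finset.filter_insert, if_pos h, Finset.card_insert_of_notMem (by simp)]

lemma cnt_neg {X : ℕ → Prop} {n : ℕ} (h : ¬ X n) : cnt X (n+1) = cnt X n := by
  unfold cnt
  rw [Finset.range_add_one, Finset.filter_insert, if_neg h]

lemma on_count (B : Set V) (hB : ∀ b ∈ B, ∃ i ≤ m, p i = b) :
    B.ncard ≤ cnt (fun i => i ≤ m ∧ p i ∈ B) (m+1) := by
  classical
  have : B ⊆ p '' (((Finset.range (m+1)).filter (fun i => i ≤ m ∧ p i ∈ B) : Finset ℕ) : Set ℕ) := by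
    intro b hb
    obtain ⟨i, hi, rfl⟩ := hB b hb
    refine ⟨i, ?_, rfl⟩
    rw [Finset.mem_coe, Finset.mem_filter, Finset.mem_range]
    exact ⟨by omega, hi, hb⟩
  have h1 := Set.ncard_le_ncard this (Set.toFinite _)
  have h2 := Set.ncard_image_le (f := p) 
    (Finset.finite_toSet ((Finset.range (m+1)).filter (fun i => i ≤ m ∧ p i ∈ B)))
  rw [Set.ncard_coe_finset] at h2
  unfold cnt
  refine (h1.trans h2).trans (le_of_eq ?_)
  congr

lemma count_aux (X Y A : ℕ → Prop) (hX0 : ¬ X 0) (c1 : ∀ i, Y i → ¬ X (i+1))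
    (c2 : ∀ i, Y i → ¬ X (i+2)) (c3 : ∀ i, A i → ¬ X (i+1)) (c4 : ∀ i, Y i → ¬ A (i+1)) (j : ℕ) :
    (Y j → cnt X (j+2) + cnt Y (j+1) + cnt A (j+1) ≤ j + 2) ∧
    (¬ Y j → cnt X (j+2) + cnt Y (j+1) + cnt A (j+1) ≤ j + 1) := by
  have key : ∀ (Z : ℕ → Prop) n, (Z n ∧ cnt Z (n+1) = cnt Z n + 1) ∨
      (¬ Z n ∧ cnt Z (n+1) = cnt Z n) := fun Z n => by
    by_cases hz : Z n
    · exact Or.inl ⟨hz, cnt_pos hz⟩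
    · exact Or.inr ⟨hz, cnt_neg hz⟩
  induction j with
  | zero =>
    have d1 : Y 0 → ¬ X 1 := c1 0
    have d2 : A 0 → ¬ X 1 := c3 0
    have x0 : cnt X 1 = cnt X 0 := cnt_neg hX0
    have z1 := cnt_zero X
    have z2 := cnt_zero Y
    have z3 := cnt_zero A
    have x1 := key X 1
    have y0 := key Y 0
    have a0 := key A 0
    clear key c1 c2 c3 c4
    rw [show 0 + 2 = 1 + 1 from rfl]
    rcases x1 with ⟨x, ex⟩ | ⟨x, ex⟩ <;> rcases y0 with ⟨y', ey⟩ | ⟨y', ey⟩ <;>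
      rcases a0 with ⟨a, ea⟩ | ⟨a, ea⟩ <;>
      first
        | exact absurd x (d1 y')
        | exact absurd x (d2 a)
        | exact ⟨fun h => by first | omega | exact absurd h y',
            fun h => by first | omega | exact absurd y' h⟩
  | succ j ih =>
    have d1 : Y (j+1) → ¬ X (j+2) := c1 (j+1)
    have d2 : A (j+1) → ¬ X (j+2) := c3 (j+1)
    have d3 : Y j → ¬ X (j+2) := c2 j
    have d4 : Y j → ¬ A (j+1) := c4 j
    have x1 := key X (j+2)
    have y0 := key Y (j+1)
    have a0 := key A (j+1)
    rw [show j + 1 + 2 = j + 2 + 1 from rfl]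
    clear key c1 c2 c3 c4
    by_cases y : Y j
    · have i1 := ih.1 y
      have i2 := d3 y
      have i3 := d4 y
      rcases x1 with ⟨x, ex⟩ | ⟨x, ex⟩ <;> rcases y0 with ⟨y', ey⟩ | ⟨y', ey⟩ <;>
        rcases a0 with ⟨a, ea⟩ | ⟨a, ea⟩ <;>
        first
          | exact absurd x i2
          | exact absurd a i3
          | exact ⟨fun h => by first | omega | exact absurd h y',
              fun h => by first | omega | exact absurd y' h⟩
    · have i1 := ih.2 y
      rcases x1 with ⟨x, ex⟩ | ⟨x, ex⟩ <;> rcases y0 with ⟨y', ey⟩ | ⟨y', ey⟩ <;>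
        rcases a0 with ⟨a, ea⟩ | ⟨a, ea⟩ <;>
        first
          | exact absurd x (d1 y')
          | exact absurd x (d2 a)
          | exact ⟨fun h => by first | omega | exact absurd h y',
              fun h => by first | omega | exact absurd y' h⟩

lemma Ctx.false (h : Ctx G k F S p m u v)
    (hdeg : ∀ x y z : V, x ≠ y → x ≠ z → y ≠ z →
      ¬G.Adj x y → ¬G.Adj x z → ¬G.Adj y z →
      (Fintype.card V : ℤ) - 2 * k + 4 ≤ (deg G x : ℤ) + deg G y + deg G z) : False := by
  classical
  have hm := h.m_pos
  have hx0 : ¬ G.Adj (p 0) u := fun e => h.hu (h.leaf_out (h.mem (Nat.zero_le _)) h.deg_end e)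
  have hy0 : ¬ G.Adj (p m) u := fun e => h.hu (h.leaf_out (h.mem le_rfl) h.deg_end' e)
  have hd := hdeg (p 0) (p m) u (h.p_ne (by omega) (by omega) (by omega))
    (fun e => h.hu (e ▸ h.mem (Nat.zero_le _))) (fun e => h.hu (e ▸ h.mem le_rfl)) h.ends hx0 hy0
  have n1 := on_count (p := p) (m := m) (G.neighborSet (p 0)) (fun b hb => h.nbr_on hb)
  have n2 := on_count (p := p) (m := m) (G.neighborSet (p m)) (fun b hb => by
    obtain ⟨i, hi, e⟩ := h.rev.nbr_on (w := b) (by simpa using hb)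
    exact ⟨m - i, by omega, e⟩)
  have n3 := on_count (p := p) (m := m) {a | G.Adj a u ∧ ∃ i ≤ m, p i = a} (fun b hb => hb.2)
  have n4 := h.off_count
  have hN : G.neighborSet u ⊆ {a | G.Adj a u ∧ ∃ i ≤ m, p i = a} ∪ 
      ({a | a ∈ S ∧ G.Adj a u ∧ ∀ i ≤ m, p i ≠ a} ∪ (insert u S)ᶜ) := by
    intro a ha
    have ha' : G.Adj a u := ha.symm
    by_cases hP : ∃ i ≤ m, p i = a
    · exact Or.inl ⟨ha', hP⟩
    · by_cases hS : a ∈ S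
      · exact Or.inr (Or.inl ⟨hS, ha', by push Not at hP; exact hP⟩)
      · refine Or.inr (Or.inr ?_)
        rintro (rfl | h')
        · exact ha.ne rfl
        · exact hS h'
  have n5 := Set.ncard_le_ncard hN (Set.toFinite _)
  have n6 := Set.ncard_union_le {a | G.Adj a u ∧ ∃ i ≤ m, p i = a}
      ({a | a ∈ S ∧ G.Adj a u ∧ ∀ i ≤ m, p i ≠ a} ∪ (insert u S)ᶜ)
  have n7 := Set.ncard_union_le {a | a ∈ S ∧ G.Adj a u ∧ ∀ i ≤ m, p i ≠ a} (insert u S)ᶜ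
  have n8 := Set.ncard_add_ncard_compl (insert u S)
  rw [Set.ncard_insert_of_notMem h.hu, Nat.card_eq_fintype_card] at n8
  have n9 := count_aux (fun i => i ≤ m ∧ p i ∈ G.neighborSet (p 0))
    (fun i => i ≤ m ∧ p i ∈ G.neighborSet (p m))
    (fun i => i ≤ m ∧ p i ∈ {a | G.Adj a u ∧ ∃ i ≤ m, p i = a})
    (fun e => e.2.ne rfl)
    (fun i e1 e2 => h.cross (by have := e2.1; omega) e1.2 e2.2)
    (fun i e1 e2 => h.gap (by have := e2.1; omega) e1.2 e2.2)
    (fun i e1 e2 => by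
      have hub : G.Adj (p i) u := e1.2.1
      by_cases hi : i = 0
      · subst hi; exact hx0 hub
      · exact h.hub_succ (by omega) (by have := e2.1; omega) (Or.inl hub) e2.2)
    (fun i e1 e2 => by
      have hub : G.Adj (p (i+1)) u := e2.2.1
      by_cases hi : i + 1 = m
      · subst hi; exact hy0 hub
      · exact h.hub_pred (by have := e2.1; omega) (Or.inl hub) e1.2) m
  have n10 := n9.2 (fun e => e.2.ne rfl)
  have n11 : cnt (fun i => i ≤ m ∧ p i ∈ G.neighborSet (p 0)) (m+2) =
      cnt (fun i => i ≤ m ∧ p i ∈ G.neighborSet (p 0)) (m+1) :=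
    cnt_neg (fun e => by have := e.1; omega)
  unfold deg at hd
  omega

end

lemma exists_max (Q : ℕ → Prop) (B : ℕ) (hne : ∃ n, Q n) (hB : ∀ n, Q n → n ≤ B) :
    ∃ n, Q n ∧ ∀ n', Q n' → n' ≤ n := by
  classical
  obtain ⟨n, hn⟩ := hne
  exact ⟨Nat.findGreatest Q B, Nat.findGreatest_spec (hB n hn) hn,
    fun n' hn' => Nat.le_findGreatest (hB n' hn') hn'⟩

lemma exists_uv {G : SimpleGraph V} {S : Set V} {s a : V} (w : G.Walk a s) (hs : s ∈ S) :
    a ∉ S → ∀ b, b ∉ S → G.Adj a b → ∃ u v, u ∉ S ∧ v ∉ S ∧ G.Adj u v ∧ ∃ c ∈ S, G.Adj c u := by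
  induction w with
  | nil => intro ha; exact absurd hs ha
  | @cons a c d hac _ ih =>
    intro ha b hb hab
    by_cases hc : c ∈ S
    · exact ⟨a, b, ha, hb, hab, c, hc, hac.symm⟩
    · exact ih hs hc a ha hac.symm

def toSub {G F : SimpleGraph V} {S : Set V} (hle : F ≤ G) (h : Conn F S) : G.Subgraph where
  verts := S
  Adj := F.Adj
  adj_sub := fun h => hle h
  edge_vert := fun h' => h.supp _ _ h'
  symm := F.symm

end DKT

open DKT in
/-- If `k ≥ 2`, `G` is connected of order `n` and
`d(x) + d(y) + d(z) ≥ n - 2k + 4` for every independent triple `{x, y, z}`,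
then `G` has a dominating tree with at most `k` leaves. -/
theorem dominating_k_ended_tree {V : Type*} [Fintype V] (k : ℕ) (hk : 2 ≤ k)
    (G : SimpleGraph V) (hconn : G.Connected)
    (hdeg : ∀ x y z : V, x ≠ y → x ≠ z → y ≠ z →
      ¬G.Adj x y → ¬G.Adj x z → ¬G.Adj y z →
      (Fintype.card V : ℤ) - 2 * k + 4 ≤ (deg G x : ℤ) + deg G y + deg G z) :
    ∃ H : G.Subgraph, IsEndedTree H k ∧ IsIndep G H.vertsᶜ := by
  classical
  have hcardV : ∀ S : Set V, S.ncard ≤ Fintype.card V := by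
    intro S
    rw [← Nat.card_eq_fintype_card, ← Set.ncard_univ]
    exact Set.ncard_le_ncard (Set.subset_univ _) (Set.toFinite _)
  -- maximal order
  obtain ⟨N, ⟨F0, S, hS0, hle0, hc0, he0, hN⟩, hmax⟩ := exists_max
    (fun n => ∃ (F : SimpleGraph V) (S : Set V), S.Nonempty ∧ F ≤ G ∧ Conn F S ∧ exc F + 2 ≤ k ∧
      S.ncard = n) (Fintype.card V) (by
      obtain ⟨s⟩ := hconn.nonempty
      refine ⟨1, ⊥, {s}, ⟨s, rfl⟩, bot_le, ⟨fun a b h => absurd h (by simp), ?_⟩, ?_, by simp⟩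
      · rintro a rfl b rfl
        exact Reachable.refl _
      · have : exc (⊥ : SimpleGraph V) = 0 := by
          unfold exc
          apply Finset.sum_eq_zero
          intro w _
          simp [deg, neighborSet]
        omega) (by
      rintro n ⟨F, S, _, _, _, _, rfl⟩
      exact hcardV S)
  obtain ⟨F1, hF1, hc1, ht1⟩ := exists_tree hc0 hS0
  have he1 : exc F1 ≤ exc F0 := exc_le (fun w => by have := deg_mono hF1 w; omega)
  obtain ⟨s, hs⟩ := hS0
  -- longest path
  obtain ⟨m, ⟨F, p, hle, hc, he, ht, hp⟩, hmaxP⟩ := exists_max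
    (fun m => ∃ (F : SimpleGraph V) (p : ℕ → V), F ≤ G ∧ Conn F S ∧ exc F + 2 ≤ k ∧
      dsum F + 2 = 2 * S.ncard ∧ PathIn F p m) (Fintype.card V) 
      ⟨0, F1, fun _ => s, hF1.trans hle0, hc1, by omega, ht1,
        fun i j hi hj _ => by omega, fun i hi => by omega⟩ (by
      rintro n ⟨F, p, _, _, _, _, hp⟩
      have h1 : (p '' (Set.Iic n)).ncard = n + 1 := by
        have hi : Set.InjOn p (Set.Iic n) := fun i hi j hj e => hp.1 i j hi hj e
        rw [Set.ncard_image_of_injOn hi]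
        rw [Set.ncard_eq_toFinset_card']
        simp
      have := hcardV (p '' (Set.Iic n))
      omega)
  refine ⟨toSub hle hc, ⟨isTree_of hc ⟨s, hs⟩ ht, ?_⟩, ?_⟩
  · have hl := leaves_le hc ht
    refine le_trans ?_ (hl.trans he)
    unfold leafCount
    rw [← Set.ncard_image_of_injective _ Subtype.val_injective]
    apply Set.ncard_le_ncard _ (Set.toFinite _)
    rintro _ ⟨⟨w, hwS⟩, hw, rfl⟩
    have hwS' : w ∈ S := hwS
    have h1 : deg (F.induce S) ⟨w, hwS'⟩ = 1 := hw
    have h2 := deg_map (F.induce S) ⟨w, hwS'⟩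
    rw [map_induce hc] at h2
    exact h2.trans h1
  · intro a ha b hb _ hab
    obtain ⟨w⟩ := hconn.preconnected a s
    obtain ⟨u, v, hu, hv, huv, hA⟩ := exists_uv w hs ha b hb hab
    refine Ctx.false (p := p) (m := m) (u := u) (v := v) (F := F) (S := S) (k := k) (G := G)
      ⟨hle, hc, he, ht, hp, ?_, ?_, hu, hv, huv, hA⟩ hdeg
    · intro F' S' h1 h2 h3
      rcases S'.eq_empty_or_nonempty with rfl | hne
      · simp
      · rw [hN]
        exact hmax _ ⟨F', S', hne, h1, h2, h3, rfl⟩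
    · intro F' q m' h1 h2 h3 h4 h5
      exact hmaxP _ ⟨F', q, h1, h2, h3, h4, h5⟩
end

section
/- Let G be a connected simple graph containing no dominating path, i.e., for every path P of maximum order in G the set of vertices outside P is not independent. Then G contains an independent set {x, y, z} of three pairwise nonadjacent vertices, and G contains a subgraph that is a tree with at most 3 leaves having at least d(x) + d(y) + d(z) + 1 vertices for some independent triple {x, y, z}; in particular t_3 ≥ σ_3 + 1, where σ_3 is the minimum of d(x) + d(y) + d(z) over independent triples and t_3 is the maximum order of a subgraph tree with at most 3 leaves. -/
open SimpleGraph

theorem chain_to_walk {V : Type*} (G : SimpleGraph V) : ∀ (l : List V), l ≠ [] → l.IsChain G.Adj →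
    ∃ (u v : V) (p : G.Walk u v), p.support = l
  | [], h, _ => absurd rfl h
  | [a], _, _ => ⟨a, a, .nil, rfl⟩
  | a :: b :: l, _, h => by
    rw [List.isChain_cons_cons] at h
    obtain ⟨u, v, p, hp⟩ := chain_to_walk G (b :: l) (by simp) h.2
    have hu : u = b := by
      have := p.head_support
      simp only [hp, List.head_cons] at this
      exact this.symm
    subst hu
    exact ⟨a, v, .cons h.1 p, by simp [hp]⟩

theorem pathOrd_bdd {V : Type*} [Fintype V] (G : SimpleGraph V) :
    BddAbove {m | ∃ (u v : V) (p : G.Walk u v), p.IsPath ∧ p.support.length = m} := by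
  refine ⟨Fintype.card V, ?_⟩
  rintro m ⟨u, v, p, hp, rfl⟩
  exact hp.support_nodup.length_le_card

theorem chain_le_pathOrd {V : Type*} [Fintype V] (G : SimpleGraph V) (l : List V)
    (hn : l.Nodup) (hc : l.IsChain G.Adj) : l.length ≤ pathOrd G := by
  by_cases h : l = []
  · simp [h]
  obtain ⟨u, v, p, hp⟩ := chain_to_walk G l h hc
  exact le_csSup (pathOrd_bdd G) ⟨u, v, p, by rw [Walk.isPath_def, hp]; exact hn, by rw [hp]⟩

theorem nodup_split {V : Type*} {A B A' B' : List V} {x : V}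
    (h : (A ++ x :: B).Nodup) (e : A ++ x :: B = A' ++ x :: B') : A = A' ∧ B = B' := by
  induction A generalizing A' with
  | nil => cases A' <;> simp_all
  | cons a A ih =>
    cases A' with
    | nil =>
      simp only [List.cons_append, List.nil_append, List.cons.injEq, List.nodup_cons] at h e
      rw [e.1] at h
      simp at h
    | cons b A' =>
      simp only [List.cons_append, List.cons.injEq, List.nodup_cons] at h e
      have := ih h.2 e.2
      exact ⟨by rw [e.1, this.1], this.2⟩

theorem rev_chain {V : Type*} {G : SimpleGraph V} {l : List V} :
    l.reverse.IsChain G.Adj ↔ l.IsChain G.Adj := by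
  rw [List.isChain_reverse]
  constructor <;> intro h <;> exact h.imp (fun a b hab => hab.symm)

/-- A cycle list plus two outside vertices gives a path with two more vertices. -/
theorem cycle_ext {V : Type*} [Fintype V] (G : SimpleGraph V) (C : List V)
    (hn : C.Nodup) (hc : C.IsChain G.Adj)
    (hcl : ∀ a ∈ C.getLast?, ∀ b ∈ C.head?, G.Adj a b)
    {w q r : V} (hw : w ∈ C) (hq : q ∉ C) (hr : r ∉ C) (hwq : G.Adj q w) (hqr : G.Adj r q) :
    C.length + 2 ≤ pathOrd G := by
  obtain ⟨A, B, rfl⟩ := List.append_of_mem hw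
  have := chain_le_pathOrd G (r :: q :: (w :: B ++ A)) (by
    have := hqr.ne
    have := List.nodup_append_comm.1 hn
    simp_all) (by
    rw [List.isChain_append] at hc
    have : (w :: B ++ A).IsChain G.Adj := by
      rw [List.isChain_append]
      refine ⟨hc.2.1, hc.1, ?_⟩
      intro a ha b hb
      apply hcl
      · rw [List.getLast?_append]; simp_all
      · rw [List.head?_append]; simp_all
    simp_all [List.isChain_cons_cons])
  simp at this ⊢
  omega

/-- successor-of-x adjacent to head, x adjacent to outside vertex. -/
theorem pred_ext {V : Type*} [Fintype V] (G : SimpleGraph V) {L : List V}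
    (hn : L.Nodup) (hc : L.IsChain G.Adj) {u : V} (hu : L.head? = some u)
    {A B : List V} {x y q : V} (hL : L = A ++ x :: y :: B) (hy : G.Adj u y)
    (hq : q ∉ L) (hqx : G.Adj q x) : L.length + 1 ≤ pathOrd G := by
  subst hL
  have := chain_le_pathOrd G (q :: (x :: A.reverse) ++ (y :: B)) (by
    have h2 : (x :: A.reverse).Perm (A ++ [x]) := by
      have := List.reverse_perm (A ++ [x])
      simpa using this
    have h1 : ((x :: A.reverse) ++ (y :: B)).Perm (A ++ x :: y :: B) := by
      have := h2.append_right (y :: B)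
      simpa using this
    rw [List.cons_append, List.nodup_cons, h1.nodup_iff, h1.mem_iff]
    exact ⟨hq, hn⟩) (by
    have e : A ++ x :: y :: B = (A ++ [x]) ++ (y :: B) := by simp
    rw [e, List.isChain_append] at hc
    rw [List.isChain_append]
    refine ⟨?_, hc.2.1, ?_⟩
    · have h := rev_chain.2 hc.1
      simp only [List.reverse_append, List.reverse_cons, List.reverse_nil, List.nil_append,
        List.singleton_append] at h
      exact List.isChain_cons_cons.2 ⟨hqx, h⟩
    · intro a ha b hb
      have hb' : y = b := by simpa using hb
      subst hb'
      have : a = u := by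
        cases A with
        | nil => simp at ha hu; rw [← ha, ← hu]
        | cons c A => simp at ha hu; simp [List.getLast?_cons] at ha; rw [← ha, ← hu]
      rw [this]; exact hy)
  simp at this ⊢
  omega

theorem both_ext {V : Type*} [Fintype V] (G : SimpleGraph V) {L : List V}
    (hn : L.Nodup) (hc : L.IsChain G.Adj) (hmax : L.length = pathOrd G)
    {u v : V} (hu : L.head? = some u) (hv : L.getLast? = some v)
    {A B : List V} {w x y s q r : V} (hL : L = A ++ w :: x :: y :: B)
    (hy : G.Adj u y) (hw : G.Adj v w)
    (hs : s ∈ L) (hq : q ∉ L) (hr : r ∉ L) (hsq : G.Adj q s) (hqr : G.Adj r q) : False := by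
  by_cases hsx : s = x
  · subst hsx
    have := pred_ext G hn hc hu (A := A ++ [w]) (by simpa using hL) hy hq hsq
    omega
  subst hL
  have hP : ((A ++ [w]) ++ (y :: B).reverse).Perm (A ++ w :: y :: B) := by
    have := (List.reverse_perm (y :: B)).append_left (A ++ [w])
    simpa using this
  have := cycle_ext G ((A ++ [w]) ++ (y :: B).reverse) (w := s) (q := q) (r := r)
    (by
      rw [hP.nodup_iff]
      refine hn.sublist ?_
      simp)
    (by
      have e : A ++ w :: x :: y :: B = (A ++ [w]) ++ ([x] ++ (y :: B)) := by simp
      rw [e, List.isChain_append, List.isChain_append (l₁ := [x])] at hc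
      rw [List.isChain_append]
      refine ⟨hc.1, rev_chain.2 hc.2.1.2.1, ?_⟩
      intro a ha b hb
      have ha' : w = a := by simpa using ha
      subst ha'
      rw [List.head?_reverse] at hb
      have : b = v := by
        simp [List.getLast?_append, List.getLast?_cons] at hv hb
        rw [← hv, ← hb]
      rw [this]; exact hw.symm)
    (by
      intro a ha b hb
      have ha' : y = a := by
        rw [List.getLast?_append] at ha
        simpa using ha
      subst ha'
      have : b = u := by
        cases A with
        | nil => simp at hb hu; rw [← hb, ← hu]
        | cons c A => simp at hb hu; rw [← hb, ← hu]
      rw [this]; exact hy.symm)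
    (by
      rw [hP.mem_iff]
      simp at hs ⊢
      tauto)
    (by rw [hP.mem_iff]; simp at hq ⊢; tauto)
    (by rw [hP.mem_iff]; simp at hr ⊢; tauto) hsq hqr
  rw [hP.length_eq] at this
  simp at this hmax
  omega

theorem deg_le_pred {V : Type*} [Fintype V] (G : SimpleGraph V) {L : List V}
    (hn : L.Nodup) (hc : L.IsChain G.Adj) (hmax : L.length = pathOrd G)
    {u : V} (hu : L.head? = some u) :
    deg G u ≤ {x | ∃ A B y, L = A ++ x :: y :: B ∧ G.Adj u y}.ncard := by
  have key : ∀ y ∈ G.neighborSet u, ∃ x A B, L = A ++ x :: y :: B := by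
    intro y hy
    have hy : G.Adj u y := hy
    have hyL : y ∈ L := by
      by_contra hyL
      cases L with
      | nil => simp at hu
      | cons a L =>
        simp at hu
        subst hu
        have := chain_le_pathOrd G (y :: a :: L) (List.nodup_cons.2 ⟨hyL, hn⟩)
          (List.isChain_cons_cons.2 ⟨hy.symm, hc⟩)
        simp at this hmax
        omega
    obtain ⟨A, B, rfl⟩ := List.append_of_mem hyL
    rcases List.eq_nil_or_concat' A with rfl | ⟨A', x, rfl⟩
    · simp at hu
      exact absurd hu.symm hy.ne
    · exact ⟨x, A', B, by simp⟩
  choose! f hf using key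
  unfold deg
  refine Set.ncard_le_ncard_of_injOn f ?_ ?_ (Set.toFinite _)
  · intro y hy
    obtain ⟨A, B, h⟩ := hf y hy
    exact ⟨A, B, y, h, hy⟩
  · intro y hy y' hy' e
    obtain ⟨A, B, h⟩ := hf y hy
    obtain ⟨A', B', h'⟩ := hf y' hy'
    rw [e] at h
    have := nodup_split (h ▸ hn) (h.symm.trans h')
    simpa using (List.cons.inj this.2).1

theorem tree_lemma {V : Type*} [Fintype V] (G : SimpleGraph V) {u v w z : V}
    (p : G.Walk u v) (q : G.Walk w z) (hp : p.IsPath) (hq : q.IsPath) (hw : w ∈ p.support)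
    (hd : ∀ x ∈ q.support, x ∈ p.support → x = w) :
    IsEndedTree (p.toSubgraph ⊔ q.toSubgraph) 3 ∧
      (p.toSubgraph ⊔ q.toSubgraph).verts.ncard = p.length + 1 + q.length := by
  classical
  have hcard : (p.toSubgraph ⊔ q.toSubgraph).verts.ncard = p.length + 1 + q.length := by
    have e : (p.toSubgraph ⊔ q.toSubgraph).verts
        = ((p.support ++ q.support.tail).toFinset : Set V) := by
      ext x
      have : x ∈ q.support ↔ x = w ∨ x ∈ q.support.tail := by
        rw [← List.mem_cons, q.cons_tail_support]
      simp [Walk.mem_verts_toSubgraph, this]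
      constructor
      · rintro (h | rfl | h)
        · exact Or.inl h
        · exact Or.inl hw
        · exact Or.inr h
      · tauto
    rw [e, Set.ncard_coe_finset, List.toFinset_card_of_nodup]
    · simp
    · have hqn := hq.support_nodup
      rw [← q.cons_tail_support, List.nodup_cons] at hqn
      rw [List.nodup_append']
      refine ⟨hp.support_nodup, hqn.2, ?_⟩
      intro x hx hx'
      have := hd x (List.mem_of_mem_tail hx') hx
      subst this
      exact hqn.1 hx'
  have hconn : (p.toSubgraph ⊔ q.toSubgraph).Connected :=
    Subgraph.connected_sup p.toSubgraph_connected.preconnected q.toSubgraph_connected.preconnected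
      ⟨w, by simp [Walk.mem_verts_toSubgraph, hw]⟩
  have hedge : (p.toSubgraph ⊔ q.toSubgraph).edgeSet.ncard ≤ p.length + q.length := by
    have e : (p.toSubgraph ⊔ q.toSubgraph).edgeSet ⊆ ((p.edges ++ q.edges).toFinset : Set _) := by
      intro x hx
      simpa [Subgraph.edgeSet_sup] using hx
    refine (Set.ncard_le_ncard e).trans ?_
    rw [Set.ncard_coe_finset]
    refine (List.toFinset_card_le _).trans ?_
    simp
  refine ⟨⟨?_, ?_⟩, hcard⟩
  · rw [isTree_iff_connected_and_card]
    refine ⟨hconn.coe, ?_⟩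
    have h1 := hconn.coe.card_vert_le_card_edgeSet_add_one
    have h2 : Nat.card (p.toSubgraph ⊔ q.toSubgraph).coe.edgeSet
        = (p.toSubgraph ⊔ q.toSubgraph).edgeSet.ncard := by
      rw [← Subgraph.image_coe_edgeSet_coe, Set.ncard_image_of_injective, Nat.card_coe_set_eq]
      exact Sym2.map.injective Subtype.val_injective
    have h3 := Nat.card_coe_set_eq (p.toSubgraph ⊔ q.toSubgraph).verts
    omega
  · unfold leafCount
    have hint : ∀ {a b : V} (r : G.Walk a b), r.IsPath → r.toSubgraph ≤ (p.toSubgraph ⊔ q.toSubgraph) →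
        ∀ x ∈ r.support, x ≠ a → x ≠ b → ((p.toSubgraph ⊔ q.toSubgraph).neighborSet x).ncard ≠ 1 := by
      intro a b r hr hle x hx hxa hxb h1
      obtain ⟨i, rfl, hi⟩ := Walk.mem_support_iff_exists_getVert.1 hx
      have h2 := hr.ncard_neighborSet_toSubgraph_internal_eq_two (i := i)
        (by rintro rfl; simp at hxa)
        (lt_of_le_of_ne hi (by rintro rfl; simp at hxb))
      have := Set.ncard_le_ncard (Subgraph.neighborSet_subset_of_subgraph hle (r.getVert i))
      omega
    have hsub : Subtype.val '' {x : (p.toSubgraph ⊔ q.toSubgraph).verts |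
        ((p.toSubgraph ⊔ q.toSubgraph).coe.neighborSet x).ncard = 1} ⊆ {u, v, z} := by
      rintro _ ⟨x, hx, rfl⟩
      have hx' : ((p.toSubgraph ⊔ q.toSubgraph).neighborSet x).ncard = 1 := by
        have e : (p.toSubgraph ⊔ q.toSubgraph).neighborSet x =
          Subtype.val '' ((p.toSubgraph ⊔ q.toSubgraph).coe.neighborSet x) := by
          ext y
          constructor
          · intro h
            exact ⟨⟨y, Subgraph.edge_vert _ (Subgraph.Adj.symm h)⟩, h, rfl⟩
          · rintro ⟨y, h, rfl⟩
            exact h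
        rw [e, Set.ncard_image_of_injective _ Subtype.val_injective]
        exact hx
      by_contra hne
      simp only [Set.mem_insert_iff, Set.mem_singleton_iff, not_or] at hne
      by_cases hxp : x.1 ∈ p.support
      · exact hint p hp le_sup_left x hxp hne.1 hne.2.1 hx'
      · have hxq : x.1 ∈ q.support := by
          have := x.2
          simp [Walk.mem_verts_toSubgraph] at this
          tauto
        exact hint q hq le_sup_right x hxq (by rintro h; rw [h] at hxp; exact hxp hw) hne.2.2 hx'
    rw [← Set.ncard_image_of_injective _ Subtype.val_injective]
    refine (Set.ncard_le_ncard hsub).trans ?_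
    refine (Set.ncard_insert_le _ _).trans ?_
    have := Set.ncard_insert_le v {z}
    simp at this
    omega

theorem main_exists {V : Type*} [Fintype V]
    (G : SimpleGraph V) (hconn : G.Connected)
    (hdom : ∀ (u v : V) (p : G.Walk u v), p.IsPath → p.support.length = pathOrd G →
      ¬ IsIndep G {x | x ∉ p.support}) :
    ∃ x y z : V, x ≠ y ∧ x ≠ z ∧ y ≠ z ∧ ¬G.Adj x y ∧ ¬G.Adj x z ∧ ¬G.Adj y z ∧
      ∃ H : G.Subgraph, IsEndedTree H 3 ∧
        deg G x + deg G y + deg G z + 1 ≤ H.verts.ncard := by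
  classical
  obtain ⟨u, v, p, hp, hpl⟩ := Nat.sSup_mem
    (s := {m | ∃ (u v : V) (p : G.Walk u v), p.IsPath ∧ p.support.length = m})
    (by
      obtain ⟨a⟩ := hconn.nonempty
      exact ⟨1, a, a, .nil, by simp, by simp⟩) (pathOrd_bdd G)
  change p.support.length = pathOrd G at hpl
  -- outside edge
  have h1 := hdom u v p hp hpl
  simp only [IsIndep, Set.Pairwise, Set.mem_setOf_eq] at h1
  push Not at h1
  obtain ⟨a, ha, b, hb, -, hab⟩ := h1
  obtain ⟨W⟩ := hconn.preconnected a u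
  obtain ⟨⟨⟨s, w⟩, hsw⟩, -, hs, hw⟩ := W.exists_boundary_dart
    {x | x ∉ p.support ∧ ∃ y, y ∉ p.support ∧ G.Adj x y} ⟨ha, b, hb, hab⟩ (by simp)
  simp only [Set.mem_setOf_eq] at hs hw
  have hsw : G.Adj s w := hsw
  obtain ⟨hsP, r, hrP, hsr⟩ := hs
  have hwP : w ∈ p.support := by
    by_contra hwP
    exact hw ⟨hwP, s, hsP, hsw.symm⟩
  clear hw W ha hb hab a b
  -- longest path from s
  obtain ⟨⟨z, q, hq, hqP, hql⟩, hqmax⟩ :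
      (∃ (z : V) (q : G.Walk s z), q.IsPath ∧ (∀ x ∈ q.support, x ∉ p.support) ∧
        q.length = sSup {n | ∃ (z : V) (q : G.Walk s z), q.IsPath ∧
          (∀ x ∈ q.support, x ∉ p.support) ∧ q.length = n}) ∧
      ∀ (z : V) (q : G.Walk s z), q.IsPath → (∀ x ∈ q.support, x ∉ p.support) →
        q.length ≤ sSup {n | ∃ (z : V) (q : G.Walk s z), q.IsPath ∧
          (∀ x ∈ q.support, x ∉ p.support) ∧ q.length = n} := by
    have hb : BddAbove {n | ∃ (z : V) (q : G.Walk s z), q.IsPath ∧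
          (∀ x ∈ q.support, x ∉ p.support) ∧ q.length = n} := by
      refine ⟨Fintype.card V, ?_⟩
      rintro _ ⟨z, q, hq, -, rfl⟩
      exact hq.length_lt.le
    refine ⟨Nat.sSup_mem (s := {n | ∃ (z : V) (q : G.Walk s z), q.IsPath ∧
          (∀ x ∈ q.support, x ∉ p.support) ∧ q.length = n}) ⟨0, s, .nil, by simp, by simpa using hsP, by simp⟩ hb, ?_⟩
    intro z q hq hqP
    exact le_csSup hb ⟨z, q, hq, hqP, rfl⟩
  rw [← hql] at hqmax
  clear hql
  have hzP : z ∉ p.support := hqP z q.end_mem_support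
  -- neighbours of z
  have hNz : ∀ x, G.Adj z x → x ∈ p.support ∨ x ∈ q.support := by
    intro x hx
    by_contra hcon
    push Not at hcon
    have := hqmax x (q.concat hx) (hq.concat hcon.2 hx) (by
      intro y hy
      simp only [Walk.support_concat, List.mem_append, List.mem_singleton] at hy
      rcases hy with hy | rfl
      · exact hqP y hy
      · exact hcon.1)
    simp at this
  have hn := hp.support_nodup
  have hc := p.isChain_adj_support
  have hu : p.support.head? = some u := by
    rw [← p.cons_tail_support]; rfl
  have hv : p.support.getLast? = some v := by
    rw [List.getLast?_eq_some_getLast p.support_ne_nil, p.getLast_support]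
  -- reversed data
  have hn' := List.nodup_reverse.2 hn
  have hc' := rev_chain.2 hc
  have hpl' : p.support.reverse.length = pathOrd G := by simpa using hpl
  have hu' : p.support.reverse.head? = some v := by rw [List.head?_reverse, hv]
  -- endpoints have no outside neighbours
  have huout : ∀ x, G.Adj u x → x ∈ p.support := by
    intro x hx
    by_contra hxP
    have := chain_le_pathOrd G (x :: p.support) (List.nodup_cons.2 ⟨hxP, hn⟩) (by
      rw [← p.cons_tail_support] at hc ⊢
      exact List.isChain_cons_cons.2 ⟨hx.symm, hc⟩)
    simp at this hpl
    omega
  have hvout : ∀ x, G.Adj v x → x ∈ p.support := by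
    intro x hx
    by_contra hxP
    have := chain_le_pathOrd G (x :: p.reverse.support) (List.nodup_cons.2
      ⟨by simpa using hxP, hp.reverse.support_nodup⟩) (by
      have hc := p.reverse.isChain_adj_support
      rw [← p.reverse.cons_tail_support] at hc ⊢
      exact List.isChain_cons_cons.2 ⟨hx.symm, hc⟩)
    simp at this hpl
    omega
  have huv : u ≠ v := by
    rintro rfl
    have : p = .nil := by simpa using hp
    subst this
    simp only [Walk.support_nil, List.mem_singleton] at hwP
    subst hwP
    exact hsP (huout s hsw.symm)
  have hnuv : ¬ G.Adj u v := by
    intro h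
    have := cycle_ext G p.support hn hc (by
      intro a ha b hb
      rw [hv] at ha; rw [hu] at hb
      simp at ha hb
      subst ha hb
      exact h.symm) hwP hsP hrP hsw hsr.symm
    omega
  set Nu := {x | ∃ A B y, p.support = A ++ x :: y :: B ∧ G.Adj u y} with hNu
  set Nv := {x | ∃ A B y, p.support.reverse = A ++ x :: y :: B ∧ G.Adj v y} with hNv
  set Nz := {x | x ∈ p.support ∧ G.Adj z x} with hNzd
  have d1 : deg G u ≤ Nu.ncard := deg_le_pred G hn hc hpl hu
  have d2 : deg G v ≤ Nv.ncard := deg_le_pred G hn' hc' hpl' hu'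
  have d3 : deg G z ≤ Nz.ncard + q.length := by
    have hsub : G.neighborSet z ⊆ Nz ∪ ((q.support.toFinset.erase z : Finset V) : Set V) := by
      intro x hx
      have hx : G.Adj z x := hx
      rcases hNz x hx with h | h
      · exact Or.inl ⟨h, hx⟩
      · right
        simp [h, hx.ne']
    unfold deg
    refine (Set.ncard_le_ncard hsub).trans ((Set.ncard_union_le _ _).trans ?_)
    rw [Set.ncard_coe_finset, Finset.card_erase_of_mem (by simp),
      List.toFinset_card_of_nodup hq.support_nodup]
    simp
  have j1 : Disjoint Nu Nz := by
    rw [Set.disjoint_left]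
    rintro x ⟨A, B, y, hL, hy⟩ ⟨-, hx⟩
    have := pred_ext G hn hc hu hL hy hzP hx
    omega
  have j2 : Disjoint Nv Nz := by
    rw [Set.disjoint_left]
    rintro x ⟨A, B, y, hL, hy⟩ ⟨-, hx⟩
    have := pred_ext G hn' hc' hu' hL hy (by simpa using hzP) hx
    omega
  have j3 : Disjoint Nu Nv := by
    rw [Set.disjoint_left]
    rintro x ⟨A, B, y, hL, hy⟩ ⟨A', B', y', hL', hy'⟩
    have hL2 : p.support = (B'.reverse ++ [y']) ++ x :: A'.reverse := by
      have := congrArg List.reverse hL'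
      simpa using this
    have := nodup_split (hL ▸ hn) (hL.symm.trans hL2)
    rw [this.1] at hL
    exact both_ext G hn hc hpl hu hv (A := B'.reverse) (B := B) (w := y') (x := x) (y := y)
      (by simpa using hL) hy hy' hwP hsP hrP hsw hsr.symm
  have tot : Nu.ncard + Nv.ncard + Nz.ncard ≤ p.length + 1 := by
    rw [← Set.ncard_union_eq j3, ← Set.ncard_union_eq (Disjoint.union_left j1 j2)]
    have hsub : Nu ∪ Nv ∪ Nz ⊆ (p.support.toFinset : Set V) := by
      rintro x ((⟨A, B, y, hL, -⟩ | ⟨A, B, y, hL, -⟩) | ⟨h, -⟩)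
      · simp [hL]
      · have : x ∈ p.support.reverse := by simp [hL]
        simpa using this
      · simpa using h
    refine (Set.ncard_le_ncard hsub).trans ?_
    rw [Set.ncard_coe_finset]
    refine (List.toFinset_card_le _).trans ?_
    simp
  have hq' : (Walk.cons hsw.symm q).IsPath := by
    rw [Walk.cons_isPath_iff]
    exact ⟨hq, fun h => hqP w h hwP⟩
  obtain ⟨T1, T2⟩ := tree_lemma G p (Walk.cons hsw.symm q) hp hq' hwP (by
    intro x hx hxp
    simp only [Walk.support_cons, List.mem_cons] at hx
    rcases hx with rfl | hx
    · rfl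
    · exact absurd hxp (hqP x hx))
  refine ⟨u, v, z, huv, ?_, ?_, hnuv, ?_, ?_, _, T1, ?_⟩
  · rintro rfl; exact hzP p.start_mem_support
  · rintro rfl; exact hzP p.end_mem_support
  · exact fun h => hzP (huout z h)
  · exact fun h => hzP (hvout z h)
  · rw [T2, Walk.length_cons]
    omega

/-- If `G` is connected and has no dominating path (for every path of
maximum order, the set of vertices outside it is not independent), then `G` has an
independent triple `{x, y, z}` together with a subgraph tree with at most `3` leaves on
at least `d(x) + d(y) + d(z) + 1` vertices; in particular `t₃ ≥ σ₃ + 1`. -/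
theorem t3_ge_sigma3_succ_of_no_dominating_path {V : Type*} [Fintype V]
    (G : SimpleGraph V) (hconn : G.Connected)
    (hdom : ∀ (u v : V) (p : G.Walk u v), p.IsPath → p.support.length = pathOrd G →
      ¬ IsIndep G {x | x ∉ p.support}) :
    (∃ x y z : V, x ≠ y ∧ x ≠ z ∧ y ≠ z ∧ ¬G.Adj x y ∧ ¬G.Adj x z ∧ ¬G.Adj y z ∧
      ∃ H : G.Subgraph, IsEndedTree H 3 ∧
        deg G x + deg G y + deg G z + 1 ≤ H.verts.ncard) ∧
    sigma3 G + 1 ≤ treeOrd G 3 := by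

  have hex := main_exists G hconn hdom
  refine ⟨hex, ?_⟩
  obtain ⟨x, y, z, hxy, hxz, hyz, nxy, nxz, nyz, H, hH, hle⟩ := hex
  have h1 : sigma3 G ≤ deg G x + deg G y + deg G z :=
    Nat.sInf_le ⟨x, y, z, hxy, hxz, hyz, nxy, nxz, nyz, rfl⟩
  have h2 : H.verts.ncard ≤ treeOrd G 3 := by
    refine le_csSup ⟨Fintype.card V, ?_⟩ ⟨H, hH, rfl⟩
    rintro _ ⟨K, -, rfl⟩
    rw [← Nat.card_eq_fintype_card, ← Set.ncard_univ]
    exact Set.ncard_le_ncard (Set.subset_univ _)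
  omega
end
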